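/- Let G be a connected reductive group over ℂ with Borel subgroup B, and let H be a closed subgroup of G containing the maximal unipotent subgroup U of B. Then there exists a parabolic subgroup P of G such that P' ⊆ H ⊆ P, where P' is the commutator (derived) subgroup of P. -/

import Mathlib

/-- `GL(n, ℂ)`. -/
abbrev GLn (n : ℕ) := Matrix.GeneralLinearGroup (Fin n) ℂ

/-- The matrix entries of an element of `GL(n, ℂ)`, as a point of `ℂ^{n×n}`. -/
def entriesOf {n : ℕ} (g : GLn n) : Fin n × Fin n → ℂ :=
  fun q => (g : Matrix (Fin n) (Fin n) ℂ) q.1 q.2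

/-- A subset of `GL(n, ℂ)` is algebraic (Zariski closed) if it is the common zero set of a
family of polynomials in the matrix entries. -/
def IsAlgebraicSubset {n : ℕ} (S : Set (GLn n)) : Prop :=
  ∃ T : Set (MvPolynomial (Fin n × Fin n) ℂ),
    S = {g : GLn n | ∀ p ∈ T, MvPolynomial.eval (entriesOf g) p = 0}

/-- The Zariski topology on `GL(n, ℂ)`. -/
def zariskiTop (n : ℕ) : TopologicalSpace (GLn n) :=
  TopologicalSpace.generateFrom {U : Set (GLn n) | IsAlgebraicSubset Uᶜ}

/-- Connectedness in the Zariski topology. -/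
def IsZConnected {n : ℕ} (S : Set (GLn n)) : Prop :=
  @IsPreconnected (GLn n) (zariskiTop n) S

/-- A unipotent element of `GL(n, ℂ)`. -/
def IsUnipotentElt {n : ℕ} (g : GLn n) : Prop :=
  ((g : Matrix (Fin n) (Fin n) ℂ) - 1) ^ n = 0

/-- A unipotent subgroup of `G`. -/
def IsUnipotentSub {n : ℕ} (G U : Subgroup (GLn n)) : Prop :=
  U ≤ G ∧ ∀ g ∈ U, IsUnipotentElt g

/-- A maximal unipotent subgroup of `G`. -/
def IsMaxUnipotentIn {n : ℕ} (G U : Subgroup (GLn n)) : Prop :=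
  IsUnipotentSub G U ∧ ∀ V : Subgroup (GLn n), IsUnipotentSub G V → U ≤ V → V = U

/-- A Borel subgroup of `G`: a maximal Zariski-closed connected solvable subgroup. -/
def IsBorelIn {n : ℕ} (G B : Subgroup (GLn n)) : Prop :=
  (B ≤ G ∧ IsAlgebraicSubset (B : Set (GLn n)) ∧ IsZConnected (B : Set (GLn n)) ∧
    IsSolvable B) ∧
  ∀ B' : Subgroup (GLn n),
    (B' ≤ G ∧ IsAlgebraicSubset (B' : Set (GLn n)) ∧ IsZConnected (B' : Set (GLn n)) ∧
      IsSolvable B') → B ≤ B' → B' = B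

/-- A parabolic subgroup of `G`: a Zariski-closed subgroup containing a Borel subgroup. -/
def IsParabolicIn {n : ℕ} (G P : Subgroup (GLn n)) : Prop :=
  P ≤ G ∧ IsAlgebraicSubset (P : Set (GLn n)) ∧ ∃ B, IsBorelIn G B ∧ B ≤ P

/-- `G` is connected and reductive: `G` is a Zariski-closed connected subgroup with no
nontrivial Zariski-closed connected normal unipotent subgroup. -/
def IsConnectedReductive {n : ℕ} (G : Subgroup (GLn n)) : Prop :=
  IsAlgebraicSubset (G : Set (GLn n)) ∧ IsZConnected (G : Set (GLn n)) ∧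
  ∀ N : Subgroup (GLn n), N ≤ G → (∀ g ∈ G, ∀ x ∈ N, g * x * g⁻¹ ∈ N) →
    IsAlgebraicSubset (N : Set (GLn n)) → IsZConnected (N : Set (GLn n)) →
    (∀ x ∈ N, IsUnipotentElt x) → N = ⊥

section AffineFunctionAlgebras

variable {X Y : Type}

/-- Pullback of functions along a map. -/
def pullback (m : Y → X) : (X → ℂ) →ₐ[ℂ] (Y → ℂ) where
  toFun f := f ∘ m
  map_one' := rfl
  map_mul' _ _ := rfl
  map_zero' := rfl
  map_add' _ _ := rfl
  commutes' _ := rfl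

/-- `A` is an affine algebra of functions on `X`: finitely generated, and each of its
characters is the evaluation at a point. -/
def IsAffine (A : Subalgebra ℂ (X → ℂ)) : Prop :=
  A.FG ∧ ∀ φ : A →ₐ[ℂ] ℂ, ∃ x, ∀ f : A, φ f = f.1 x

/-- The closure of `S` with respect to the functions in `A`. -/
def zcl (A : Subalgebra ℂ (X → ℂ)) (S : Set X) : Set X :=
  {x | ∀ f ∈ A, (∀ s ∈ S, f s = 0) → f x = 0}

/-- `S` is closed with respect to the functions in `A`. -/
def ZC (A : Subalgebra ℂ (X → ℂ)) (S : Set X) : Prop := zcl A S ⊆ S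

theorem subset_zcl (A : Subalgebra ℂ (X → ℂ)) (S : Set X) : S ⊆ zcl A S :=
  fun x hx f _ h => h x hx

theorem zcl_mono (A : Subalgebra ℂ (X → ℂ)) {S S' : Set X} (h : S ⊆ S') : zcl A S ⊆ zcl A S' :=
  fun _ hx f hf h' => hx f hf fun s hs => h' s (h hs)

theorem zc_zcl (A : Subalgebra ℂ (X → ℂ)) (S : Set X) : ZC A (zcl A S) :=
  fun _ hx f hf h => hx f hf fun _ hs => hs f hf h

theorem zcl_min {A : Subalgebra ℂ (X → ℂ)} {S S' : Set X} (hS' : ZC A S') (h : S ⊆ S') :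
    zcl A S ⊆ S' := ((zcl_mono A h).trans hS')

/-- The common zero set of a family of functions of `A` is closed. -/
theorem zc_zeros {A : Subalgebra ℂ (X → ℂ)} (F : Set (X → ℂ)) (hF : F ⊆ A) :
    ZC A {x | ∀ f ∈ F, f x = 0} :=
  fun _ hx f hf => hx f (hF hf) fun _ hs => hs f hf

theorem ZC.inter {A : Subalgebra ℂ (X → ℂ)} {S S' : Set X} (h : ZC A S) (h' : ZC A S') :
    ZC A (S ∩ S') :=
  fun _ hx => ⟨h (zcl_mono A Set.inter_subset_left hx), h' (zcl_mono A Set.inter_subset_right hx)⟩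

theorem ZC.iInter {A : Subalgebra ℂ (X → ℂ)} {ι : Sort*} {S : ι → Set X} (h : ∀ i, ZC A (S i)) :
    ZC A (⋂ i, S i) :=
  fun _ hx => Set.mem_iInter.2 fun i => h i (zcl_mono A (Set.iInter_subset _ i) hx)

theorem zc_univ (A : Subalgebra ℂ (X → ℂ)) : ZC A Set.univ := Set.subset_univ _

theorem zc_empty (A : Subalgebra ℂ (X → ℂ)) : ZC A ∅ :=
  fun _ hx => absurd (hx 1 A.one_mem (by simp)) (by simp)

theorem ZC.union {A : Subalgebra ℂ (X → ℂ)} {S S' : Set X} (h : ZC A S) (h' : ZC A S') :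
    ZC A (S ∪ S') := by
  intro x hx
  by_contra hn
  simp only [Set.mem_union, not_or] at hn
  obtain ⟨h1, h2⟩ := hn
  have h1' : x ∉ zcl A S := fun hh => h1 (h hh)
  have h2' : x ∉ zcl A S' := fun hh => h2 (h' hh)
  simp only [zcl, Set.mem_setOf_eq, not_forall] at h1' h2'
  obtain ⟨f, hf, hf0, hfx⟩ := h1'
  obtain ⟨g, hg, hg0, hgx⟩ := h2'
  have := hx (f * g) (A.mul_mem hf hg) (by
    rintro s (hs | hs)
    · simp [hf0 s hs]
    · simp [hg0 s hs])
  rcases mul_eq_zero.1 this with h | h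
  exacts [hfx h, hgx h]

theorem ZC.preimage {A : Subalgebra ℂ (X → ℂ)} {A' : Subalgebra ℂ (Y → ℂ)} {m : Y → X}
    (hm : ∀ f ∈ A, f ∘ m ∈ A') {S : Set X} (h : ZC A S) : ZC A' (m ⁻¹' S) :=
  fun y hy => h fun f hf hf0 => hy (f ∘ m) (hm f hf) fun s hs => hf0 _ hs

/-- The ideal of functions in `A` vanishing on `S`. -/
def vanIdeal (A : Subalgebra ℂ (X → ℂ)) (S : Set X) : Ideal A where
  carrier := {f | ∀ s ∈ S, f.1 s = 0}
  add_mem' := fun ha hb s hs => by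
    simp [ha s hs, hb s hs]
  zero_mem' := fun _ _ => rfl
  smul_mem' := fun c f hf s hs => by
    simp [hf s hs]

theorem IsAffine.noetherian {A : Subalgebra ℂ (X → ℂ)} (hA : IsAffine A) : IsNoetherianRing A := by
  have : Algebra.FiniteType ℂ A := A.fg_iff_finiteType.1 hA.1
  exact Algebra.FiniteType.isNoetherianRing ℂ A

theorem exists_min_ZC {A : Subalgebra ℂ (X → ℂ)} (hA : IsAffine A) (P : Set X → Prop)
    (h : ∃ S, ZC A S ∧ P S) :
    ∃ S, ZC A S ∧ P S ∧ ∀ S', ZC A S' → P S' → S' ⊆ S → S' = S := by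
  have := hA.noetherian
  have hne : {J : Ideal A | ∃ S, ZC A S ∧ P S ∧ J = vanIdeal A S}.Nonempty := by
    obtain ⟨S, h1, h2⟩ := h
    exact ⟨_, S, h1, h2, rfl⟩
  obtain ⟨J, ⟨S, h1, h2, rfl⟩, hmax⟩ := set_has_maximal_iff_noetherian.2 this _ hne
  refine ⟨S, h1, h2, fun S' h1' h2' hs => hs.antisymm fun x hx => ?_⟩
  by_contra hx'
  have hle : vanIdeal A S ≤ vanIdeal A S' := fun f hf s hs' => hf s (hs hs')
  have hnlt := hmax (vanIdeal A S') ⟨S', h1', h2', rfl⟩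
  have heq : vanIdeal A S = vanIdeal A S' := by
    by_contra hne
    exact hnlt (lt_of_le_of_ne hle hne)
  refine hx' (h1' fun f hf hf0 => ?_)
  have hmem : (⟨f, hf⟩ : A) ∈ vanIdeal A S' := hf0
  rw [← heq] at hmem
  exact hmem x hx

theorem exists_algHom_of_ne_top {R : Type} [CommRing R] [Algebra ℂ R] [Algebra.FiniteType ℂ R]
    (J : Ideal R) (hJ : J ≠ ⊤) : ∃ φ : R →ₐ[ℂ] ℂ, ∀ f ∈ J, φ f = 0 := by
  obtain ⟨M, hM, hJM⟩ := Ideal.exists_le_maximal J hJ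
  letI : Field (R ⧸ M) := Ideal.Quotient.field M
  have : Algebra.FiniteType ℂ (R ⧸ M) :=
    Algebra.FiniteType.of_surjective (Ideal.Quotient.mkₐ ℂ M) (Ideal.Quotient.mkₐ_surjective ℂ M)
  have := finite_of_finite_type_of_isJacobsonRing ℂ (R ⧸ M)
  have hbij : Function.Bijective (algebraMap ℂ (R ⧸ M)) :=
    IsAlgClosed.algebraMap_bijective_of_isIntegral
  let e : ℂ ≃ₐ[ℂ] (R ⧸ M) := AlgEquiv.ofBijective (Algebra.ofId ℂ _) hbij
  refine ⟨e.symm.toAlgHom.comp (Ideal.Quotient.mkₐ ℂ M), fun f hf => ?_⟩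
  simp [Ideal.Quotient.eq_zero_iff_mem.2 (hJM hf)]

theorem IsAffine.exists_point {A : Subalgebra ℂ (X → ℂ)} (hA : IsAffine A) (J : Ideal A)
    (hJ : J ≠ ⊤) : ∃ x, ∀ f ∈ J, f.1 x = 0 := by
  have : Algebra.FiniteType ℂ A := A.fg_iff_finiteType.1 hA.1
  obtain ⟨φ, hφ⟩ := exists_algHom_of_ne_top J hJ
  obtain ⟨x, hx⟩ := hA.2 φ
  exact ⟨x, fun f hf => by rw [← hx, hφ f hf]⟩

/-- Restriction of an affine algebra to a closed subset is affine. -/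
theorem IsAffine.restrict {A : Subalgebra ℂ (X → ℂ)} (hA : IsAffine A) {S : Set X}
    (hS : ZC A S) : IsAffine (A.map (pullback (Subtype.val : S → X))) := by
  refine ⟨hA.1.map _, fun φ => ?_⟩
  let r : A →ₐ[ℂ] A.map (pullback (Subtype.val : S → X)) :=
    ((pullback (Subtype.val : S → X)).comp A.val).codRestrict _ fun f => ⟨f.1, f.2, rfl⟩
  obtain ⟨x, hx⟩ := hA.2 (φ.comp r)
  have hxS : x ∈ S := hS fun f hf hf0 => by
    refine (hx ⟨f, hf⟩).symm.trans ?_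
    have h0 : r ⟨f, hf⟩ = 0 := Subtype.ext (funext fun s => hf0 s.1 s.2)
    simp [h0]
  refine ⟨⟨x, hxS⟩, fun f => ?_⟩
  obtain ⟨f, g, hg, rfl⟩ := f
  exact hx ⟨g, hg⟩

/-- The algebra of functions on a product generated by functions of the two variables. -/
def prodAlg (A : Subalgebra ℂ (X → ℂ)) (B : Subalgebra ℂ (Y → ℂ)) :
    Subalgebra ℂ (X × Y → ℂ) := A.map (pullback Prod.fst) ⊔ B.map (pullback Prod.snd)

theorem IsAffine.prod {A : Subalgebra ℂ (X → ℂ)} {B : Subalgebra ℂ (Y → ℂ)} (hA : IsAffine A)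
    (hB : IsAffine B) : IsAffine (prodAlg A B) := by
  refine ⟨(hA.1.map _).sup (hB.1.map _), fun φ => ?_⟩
  have h1 : ∀ f ∈ A, f ∘ Prod.fst ∈ prodAlg A B := fun f hf =>
    (le_sup_left : _ ≤ prodAlg A B) ⟨f, hf, rfl⟩
  have h2 : ∀ f ∈ B, f ∘ Prod.snd ∈ prodAlg A B := fun f hf =>
    (le_sup_right : _ ≤ prodAlg A B) ⟨f, hf, rfl⟩
  obtain ⟨x, hx⟩ := hA.2 (φ.comp (((pullback Prod.fst).comp A.val).codRestrict _
    fun f => h1 f.1 f.2))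
  obtain ⟨y, hy⟩ := hB.2 (φ.comp (((pullback Prod.snd).comp B.val).codRestrict _
    fun f => h2 f.1 f.2))
  refine ⟨(x, y), fun f => ?_⟩
  have hsup : prodAlg A B = Algebra.adjoin ℂ
      (((A.map (pullback Prod.fst) : Subalgebra ℂ (X × Y → ℂ)) : Set (X × Y → ℂ)) ∪
      ((B.map (pullback Prod.snd) : Subalgebra ℂ (X × Y → ℂ)) : Set (X × Y → ℂ))) := by
    rw [Algebra.adjoin_union, Algebra.adjoin_eq, Algebra.adjoin_eq]; rfl
  have key : ∀ (f : X × Y → ℂ) (hf : f ∈ prodAlg A B), φ ⟨f, hf⟩ = f (x, y) := by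
    intro f hf
    refine Algebra.adjoin_induction (p := fun f hf => φ ⟨f, hsup ▸ hf⟩ = f (x, y)) ?_ ?_ ?_ ?_
      (hsup ▸ hf : f ∈ Algebra.adjoin ℂ _)
    · rintro f (⟨g, hg, rfl⟩ | ⟨g, hg, rfl⟩)
      · exact hx ⟨g, hg⟩
      · exact hy ⟨g, hg⟩
    · exact fun r => φ.commutes r
    · intro a b ha hb iha ihb
      exact (φ.map_add ⟨a, hsup ▸ ha⟩ ⟨b, hsup ▸ hb⟩).trans (congrArg₂ (· + ·) iha ihb)
    · intro a b ha hb iha ihb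
      exact (φ.map_mul ⟨a, hsup ▸ ha⟩ ⟨b, hsup ▸ hb⟩).trans (congrArg₂ (· * ·) iha ihb)
  exact key f.1 f.2

end AffineFunctionAlgebras

section RegularFunctions

variable {n : ℕ} {X : Type}

/-- The algebra of regular functions on `GLn n`. -/
def Reg (n : ℕ) : Subalgebra ℂ (GLn n → ℂ) :=
  Algebra.adjoin ℂ (Set.range (fun (q : Fin n × Fin n) (g : GLn n) => g.1 q.1 q.2) ∪
    Set.range (fun (q : Fin n × Fin n) (g : GLn n) => (g⁻¹).1 q.1 q.2))

theorem reg_entry (i j : Fin n) : (fun g : GLn n => g.1 i j) ∈ Reg n :=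
  Algebra.subset_adjoin (Or.inl ⟨(i, j), rfl⟩)

theorem reg_inv_entry (i j : Fin n) : (fun g : GLn n => (g⁻¹).1 i j) ∈ Reg n :=
  Algebra.subset_adjoin (Or.inr ⟨(i, j), rfl⟩)

@[elab_as_elim]
theorem reg_induction {P : (f : GLn n → ℂ) → f ∈ Reg n → Prop}
    (h1 : ∀ i j, P (fun g => g.1 i j) (reg_entry i j))
    (h2 : ∀ i j, P (fun g => (g⁻¹).1 i j) (reg_inv_entry i j))
    (h3 : ∀ c : ℂ, P (fun _ => c) ((Reg n).algebraMap_mem c))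
    (h4 : ∀ f g hf hg, P f hf → P g hg → P (f + g) ((Reg n).add_mem hf hg))
    (h5 : ∀ f g hf hg, P f hf → P g hg → P (f * g) ((Reg n).mul_mem hf hg))
    {f : GLn n → ℂ} (hf : f ∈ Reg n) : P f hf := by
  refine Algebra.adjoin_induction (p := P) ?_ h3 h4 h5 hf
  rintro f (⟨q, rfl⟩ | ⟨q, rfl⟩)
  · exact h1 _ _
  · exact h2 _ _

/-- A matrix-valued map all of whose entries are in `A`. -/
def MatIn (A : Subalgebra ℂ (X → ℂ)) (M : X → Matrix (Fin n) (Fin n) ℂ) : Prop :=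
  ∀ i j, (fun x => M x i j) ∈ A

theorem MatIn.const (A : Subalgebra ℂ (X → ℂ)) (M : Matrix (Fin n) (Fin n) ℂ) :
    MatIn A fun _ => M := fun i j => A.algebraMap_mem (M i j)

theorem sum_mem_fun {A : Subalgebra ℂ (X → ℂ)} {ι : Type*} (s : Finset ι) (f : ι → X → ℂ)
    (h : ∀ i ∈ s, f i ∈ A) : (fun x => ∑ i ∈ s, f i x) ∈ A := by
  have : (fun x => ∑ i ∈ s, f i x) = ∑ i ∈ s, f i := by ext x; simp
  rw [this]; exact A.sum_mem h

theorem prod_mem_fun {A : Subalgebra ℂ (X → ℂ)} {ι : Type*} (s : Finset ι) (f : ι → X → ℂ)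
    (h : ∀ i ∈ s, f i ∈ A) : (fun x => ∏ i ∈ s, f i x) ∈ A := by
  have : (fun x => ∏ i ∈ s, f i x) = ∏ i ∈ s, f i := by ext x; simp
  rw [this]; exact A.prod_mem h

theorem const_mem_fun (A : Subalgebra ℂ (X → ℂ)) (c : ℂ) : (fun _ => c) ∈ A := A.algebraMap_mem c

theorem mul_mem_fun {A : Subalgebra ℂ (X → ℂ)} {f g : X → ℂ} (hf : f ∈ A) (hg : g ∈ A) :
    (fun x => f x * g x) ∈ A := A.mul_mem hf hg

theorem sub_mem_fun {A : Subalgebra ℂ (X → ℂ)} {f g : X → ℂ} (hf : f ∈ A) (hg : g ∈ A) :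
    (fun x => f x - g x) ∈ A := A.sub_mem hf hg

theorem add_mem_fun {A : Subalgebra ℂ (X → ℂ)} {f g : X → ℂ} (hf : f ∈ A) (hg : g ∈ A) :
    (fun x => f x + g x) ∈ A := A.add_mem hf hg

theorem pow_mem_fun {A : Subalgebra ℂ (X → ℂ)} {f : X → ℂ} (hf : f ∈ A) (k : ℕ) :
    (fun x => f x ^ k) ∈ A := A.pow_mem hf k

theorem MatIn.mul {A : Subalgebra ℂ (X → ℂ)} {M N : X → Matrix (Fin n) (Fin n) ℂ}
    (hM : MatIn A M) (hN : MatIn A N) : MatIn A fun x => M x * N x := fun i j => by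
  simp only [Matrix.mul_apply]
  exact sum_mem_fun _ _ fun k _ => mul_mem_fun (hM i k) (hN k j)

theorem det_mem_fun {ι : Type*} [Fintype ι] [DecidableEq ι] {A : Subalgebra ℂ (X → ℂ)}
    {M : X → Matrix ι ι ℂ}
    (hM : ∀ i j, (fun x => M x i j) ∈ A) : (fun x => (M x).det) ∈ A := by
  simp only [Matrix.det_apply']
  exact sum_mem_fun _ _ fun σ _ => mul_mem_fun (const_mem_fun _ _)
    (prod_mem_fun _ _ fun i _ => hM _ _)

/-- A map to `GLn n` pulling back regular functions to functions in `A`. -/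
def RegMap (A : Subalgebra ℂ (X → ℂ)) (φ : X → GLn n) : Prop := ∀ f ∈ Reg n, f ∘ φ ∈ A

theorem regMap_iff {A : Subalgebra ℂ (X → ℂ)} {φ : X → GLn n} :
    RegMap A φ ↔ MatIn A (fun x => (φ x).1) ∧ MatIn A (fun x => (φ x)⁻¹.1) := by
  refine ⟨fun h => ⟨fun i j => h _ (reg_entry i j), fun i j => h _ (reg_inv_entry i j)⟩,
    fun h f hf => ?_⟩
  induction hf using reg_induction with
  | h1 i j => exact h.1 i j
  | h2 i j => exact h.2 i j
  | h3 c => exact const_mem_fun _ c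
  | h4 f g _ _ hf hg => exact A.add_mem hf hg
  | h5 f g _ _ hf hg => exact A.mul_mem hf hg

theorem RegMap.mul {A : Subalgebra ℂ (X → ℂ)} {φ ψ : X → GLn n} (h : RegMap A φ)
    (h' : RegMap A ψ) : RegMap A fun x => φ x * ψ x := by
  rw [regMap_iff] at *
  refine ⟨h.1.mul h'.1, ?_⟩
  simp only [mul_inv_rev]
  exact h'.2.mul h.2

theorem RegMap.inv {A : Subalgebra ℂ (X → ℂ)} {φ : X → GLn n} (h : RegMap A φ) :
    RegMap A fun x => (φ x)⁻¹ := by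
  rw [regMap_iff] at *
  simpa using h.symm

theorem RegMap.const (A : Subalgebra ℂ (X → ℂ)) (g : GLn n) : RegMap A fun _ => g :=
  fun f _ => const_mem_fun A (f g)

theorem RegMap.id : RegMap (Reg n) fun x => x := fun _ hf => hf

theorem RegMap.comp {A : Subalgebra ℂ (X → ℂ)} {φ : X → GLn n} (h : RegMap A φ)
    {f : GLn n → ℂ} (hf : f ∈ Reg n) : (fun x => f (φ x)) ∈ A := h f hf

theorem isAffine_reg (n : ℕ) : IsAffine (Reg n) := by
  refine ⟨⟨(Set.toFinite (Set.range (fun (q : Fin n × Fin n) (g : GLn n) => g.1 q.1 q.2) ∪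
    Set.range (fun (q : Fin n × Fin n) (g : GLn n) => (g⁻¹).1 q.1 q.2))).toFinset, by
    rw [Set.Finite.coe_toFinset]; rfl⟩, fun φ => ?_⟩
  let M : Matrix (Fin n) (Fin n) ℂ := fun i j => φ ⟨_, reg_entry i j⟩
  let M' : Matrix (Fin n) (Fin n) ℂ := fun i j => φ ⟨_, reg_inv_entry i j⟩
  have h1 : M * M' = 1 := by
    ext i j
    have : (∑ k, (⟨_, reg_entry i k⟩ : Reg n) * ⟨_, reg_inv_entry k j⟩) =
        algebraMap ℂ (Reg n) ((1 : Matrix (Fin n) (Fin n) ℂ) i j) := by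
      apply Subtype.ext
      funext g
      have h := congrFun (congrFun g.mul_inv i) j
      simp only [AddSubmonoidClass.coe_finsetSum, Finset.sum_apply]
      rw [Matrix.mul_apply] at h
      exact h
    have h := congrArg φ this
    rw [AlgHom.commutes, map_sum] at h
    simp only [map_mul] at h
    exact h
  have h2 : M' * M = 1 := mul_eq_one_comm.1 h1
  refine ⟨⟨M, M', h1, h2⟩, ?_⟩
  have key : ∀ (f : GLn n → ℂ) (hf : f ∈ Reg n), φ ⟨f, hf⟩ = f ⟨M, M', h1, h2⟩ := by
    intro f hf
    induction hf using reg_induction with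
    | h1 i j => rfl
    | h2 i j => rfl
    | h3 c => exact φ.commutes c
    | h4 a b ha hb iha ihb =>
      exact (φ.map_add ⟨a, ha⟩ ⟨b, hb⟩).trans (congrArg₂ (· + ·) iha ihb)
    | h5 a b ha hb iha ihb =>
      exact (φ.map_mul ⟨a, ha⟩ ⟨b, hb⟩).trans (congrArg₂ (· * ·) iha ihb)
  exact fun f => key f.1 f.2

theorem reg_continuous {f : GLn n → ℂ} (hf : f ∈ Reg n) : Continuous f := by
  induction hf using reg_induction with
  | h1 i j => exact (Units.continuous_val.matrix_elem i j)
  | h2 i j => exact ((Units.continuous_val.comp continuous_inv).matrix_elem i j)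
  | h3 c => exact continuous_const
  | h4 f g _ _ hf hg => exact hf.add hg
  | h5 f g _ _ hf hg => exact hf.mul hg

theorem ZC.isClosed {S : Set (GLn n)} (h : ZC (Reg n) S) : IsClosed S := by
  have : S = ⋂ f : {f : GLn n → ℂ // f ∈ Reg n ∧ ∀ s ∈ S, f s = 0}, {x | f.1 x = 0} := by
    ext x
    simp only [Set.mem_iInter, Set.mem_setOf_eq]
    exact ⟨fun hx f => f.2.2 x hx, fun hx => h fun f hf hf0 => hx ⟨f, hf, hf0⟩⟩
  rw [this]
  exact isClosed_iInter fun f => isClosed_eq (reg_continuous f.2.1) continuous_const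

theorem reg_eval (p : MvPolynomial (Fin n × Fin n) ℂ) :
    (fun g : GLn n => MvPolynomial.eval (entriesOf g) p) ∈ Reg n := by
  induction p using MvPolynomial.induction_on with
  | C a => simpa using const_mem_fun _ a
  | add p q hp hq => simpa using add_mem_fun hp hq
  | mul_X p q hp => simpa [entriesOf] using mul_mem_fun hp (reg_entry q.1 q.2)

theorem reg_exists_poly {f : GLn n → ℂ} (hf : f ∈ Reg n) :
    ∃ (k : ℕ) (p : MvPolynomial (Fin n × Fin n) ℂ),
      ∀ g : GLn n, g.1.det ^ k * f g = MvPolynomial.eval (entriesOf g) p := by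
  have hdet : ∃ d : MvPolynomial (Fin n × Fin n) ℂ,
      ∀ g : GLn n, MvPolynomial.eval (entriesOf g) d = g.1.det :=
    ⟨(Matrix.of fun i j => MvPolynomial.X (i, j)).det, fun g => by
      rw [RingHom.map_det]; congr 1; ext i j; simp [entriesOf]⟩
  obtain ⟨d, hd⟩ := hdet
  induction hf using reg_induction with
  | h1 i j => exact ⟨0, MvPolynomial.X (i, j), fun g => by simp [entriesOf]⟩
  | h2 i j =>
    refine ⟨1, (Matrix.adjugate (Matrix.of fun i j => MvPolynomial.X (i, j))) i j, fun g => ?_⟩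
    have h1 : (MvPolynomial.eval (entriesOf g)).mapMatrix
        (Matrix.of fun i j => MvPolynomial.X (i, j)) = g.1 := by
      ext i j; simp [entriesOf]
    have h2 := RingHom.map_adjugate (MvPolynomial.eval (entriesOf g))
      (Matrix.of fun i j => MvPolynomial.X (i, j))
    rw [h1] at h2
    have h3 : MvPolynomial.eval (entriesOf g)
        ((Matrix.adjugate (Matrix.of fun i j => MvPolynomial.X (i, j))) i j) =
        g.1.adjugate i j := by rw [← h2]; rfl
    rw [h3]
    have h4 : g.1.adjugate = g.1.det • (g⁻¹).1 := by
      have := congrArg (· * (g⁻¹).1) (Matrix.adjugate_mul g.1)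
      simpa [Matrix.mul_assoc] using this
    simp [h4]
  | h3 c => exact ⟨0, MvPolynomial.C c, fun g => by simp⟩
  | h4 f g _ _ hf hg =>
    obtain ⟨k, p, hp⟩ := hf
    obtain ⟨l, q, hq⟩ := hg
    refine ⟨k + l, d ^ l * p + d ^ k * q, fun g => ?_⟩
    simp only [map_add, map_mul, map_pow, hd, ← hp, ← hq, Pi.add_apply]
    ring
  | h5 f g _ _ hf hg =>
    obtain ⟨k, p, hp⟩ := hf
    obtain ⟨l, q, hq⟩ := hg
    refine ⟨k + l, p * q, fun g => ?_⟩
    simp only [map_mul, ← hp, ← hq, Pi.mul_apply]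
    ring

theorem det_ne_zero' (g : GLn n) : g.1.det ≠ 0 :=
  ((Matrix.isUnit_iff_isUnit_det _).1 g.isUnit).ne_zero

theorem isAlgebraicSubset_iff {S : Set (GLn n)} : IsAlgebraicSubset S ↔ ZC (Reg n) S := by
  constructor
  · rintro ⟨T, rfl⟩
    intro x hx p hp
    exact hx _ (reg_eval p) fun s hs => hs p hp
  · intro h
    refine ⟨{p | ∀ s ∈ S, MvPolynomial.eval (entriesOf s) p = 0}, ?_⟩
    ext x
    refine ⟨fun hx p hp => hp x hx, fun hx => h fun f hf hf0 => ?_⟩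
    obtain ⟨k, p, hp⟩ := reg_exists_poly hf
    have := hp x
    rw [hx p fun s hs => by rw [← hp, hf0 s hs, mul_zero]] at this
    exact (mul_eq_zero.1 this).resolve_left (pow_ne_zero _ (det_ne_zero' x))

end RegularFunctions

section Constructible

theorem exists_basicOpen_subset_range_comap {R S : Type} [CommRing R] [CommRing S]
    [IsNoetherianRing R] [Nontrivial S] (f : R →+* S) (hf : f.FinitePresentation) :
    ∃ r, f r ≠ 0 ∧ ∀ q : PrimeSpectrum R, RingHom.ker f ≤ q.asIdeal → r ∉ q.asIdeal →
      q ∈ Set.range (PrimeSpectrum.comap f) := by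
  classical
  have hker : RingHom.ker f ≠ ⊤ := RingHom.ker_ne_top f
  obtain ⟨η, hη⟩ := Ideal.nonempty_minimalPrimes hker
  have hfin := Ideal.finite_minimalPrimes_of_isNoetherianRing R (RingHom.ker f)
  have hηp : η.IsPrime := hη.1.1
  obtain ⟨r0, hr0, hr0'⟩ : ∃ r0, r0 ∉ η ∧
      ∀ p ∈ (RingHom.ker f).minimalPrimes, p ≠ η → r0 ∈ p := by
    have h1 : ∀ p ∈ hfin.toFinset.erase η, ∃ x ∈ p, x ∉ η := by
      intro p hp
      simp only [Finset.mem_erase, Set.Finite.mem_toFinset] at hp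
      by_contra hcon
      push Not at hcon
      exact hp.1 (le_antisymm hcon (hη.2 hp.2.1 hcon))
    choose! x hx hx' using h1
    refine ⟨∏ p ∈ hfin.toFinset.erase η, x p, ?_, fun p hp hne => ?_⟩
    · rw [hηp.prod_mem_iff]
      push Not
      exact hx'
    · have hm : p ∈ hfin.toFinset.erase η := by simp [hne, hp]
      exact Ideal.mem_of_dvd p (Finset.dvd_prod_of_mem x hm) (hx p hm)
  let e : PrimeSpectrum R := ⟨η, hηp⟩
  let D : Set (PrimeSpectrum R) := {q | RingHom.ker f ≤ q.asIdeal ∧ r0 ∉ q.asIdeal}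
  have hD : ∀ q ∈ D, η ≤ q.asIdeal := by
    rintro q ⟨h1, h2⟩
    obtain ⟨p, hp, hpq⟩ := Ideal.exists_minimalPrimes_le h1
    by_cases hpe : p = η
    · rwa [← hpe]
    · exact absurd (hpq (hr0' p hp hpe)) h2
  have key : ∀ s : Set (PrimeSpectrum R), Topology.IsConstructible s →
      (e ∈ s → ∃ V, IsOpen V ∧ e ∈ V ∧ V ∩ D ⊆ s) ∧
      (e ∉ s → ∃ V, IsOpen V ∧ e ∈ V ∧ V ∩ D ⊆ sᶜ) := by
    intro s hs
    induction hs using Topology.IsConstructible.empty_union_induction with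
    | open_retrocompact U hU _ =>
      refine ⟨fun h => ⟨U, hU, h, Set.inter_subset_left⟩, fun h => ⟨Set.univ, isOpen_univ,
        trivial, fun q hq hqU => h ?_⟩⟩
      have hsp : e ⤳ q := (PrimeSpectrum.le_iff_specializes e q).1 (hD q hq.2)
      exact hsp.mem_open hU hqU
    | union s hs t ht hs' ht' =>
      refine ⟨?_, fun h => ?_⟩
      · rintro (h | h)
        · obtain ⟨V, h1, h2, h3⟩ := hs'.1 h
          exact ⟨V, h1, h2, h3.trans Set.subset_union_left⟩
        · obtain ⟨V, h1, h2, h3⟩ := ht'.1 h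
          exact ⟨V, h1, h2, h3.trans Set.subset_union_right⟩
      · obtain ⟨V, h1, h2, h3⟩ := hs'.2 fun hh => h (Or.inl hh)
        obtain ⟨V', h1', h2', h3'⟩ := ht'.2 fun hh => h (Or.inr hh)
        refine ⟨V ∩ V', h1.inter h1', ⟨h2, h2'⟩, fun q hq => ?_⟩
        rintro (hh | hh)
        · exact h3 ⟨hq.1.1, hq.2⟩ hh
        · exact h3' ⟨hq.1.2, hq.2⟩ hh
    | compl s hs hs' =>
      refine ⟨hs'.2, fun h => ?_⟩
      rw [compl_compl]
      exact hs'.1 (not_not.1 h)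
  have hmem : e ∈ Set.range (PrimeSpectrum.comap f) := by
    obtain ⟨p', hp', _, hc⟩ := Ideal.exists_comap_eq_of_mem_minimalPrimes (I := ⊥) f η hη
    exact ⟨⟨p', hp'⟩, PrimeSpectrum.ext hc⟩
  obtain ⟨V, hV, heV, hVD⟩ := (key _ (PrimeSpectrum.isConstructible_range_comap hf)).1 hmem
  obtain ⟨_, ⟨_, ⟨r1, rfl⟩, rfl⟩, hr1, hr1V⟩ :=
    PrimeSpectrum.isBasis_basic_opens.exists_subset_of_mem_open heV hV
  refine ⟨r0 * r1, fun h0 => ?_, fun q hq hrq => hVD ⟨hr1V ?_, hq, fun h => hrq ?_⟩⟩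
  · have : r0 * r1 ∈ η := hη.1.2 h0
    rcases hηp.mem_or_mem this with h | h
    · exact hr0 h
    · exact hr1 h
  · exact fun h => hrq (Ideal.mul_mem_left _ _ h)
  · exact Ideal.mul_mem_right _ _ h

variable {X Y : Type}

theorem IsAffine.exists_open_in_image [Nonempty X] {A : Subalgebra ℂ (X → ℂ)}
    {B : Subalgebra ℂ (Y → ℂ)} (hA : IsAffine A) (hB : IsAffine B) {m : X → Y}
    (hm : ∀ f ∈ B, f ∘ m ∈ A) :
    ∃ p ∈ B, (∃ x, p (m x) ≠ 0) ∧ ∀ y ∈ zcl B (Set.range m), p y ≠ 0 →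
      ∃ x, ∀ f ∈ B, f y = f (m x) := by
  have := hB.noetherian
  have hAf : Algebra.FiniteType ℂ A := A.fg_iff_finiteType.1 hA.1
  let φ : B →ₐ[ℂ] A := ((pullback m).comp B.val).codRestrict _ fun f => hm f.1 f.2
  have : Nontrivial A := by
    refine ⟨0, 1, fun h => ?_⟩
    have := congrFun (congrArg Subtype.val h) (Classical.arbitrary X)
    exact zero_ne_one this
  have hfp : φ.toRingHom.FinitePresentation := by
    refine RingHom.FinitePresentation.of_finiteType.1 ?_
    refine RingHom.FiniteType.of_comp_finiteType (f := algebraMap ℂ B) ?_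
    have : φ.toRingHom.comp (algebraMap ℂ B) = algebraMap ℂ A := φ.comp_algebraMap
    rw [this]
    exact RingHom.finiteType_algebraMap.2 hAf
  obtain ⟨r, hr, hr'⟩ := exists_basicOpen_subset_range_comap φ.toRingHom hfp
  refine ⟨r.1, r.2, ?_, fun y hy hry => ?_⟩
  · by_contra hcon
    push Not at hcon
    exact hr (Subtype.ext (funext hcon))
  let ev : B →ₐ[ℂ] ℂ := (Pi.evalAlgHom ℂ _ y).comp B.val
  have hmax : (RingHom.ker ev).IsMaximal := RingHom.ker_isMaximal_of_surjective _ fun c =>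
    ⟨algebraMap ℂ B c, ev.commutes c⟩
  obtain ⟨P, hP⟩ := hr' ⟨RingHom.ker ev, hmax.isPrime⟩ (fun f hf => by
    refine hy f.1 f.2 ?_
    rintro _ ⟨x, rfl⟩
    exact congrFun (congrArg Subtype.val (hf : φ f = 0)) x) hry
  obtain ⟨x, hx⟩ := hA.exists_point P.asIdeal P.2.ne_top
  refine ⟨x, fun f hf => ?_⟩
  have hc : (⟨f, hf⟩ - algebraMap ℂ B (f y) : B) ∈ RingHom.ker ev := by
    have : ev ⟨f, hf⟩ = f y := rfl
    rw [RingHom.mem_ker, map_sub, AlgHom.commutes, this]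
    simp
  have hP' : Ideal.comap φ.toRingHom P.asIdeal = RingHom.ker ev := congrArg PrimeSpectrum.asIdeal hP
  rw [← hP'] at hc
  have h0 := hx _ (Ideal.mem_comap.1 hc)
  have h1 : f (m x) - f y = 0 := h0
  exact (sub_eq_zero.1 h1).symm

theorem IsAffine.finite_range_of_bounded {A : Subalgebra ℂ (X → ℂ)} (hA : IsAffine A)
    {f : X → ℂ} (hf : f ∈ A) {C : ℝ} (hC : ∀ x, ‖f x‖ ≤ C) : (Set.range f).Finite := by
  classical
  have hne : ∀ (c : Set.Ioi C) (x : X), f x - (c.1 : ℂ) ≠ 0 := by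
    intro c x h
    have h1 : ‖f x‖ = |c.1| := by rw [sub_eq_zero.1 h]; simp
    have h2 := hC x
    have h3 : C < c.1 := c.2
    have h4 := le_abs_self c.1
    linarith
  have hinv : ∀ c : Set.Ioi C, (fun x => (f x - (c.1 : ℂ))⁻¹) ∈ A := by
    intro c
    let g : A := ⟨fun x => f x - (c.1 : ℂ), sub_mem_fun hf (const_mem_fun A _)⟩
    have htop : Ideal.span {g} = ⊤ := by
      by_contra hcon
      obtain ⟨x, hx⟩ := hA.exists_point _ hcon
      exact hne c x (hx g (Ideal.mem_span_singleton_self g))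
    obtain ⟨h, hh⟩ := Ideal.mem_span_singleton'.1 ((Ideal.eq_top_iff_one _).1 htop)
    have : (fun x => (f x - (c.1 : ℂ))⁻¹) = h.1 := by
      ext x
      have : h.1 x * (f x - (c.1 : ℂ)) = 1 := congrFun (congrArg Subtype.val hh) x
      exact (eq_inv_of_mul_eq_one_left this).symm
    rw [this]; exact h.2
  have hrank : Module.rank ℂ A ≤ Cardinal.aleph0 := by
    have : Algebra.FiniteType ℂ A := A.fg_iff_finiteType.1 hA.1
    obtain ⟨k, φ, hφ⟩ := Algebra.FiniteType.iff_quotient_mvPolynomial''.1 this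
    refine (LinearMap.rank_le_of_surjective φ.toLinearMap hφ).trans ?_
    rw [MvPolynomial.rank_eq_lift]
    simpa using Cardinal.power_nat_le (n := k) le_rfl
  have hnli : ¬ LinearIndependent ℂ (fun c : Set.Ioi C => (⟨_, hinv c⟩ : A)) := by
    intro h
    have h1 := h.cardinal_le_rank
    rw [Cardinal.mk_Ioi_real] at h1
    exact absurd (h1.trans hrank) (not_le.2 Cardinal.aleph0_lt_continuum)
  rw [linearIndependent_iff'] at hnli
  push Not at hnli
  obtain ⟨s, a, hsum, c0, hc0, ha⟩ := hnli
  have hsum' : ∀ x, ∑ c ∈ s, a c * (f x - (c.1 : ℂ))⁻¹ = 0 := by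
    intro x
    have := congrFun (congrArg Subtype.val hsum) x
    simpa [AddSubmonoidClass.coe_finsetSum, Finset.sum_apply] using this
  let p : Polynomial ℂ := ∑ c ∈ s, Polynomial.C (a c) *
    ∏ d ∈ s.erase c, (Polynomial.X - Polynomial.C (d.1 : ℂ))
  have hp : ∀ z : ℂ, p.eval z = ∑ c ∈ s, a c * ∏ d ∈ s.erase c, (z - (d.1 : ℂ)) := by
    intro z
    simp [p, Polynomial.eval_finsetSum, Polynomial.eval_prod]
  have hp0 : p ≠ 0 := by
    intro h0
    have h1 := hp (c0.1 : ℂ)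
    rw [h0, Polynomial.eval_zero, Finset.sum_eq_single c0] at h1
    · refine mul_ne_zero ha (Finset.prod_ne_zero_iff.2 fun d hd => ?_) h1.symm
      rw [sub_ne_zero]
      exact fun h => (Finset.mem_erase.1 hd).1 (Subtype.ext (Complex.ofReal_injective h)).symm
    · intro c _ hne
      rw [Finset.prod_eq_zero (Finset.mem_erase.2 ⟨hne.symm, hc0⟩) (sub_self _), mul_zero]
    · exact fun h => absurd hc0 h
  refine (p.roots.toFinset.finite_toSet).subset ?_
  rintro _ ⟨x, rfl⟩
  simp only [Finset.mem_coe, Multiset.mem_toFinset, Polynomial.mem_roots hp0, Polynomial.IsRoot]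
  rw [hp]
  have : ∀ c ∈ s, a c * ∏ d ∈ s.erase c, (f x - (d.1 : ℂ)) =
      (∏ d ∈ s, (f x - (d.1 : ℂ))) * (a c * (f x - (c.1 : ℂ))⁻¹) := by
    intro c hc
    rw [← Finset.mul_prod_erase s _ hc]
    field_simp [hne c x]
  rw [Finset.sum_congr rfl this, ← Finset.mul_sum, hsum' x, mul_zero]

/-- A regular function bounded on a closed set takes finitely many values there. -/
theorem IsAffine.finite_image_of_bounded {A : Subalgebra ℂ (X → ℂ)} (hA : IsAffine A) {S : Set X}
    (hS : ZC A S) {f : X → ℂ} (hf : f ∈ A) {C : ℝ} (hC : ∀ x ∈ S, ‖f x‖ ≤ C) :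
    (f '' S).Finite := by
  have := (hA.restrict hS).finite_range_of_bounded (f := f ∘ Subtype.val) ⟨f, hf, rfl⟩
    (C := C) (fun x => hC x.1 x.2)
  rwa [Set.range_comp, Subtype.range_coe] at this

end Constructible

section Irreducible

variable {X : Type}

/-- `S` is irreducible for the functions in `A`. -/
def Irr (A : Subalgebra ℂ (X → ℂ)) (S : Set X) : Prop :=
  S.Nonempty ∧ ∀ f ∈ A, ∀ g ∈ A, (∀ s ∈ S, f s * g s = 0) →
    (∀ s ∈ S, f s = 0) ∨ (∀ s ∈ S, g s = 0)

theorem Irr.prod_eq_zero {A : Subalgebra ℂ (X → ℂ)} {S : Set X} (h : Irr A S) {ι : Type*}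
    (t : Finset ι) (f : ι → X → ℂ) (hf : ∀ i ∈ t, f i ∈ A)
    (h0 : ∀ s ∈ S, ∏ i ∈ t, f i s = 0) : ∃ i ∈ t, ∀ s ∈ S, f i s = 0 := by
  classical
  induction t using Finset.induction_on with
  | empty =>
    obtain ⟨s, hs⟩ := h.1
    exact absurd (h0 s hs) (by simp)
  | insert a t ha ih =>
    have hf' : ∀ i ∈ t, f i ∈ A := fun i hi => hf i (Finset.mem_insert_of_mem hi)
    rcases h.2 (f a) (hf a (Finset.mem_insert_self _ _)) (fun x => ∏ i ∈ t, f i x)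
      (prod_mem_fun _ _ hf') (fun s hs => by have := h0 s hs; rwa [Finset.prod_insert ha] at this) with h1 | h1
    · exact ⟨a, Finset.mem_insert_self _ _, h1⟩
    · obtain ⟨i, hi, hi'⟩ := ih hf' h1
      exact ⟨i, Finset.mem_insert_of_mem hi, (hi')⟩

/-- A function with finitely many values on an irreducible set is constant there. -/
theorem Irr.const_of_finite {A : Subalgebra ℂ (X → ℂ)} {S : Set X} (h : Irr A S) {f : X → ℂ}
    (hf : f ∈ A) (hfin : (f '' S).Finite) : ∃ c, ∀ s ∈ S, f s = c := by
  obtain ⟨c, _, hc⟩ := h.prod_eq_zero hfin.toFinset (fun c x => f x - c)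
    (fun c _ => sub_mem_fun hf (const_mem_fun A c)) (fun s hs =>
      Finset.prod_eq_zero (hfin.mem_toFinset.2 ⟨s, hs, rfl⟩) (sub_self _))
  exact ⟨c, fun s hs => sub_eq_zero.1 (hc s hs)⟩

theorem Irr.const_of_bounded {A : Subalgebra ℂ (X → ℂ)} (hA : IsAffine A) {S : Set X}
    (hS : ZC A S) (h : Irr A S) {f : X → ℂ} (hf : f ∈ A) {C : ℝ} (hC : ∀ x ∈ S, ‖f x‖ ≤ C) :
    ∃ c, ∀ s ∈ S, f s = c :=
  h.const_of_finite hf (hA.finite_image_of_bounded hS hf hC)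

end Irreducible

open scoped Pointwise

section ClosedSubgroups

variable {n : ℕ}

theorem regMap_mulLeft (a : GLn n) : RegMap (Reg n) fun x => a * x :=
  (RegMap.const _ a).mul RegMap.id

theorem regMap_mulRight (a : GLn n) : RegMap (Reg n) fun x => x * a :=
  RegMap.id.mul (RegMap.const _ a)

theorem regMap_conj (a : GLn n) : RegMap (Reg n) fun x => a * x * a⁻¹ :=
  (regMap_mulLeft a).mul (RegMap.const _ a⁻¹)

theorem reg_separates {x y : GLn n} (h : ∀ f ∈ Reg n, f x = f y) : x = y :=
  Units.ext (Matrix.ext fun i j => h _ (reg_entry i j))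

/-- The Zariski closure of a subgroup. -/
def zclSubgroup (K : Subgroup (GLn n)) : Subgroup (GLn n) where
  carrier := zcl (Reg n) K
  one_mem' := subset_zcl _ _ K.one_mem
  mul_mem' := by
    intro a b ha hb
    have h1 : ∀ x ∈ K, ∀ y ∈ zcl (Reg n) (K : Set (GLn n)), x * y ∈ zcl (Reg n) (K : Set (GLn n)) :=
      fun x hx y hy f hf hf0 => hy _ ((regMap_mulLeft x).comp hf) fun s hs =>
        hf0 _ (K.mul_mem hx hs)
    exact fun f hf hf0 => ha _ ((regMap_mulRight b).comp hf) fun s hs => h1 s hs b hb f hf hf0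
  inv_mem' := fun {a} ha f hf hf0 => ha _ ((RegMap.id.inv).comp hf) fun s hs =>
    hf0 _ (K.inv_mem hs)

theorem le_zclSubgroup (K : Subgroup (GLn n)) : K ≤ zclSubgroup K := subset_zcl _ _

theorem zc_zclSubgroup (K : Subgroup (GLn n)) : ZC (Reg n) (zclSubgroup K : Set (GLn n)) :=
  zc_zcl _ _

theorem zclSubgroup_le {K L : Subgroup (GLn n)} (hL : ZC (Reg n) (L : Set (GLn n))) (h : K ≤ L) :
    zclSubgroup K ≤ L := zcl_min hL h

/-- `Γ` has no proper closed subgroup of finite index. -/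
def NoFin (Γ : Subgroup (GLn n)) : Prop :=
  ∀ K ≤ Γ, ZC (Reg n) (K : Set (GLn n)) → K.relIndex Γ ≠ 0 → K = Γ

/-- The ring homomorphism on regular functions induced by left translation. -/
def transl (a : GLn n) : Reg n →+* Reg n where
  toFun f := ⟨fun z => f.1 (a * z), (regMap_mulLeft a).comp f.2⟩
  map_one' := rfl
  map_mul' _ _ := rfl
  map_zero' := rfl
  map_add' _ _ := rfl

theorem irr_of_noFin {Γ : Subgroup (GLn n)} (hΓ : ZC (Reg n) (Γ : Set (GLn n))) (h : NoFin Γ) :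
    Irr (Reg n) (Γ : Set (GLn n)) := by
  have := (isAffine_reg n).noetherian
  set I := vanIdeal (Reg n) (Γ : Set (GLn n)) with hI
  have hItop : I ≠ ⊤ := by
    intro h
    have h1 : (1 : Reg n) ∈ I := h ▸ Submodule.mem_top
    exact one_ne_zero (h1 1 Γ.one_mem)
  obtain ⟨p, hp⟩ := Ideal.nonempty_minimalPrimes hItop
  have hpp : p.IsPrime := hp.1.1
  let V : Ideal (Reg n) → Set (GLn n) := fun q => {x | ∀ f ∈ q, f.1 x = 0}
  have hVz : ∀ q, ZC (Reg n) (V q) := fun q x hx f hf => hx f.1 f.2 fun s hs => hs f hf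
  have hVne : (V p).Nonempty := (isAffine_reg n).exists_point p hpp.ne_top
  have hVΓ : V p ⊆ Γ := fun x hx => hΓ fun f hf hf0 => hx ⟨f, hf⟩ (hp.1.2 hf0)
  have hItr : ∀ a ∈ Γ, ∀ f ∈ I, transl a f ∈ I := fun a ha f hf s hs =>
    hf _ (Γ.mul_mem ha hs)
  have htt : ∀ (a : GLn n) f, transl a (transl a⁻¹ f) = f := fun a f =>
    Subtype.ext (funext fun z => by simp [transl])
  have hmin : ∀ a ∈ Γ, p.comap (transl a) ∈ I.minimalPrimes := by
    intro a ha
    refine ⟨⟨Ideal.comap_isPrime _ _, fun f hf => hp.1.2 (hItr a ha f hf)⟩, ?_⟩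
    rintro q ⟨hq, hIq⟩ hqp
    have h1 : p ≤ q.comap (transl a⁻¹) := by
      refine hp.2 ⟨Ideal.comap_isPrime _ _, fun f hf => hIq (hItr _ (Γ.inv_mem ha) f hf)⟩ ?_
      intro f hf
      have := hqp (Ideal.mem_comap.1 hf)
      rw [Ideal.mem_comap, htt] at this
      exact this
    intro f hf
    have := h1 (Ideal.mem_comap.1 hf)
    rw [Ideal.mem_comap] at this
    have h2 := htt a⁻¹ f
    rw [inv_inv] at h2
    rwa [h2] at this
  have hVtr : ∀ a : GLn n, V (p.comap (transl a)) = a • V p := by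
    intro a
    ext x
    rw [Set.mem_smul_set_iff_inv_smul_mem]
    constructor
    · intro hx f hf
      have h0 : transl a⁻¹ f ∈ p.comap (transl a) := by rw [Ideal.mem_comap, htt]; exact hf
      exact hx _ h0
    · intro hx f hf
      have := hx _ (Ideal.mem_comap.1 hf)
      simpa [transl] using this
  have hst : (MulAction.stabilizer Γ (V p)).index ≠ 0 := by
    rw [MulAction.index_stabilizer]
    refine Set.ncard_ne_zero_of_mem (MulAction.mem_orbit_self _) ?_
    refine ((Ideal.finite_minimalPrimes_of_isNoetherianRing _ I).image V).subset ?_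
    rintro _ ⟨a, rfl⟩
    exact ⟨_, hmin a.1 a.2, hVtr a.1⟩
  set K : Subgroup (GLn n) := (MulAction.stabilizer Γ (V p)).map Γ.subtype with hK
  have hKΓ : K ≤ Γ := by
    rintro _ ⟨a, _, rfl⟩
    exact a.2
  have hKmem : ∀ a, a ∈ K ↔ a ∈ Γ ∧ ∀ z ∈ V p, a * z ∈ V p ∧ a⁻¹ * z ∈ V p := by
    intro a
    constructor
    · rintro ⟨a, ha, rfl⟩
      have h1 : a.1 • V p = V p := ha
      refine ⟨a.2, fun z hz => ⟨?_, ?_⟩⟩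
      · rw [← h1]; exact Set.smul_mem_smul_set hz
      · rw [← h1, Set.mem_smul_set_iff_inv_smul_mem] at hz; exact hz
    · rintro ⟨ha, hz⟩
      refine ⟨⟨a, ha⟩, ?_, rfl⟩
      refine Set.Subset.antisymm ?_ fun z hz' => ?_
      · rintro _ ⟨z, hz', rfl⟩
        exact (hz z hz').1
      · exact ⟨a⁻¹ * z, (hz z hz').2, by simp [Subgroup.smul_def]⟩
  have hKz : ZC (Reg n) (K : Set (GLn n)) := by
    intro a ha
    refine (hKmem a).2 ⟨hΓ (zcl_mono _ hKΓ ha), fun z hz => ⟨hVz p fun f hf hf0 => ?_,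
      hVz p fun f hf hf0 => ?_⟩⟩
    · exact ha _ ((regMap_mulRight z).comp hf) fun s hs => hf0 _ (((hKmem s).1 hs).2 z hz).1
    · exact ha _ ((RegMap.id.inv.mul (RegMap.const _ z)).comp hf) fun s hs =>
        hf0 _ (((hKmem s).1 hs).2 z hz).2
  have hKi : K.relIndex Γ ≠ 0 := by
    have : K.subgroupOf Γ = MulAction.stabilizer Γ (V p) :=
      Subgroup.comap_map_eq_self_of_injective Γ.subtype_injective _
    rwa [Subgroup.relIndex, this]
  have hKeq := h K hKΓ hKz hKi
  obtain ⟨z0, hz0⟩ := hVne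
  have hΓV : ∀ a ∈ Γ, a ∈ V p := fun a ha => by
    have h1 : a * z0⁻¹ ∈ K := hKeq ▸ Γ.mul_mem ha (Γ.inv_mem (hVΓ hz0))
    simpa using (((hKmem _).1 h1).2 z0 hz0).1
  refine ⟨⟨1, Γ.one_mem⟩, fun f hf g hg hfg => ?_⟩
  have h1 : (⟨f, hf⟩ * ⟨g, hg⟩ : Reg n) ∈ p := hp.1.2 hfg
  rcases hpp.mem_or_mem h1 with h | h
  · exact Or.inl fun s hs => hΓV s hs _ h
  · exact Or.inr fun s hs => hΓV s hs _ h

theorem ZC.smul {S : Set (GLn n)} (h : ZC (Reg n) S) (a : GLn n) : ZC (Reg n) (a • S) := by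
  rw [← Set.preimage_smul_inv]
  exact h.preimage (regMap_mulLeft a⁻¹)

theorem zc_finite_iUnion {ι : Type*} [Finite ι] {S : ι → Set (GLn n)}
    (h : ∀ i, ZC (Reg n) (S i)) : ZC (Reg n) (⋃ i, S i) := by
  have key : ∀ t : Set ι, t.Finite → ZC (Reg n) (⋃ i ∈ t, S i) := by
    intro t ht
    induction t, ht using Set.Finite.induction_on with
    | empty => simpa using zc_empty _
    | insert _ _ ih => rw [Set.biUnion_insert]; exact (h _).union ih
  simpa using key Set.univ Set.finite_univ

theorem ZC.isClosed_zariskiTop {S : Set (GLn n)} (h : ZC (Reg n) S) :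
    @IsClosed _ (zariskiTop n) S := by
  letI := zariskiTop n
  refine ⟨TopologicalSpace.isOpen_generateFrom_of_mem ?_⟩
  change IsAlgebraicSubset _
  rw [compl_compl]
  exact isAlgebraicSubset_iff.2 h

theorem noFin_of_isZConnected {Γ : Subgroup (GLn n)} (h : IsZConnected (Γ : Set (GLn n))) :
    NoFin Γ := by
  intro K hK hKz hKi
  letI := zariskiTop n
  have hfin : Finite (Γ ⧸ K.subgroupOf Γ) := Nat.finite_of_card_ne_zero hKi
  have hcl : ZC (Reg n) (⋃ q : {q : Γ ⧸ K.subgroupOf Γ // q ≠ (1 : Γ)},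
      (q.1.out.1 • (K : Set (GLn n)))) := zc_finite_iUnion fun q => hKz.smul _
  have h1 := isPreconnected_closed_iff.1 h (K : Set (GLn n)) _ hKz.isClosed_zariskiTop
    hcl.isClosed_zariskiTop
  by_contra hne
  obtain ⟨g, hg, hgK⟩ : ∃ g ∈ Γ, g ∉ K := by
    by_contra hcon
    push Not at hcon
    exact hne (le_antisymm hK hcon)
  have hcov : ∀ g ∈ Γ, g ∉ K → g ∈ ⋃ q : {q : Γ ⧸ K.subgroupOf Γ // q ≠ (1 : Γ)},
      (q.1.out.1 • (K : Set (GLn n))) := by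
    intro g hg hgK
    refine Set.mem_iUnion.2 ⟨⟨((⟨g, hg⟩ : Γ) : Γ ⧸ K.subgroupOf Γ), fun h => hgK ?_⟩, ?_⟩
    · have := QuotientGroup.eq.1 h.symm
      simpa [Subgroup.mem_subgroupOf] using this
    · have := QuotientGroup.mk_out_eq_mul (K.subgroupOf Γ) ⟨g, hg⟩
      obtain ⟨k, hk⟩ := this
      rw [hk, Set.mem_smul_set_iff_inv_smul_mem]
      have : (k : Γ).1 ∈ K := Subgroup.mem_subgroupOf.1 k.2
      simpa using this
  obtain ⟨x, hx, hxK, hx'⟩ := h1 (fun x hx => by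
      by_cases hxK : x ∈ K
      · exact Or.inl hxK
      · exact Or.inr (hcov x hx hxK)) ⟨1, Γ.one_mem, K.one_mem⟩ ⟨g, hg, hcov g hg hgK⟩
  obtain ⟨q, hq⟩ := Set.mem_iUnion.1 hx'
  rw [Set.mem_smul_set_iff_inv_smul_mem] at hq
  have hqK : q.1.out.1 ∈ K := by
    have h2 : q.1.out.1⁻¹ * x ∈ K := hq
    have := K.mul_mem hxK (K.inv_mem h2)
    simpa using this
  refine q.2 ?_
  rw [← QuotientGroup.out_eq' q.1]
  exact QuotientGroup.eq.2 (by simpa [Subgroup.mem_subgroupOf] using hqK)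

theorem irr_of_isZConnected {Γ : Subgroup (GLn n)} (hz : IsAlgebraicSubset (Γ : Set (GLn n)))
    (h : IsZConnected (Γ : Set (GLn n))) : Irr (Reg n) (Γ : Set (GLn n)) :=
  irr_of_noFin (isAlgebraicSubset_iff.1 hz) (noFin_of_isZConnected h)

theorem ZC.conj {K : Subgroup (GLn n)} (h : ZC (Reg n) (K : Set (GLn n))) (a : GLn n) :
    ZC (Reg n) {x | a * x * a⁻¹ ∈ K} := h.preimage (regMap_conj a)

theorem exists_irr_subgroup {Γ : Subgroup (GLn n)} (hΓ : ZC (Reg n) (Γ : Set (GLn n))) :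
    ∃ K ≤ Γ, ZC (Reg n) (K : Set (GLn n)) ∧ K.relIndex Γ ≠ 0 ∧ Irr (Reg n) (K : Set (GLn n)) ∧
      ∀ g ∈ Γ, ∀ x ∈ K, g * x * g⁻¹ ∈ K := by
  obtain ⟨S, hS, ⟨K, rfl, hK, hKi⟩, hmin⟩ := exists_min_ZC (isAffine_reg n)
    (fun S => ∃ K : Subgroup (GLn n), (K : Set (GLn n)) = S ∧ K ≤ Γ ∧ K.relIndex Γ ≠ 0)
    ⟨Γ, hΓ, Γ, rfl, le_rfl, by simp⟩
  have hle : ∀ L ≤ Γ, ZC (Reg n) (L : Set (GLn n)) → L.relIndex Γ ≠ 0 → K ≤ L := by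
    intro L hL hLz hLi
    have h1 : ((K ⊓ L : Subgroup (GLn n)) : Set (GLn n)) = K :=
      hmin _ (by rw [Subgroup.coe_inf]; exact hS.inter hLz)
        ⟨K ⊓ L, rfl, inf_le_left.trans hK, Subgroup.relIndex_inf_ne_zero hKi hLi⟩
        (fun x hx => hx.1)
    intro x hx
    rw [← SetLike.mem_coe, ← h1] at hx
    exact hx.2
  refine ⟨K, hK, hS, hKi, irr_of_noFin hS fun L hL hLz hLi => ?_, fun g hg x hx => ?_⟩
  · refine le_antisymm hL (hle L (hL.trans hK) hLz ?_)
    rw [← Subgroup.relIndex_mul_relIndex L K Γ hL hK]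
    exact mul_ne_zero hLi hKi
  · have hz : ZC (Reg n) ((K.comap (MulAut.conj g).toMonoidHom : Subgroup (GLn n)) :
        Set (GLn n)) := hS.conj g
    have hcomap : Γ.comap (MulAut.conj g).toMonoidHom = Γ := by
      ext y
      simp only [Subgroup.mem_comap, MulEquiv.toMonoidHom_eq_coe, MonoidHom.coe_coe,
        MulAut.conj_apply]
      refine ⟨fun h => ?_, fun h => Γ.mul_mem (Γ.mul_mem hg h) (Γ.inv_mem hg)⟩
      have := Γ.mul_mem (Γ.mul_mem (Γ.inv_mem hg) h) hg
      simpa [mul_assoc] using this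
    have hi : (K.comap (MulAut.conj g).toMonoidHom).relIndex Γ ≠ 0 := by
      have h2 := Subgroup.relIndex_comap K (MulAut.conj g).toMonoidHom Γ
      rw [h2]
      have h3 : Γ.map (MulAut.conj g).toMonoidHom = Γ := by
        conv_lhs => rw [← hcomap]
        exact Subgroup.map_comap_eq_self_of_surjective (MulAut.conj g).surjective _
      rwa [h3]
    exact hle _ (by rw [← hcomap]; exact Subgroup.comap_mono hK) hz hi hx

end ClosedSubgroups

section Orbits

variable {n : ℕ}

/-- The group of invertible upper triangular matrices. -/
def Tri (n : ℕ) : Subgroup (GLn n) where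
  carrier := {g | ∀ i j, j < i → g.1 i j = 0}
  one_mem' := fun i j h => Matrix.one_apply_ne h.ne'
  mul_mem' := fun {a b} ha hb i j h => by
    rw [Units.val_mul, Matrix.mul_apply]
    refine Finset.sum_eq_zero fun k _ => ?_
    rcases lt_or_ge k i with hk | hk
    · rw [ha i k hk, zero_mul]
    · rw [hb k j (h.trans_le hk), mul_zero]
  inv_mem' := fun {a} ha i j h => by
    have h1 : a.1.BlockTriangular id := fun i j h => ha i j h
    have := a.invertible
    have h2 := Matrix.blockTriangular_inv_of_blockTriangular h1
    rw [← Matrix.coe_units_inv] at h2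
    exact h2 h

theorem mem_Tri {g : GLn n} : g ∈ Tri n ↔ ∀ i j, j < i → g.1 i j = 0 := Iff.rfl

theorem zc_Tri : ZC (Reg n) (Tri n : Set (GLn n)) :=
  fun _ hg i j h => hg _ (reg_entry i j) fun _ hs => hs i j h

/-- The stabilizer of the flag `y • T`. -/
def flagStab (y : GLn n) : Subgroup (GLn n) := (Tri n).comap (MulAut.conj y⁻¹).toMonoidHom

theorem mem_flagStab {y g : GLn n} : g ∈ flagStab y ↔ y⁻¹ * g * y ∈ Tri n := by
  simp [flagStab, Subgroup.mem_comap]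

theorem zc_flagStab (y : GLn n) : ZC (Reg n) (flagStab y : Set (GLn n)) := by
  have := (zc_Tri (n := n)).preimage (regMap_conj y⁻¹)
  exact this

/-- The `Γ`-`T` double coset of `y`. -/
def orb (Γ : Subgroup (GLn n)) (y : GLn n) : Set (GLn n) :=
  {z | ∃ γ ∈ Γ, ∃ t ∈ Tri n, z = γ * y * t}

/-- A set stable under `Γ` on the left and under triangular matrices on the right. -/
def Stable (Γ : Subgroup (GLn n)) (Y : Set (GLn n)) : Prop :=
  (∀ γ ∈ Γ, ∀ y ∈ Y, γ * y ∈ Y) ∧ ∀ t ∈ Tri n, ∀ y ∈ Y, y * t ∈ Y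

theorem mem_orb (Γ : Subgroup (GLn n)) (y : GLn n) : y ∈ orb Γ y :=
  ⟨1, Γ.one_mem, 1, (Tri n).one_mem, by simp⟩

theorem orb_stable (Γ : Subgroup (GLn n)) (y : GLn n) : Stable Γ (orb Γ y) := by
  constructor
  · rintro γ hγ _ ⟨δ, hδ, t, ht, rfl⟩
    exact ⟨γ * δ, Γ.mul_mem hγ hδ, t, ht, by simp [mul_assoc]⟩
  · rintro t ht _ ⟨δ, hδ, t', ht', rfl⟩
    exact ⟨δ, hδ, t' * t, (Tri n).mul_mem ht' ht, by simp [mul_assoc]⟩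

theorem Stable.orb_subset {Γ : Subgroup (GLn n)} {Y : Set (GLn n)} (h : Stable Γ Y) {y : GLn n}
    (hy : y ∈ Y) : orb Γ y ⊆ Y := by
  rintro _ ⟨δ, hδ, t, ht, rfl⟩
  exact h.2 t ht _ (h.1 δ hδ y hy)

theorem orb_eq_of_mem {Γ : Subgroup (GLn n)} {y z : GLn n} (h : z ∈ orb Γ y) :
    orb Γ z = orb Γ y := by
  refine ((orb_stable Γ y).orb_subset h).antisymm ((orb_stable Γ z).orb_subset ?_)
  obtain ⟨δ, hδ, t, ht, rfl⟩ := h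
  exact ⟨δ⁻¹, Γ.inv_mem hδ, t⁻¹, (Tri n).inv_mem ht, by group⟩

theorem Stable.zcl {Γ : Subgroup (GLn n)} {Y : Set (GLn n)} (h : Stable Γ Y) :
    Stable Γ (zcl (Reg n) Y) :=
  ⟨fun γ hγ _ hy f hf hf0 => hy _ ((regMap_mulLeft γ).comp hf) fun s hs => hf0 _ (h.1 γ hγ s hs),
    fun t ht _ hy f hf hf0 => hy _ ((regMap_mulRight t).comp hf) fun s hs => hf0 _ (h.2 t ht s hs)⟩

/-- There are closed orbits. -/
theorem exists_closed_orb {Γ : Subgroup (GLn n)} (hΓ : ZC (Reg n) (Γ : Set (GLn n)))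
    {Y : Set (GLn n)} (hY : ZC (Reg n) Y) (hne : Y.Nonempty) (hst : Stable Γ Y) :
    ∃ y ∈ Y, ZC (Reg n) (orb Γ y) := by
  obtain ⟨Z, hZ, ⟨hZY, ⟨y, hy⟩, hZst⟩, hmin⟩ := exists_min_ZC (isAffine_reg n)
    (fun S => S ⊆ Y ∧ S.Nonempty ∧ Stable Γ S) ⟨Y, hY, le_rfl, hne, hst⟩
  have hcl : zcl (Reg n) (orb Γ y) = Z :=
    hmin _ (zc_zcl _ _) ⟨(zcl_min hZ (hZst.orb_subset hy)).trans hZY,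
      ⟨y, subset_zcl _ _ (mem_orb Γ y)⟩, (orb_stable Γ y).zcl⟩ (zcl_min hZ (hZst.orb_subset hy))
  let m : ↥(Γ : Set (GLn n)) × ↥(Tri n : Set (GLn n)) → GLn n := fun p => p.1.1 * y * p.2.1
  have hA := ((isAffine_reg n).restrict hΓ).prod ((isAffine_reg n).restrict (zc_Tri (n := n)))
  have h1 : RegMap (prodAlg ((Reg n).map (pullback (Subtype.val : ↥(Γ : Set (GLn n)) → GLn n)))
      ((Reg n).map (pullback (Subtype.val : ↥(Tri n : Set (GLn n)) → GLn n))))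
      (fun p => p.1.1) := fun f hf =>
    Algebra.mem_sup_left (S := (Subalgebra.map (pullback Prod.fst) _)) ⟨_, ⟨f, hf, rfl⟩, rfl⟩
  have h2 : RegMap (prodAlg ((Reg n).map (pullback (Subtype.val : ↥(Γ : Set (GLn n)) → GLn n)))
      ((Reg n).map (pullback (Subtype.val : ↥(Tri n : Set (GLn n)) → GLn n))))
      (fun p => p.2.1) := fun f hf =>
    Algebra.mem_sup_right (T := (Subalgebra.map (pullback Prod.snd) _)) ⟨_, ⟨f, hf, rfl⟩, rfl⟩
  have hm : RegMap _ m := (h1.mul (RegMap.const _ y)).mul h2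
  have : Nonempty (↥(Γ : Set (GLn n)) × ↥(Tri n : Set (GLn n))) :=
    ⟨⟨⟨1, Γ.one_mem⟩, ⟨1, (Tri n).one_mem⟩⟩⟩
  obtain ⟨p, hp, ⟨x0, hx0⟩, himg⟩ := hA.exists_open_in_image (isAffine_reg n) hm
  have hrange : Set.range m = orb Γ y := by
    ext z
    constructor
    · rintro ⟨q, rfl⟩
      exact ⟨q.1.1, q.1.2, q.2.1, q.2.2, rfl⟩
    · rintro ⟨γ, hγ, t, ht, rfl⟩
      exact ⟨(⟨γ, hγ⟩, ⟨t, ht⟩), rfl⟩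
  rw [hrange, hcl] at himg
  have himg' : ∀ z ∈ Z, p z ≠ 0 → z ∈ orb Γ y := by
    intro z hz hpz
    obtain ⟨x, hx⟩ := himg z hz hpz
    rw [reg_separates hx, ← hrange]
    exact ⟨x, rfl⟩
  let W : Set (GLn n) := {z | z ∈ Z ∧ ∀ γ ∈ Γ, ∀ t ∈ Tri n, p (γ * z * t) = 0}
  have hW : ZC (Reg n) W := fun z hz => ⟨hZ (zcl_mono _ (fun _ h => h.1) hz), fun γ hγ t ht =>
    hz _ ((regMap_mulLeft γ).mul (RegMap.const _ t) |>.comp hp) fun s hs => hs.2 γ hγ t ht⟩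
  have hWst : Stable Γ W := by
    refine ⟨fun γ hγ z hz => ⟨hZst.1 γ hγ z hz.1, fun δ hδ t ht => ?_⟩,
      fun t ht z hz => ⟨hZst.2 t ht z hz.1, fun δ hδ t' ht' => ?_⟩⟩
    · rw [← mul_assoc]; exact hz.2 _ (Γ.mul_mem hδ hγ) t ht
    · have := hz.2 δ hδ _ ((Tri n).mul_mem ht ht')
      simpa [mul_assoc] using this
  have hWe : W = ∅ := by
    by_contra hne
    have h3 := hmin W hW ⟨fun z hz => hZY hz.1, Set.nonempty_iff_ne_empty.2 hne, hWst⟩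
      fun z hz => hz.1
    rw [← h3] at hy
    exact hx0 (hy.2 _ x0.1.2 _ x0.2.2)
  have hZO : Z ⊆ orb Γ y := by
    intro z hz
    have h3 : z ∉ W := hWe ▸ Set.notMem_empty z
    simp only [W, Set.mem_setOf_eq, not_and, not_forall] at h3
    obtain ⟨γ, hγ, t, ht, hne⟩ := h3 hz
    have h4 := himg' _ (hZst.2 t ht _ (hZst.1 γ hγ z hz)) hne
    have h5 := (orb_stable Γ y).2 _ ((Tri n).inv_mem ht) _
      ((orb_stable Γ y).1 _ (Γ.inv_mem hγ) _ h4)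
    have h6 : γ⁻¹ * (γ * z * t) * t⁻¹ = z := by group
    rwa [h6] at h5
  refine ⟨y, hZY hy, ?_⟩
  have : orb Γ y = Z := (hZst.orb_subset hy).antisymm hZO
  rwa [this]

end Orbits

section Compactness

variable {n : ℕ}

/-- The unitary matrices in `GLn n`. -/
def unitarySet (n : ℕ) : Set (GLn n) := {g | g.1 ∈ Matrix.unitaryGroup (Fin n) ℂ}

theorem isCompact_unitarySet : IsCompact (unitarySet n) := by
  have h : IsCompact ((Matrix.unitaryGroup (Fin n) ℂ : Submonoid (Matrix (Fin n) (Fin n) ℂ)) :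
      Set (Matrix (Fin n) (Fin n) ℂ)) := by
    refine IsCompact.of_isClosed_subset
      (isCompact_univ_pi fun _ : Fin n => isCompact_univ_pi fun _ : Fin n =>
        isCompact_closedBall (0 : ℂ) 1) ?_ ?_
    · have : ((Matrix.unitaryGroup (Fin n) ℂ : Submonoid (Matrix (Fin n) (Fin n) ℂ)) :
          Set (Matrix (Fin n) (Fin n) ℂ)) = {A | A * star A = 1} := by
        ext A
        exact Matrix.mem_unitaryGroup_iff
      rw [this]
      exact isClosed_singleton.preimage (continuous_id.mul continuous_star)
    · intro A hA i _ j _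
      simpa using entry_norm_bound_of_unitary hA i j
  have h2 := Submonoid.units_isCompact h
  have h3 : unitarySet n = ((Matrix.unitaryGroup (Fin n) ℂ :
      Submonoid (Matrix (Fin n) (Fin n) ℂ)).units : Set (GLn n)) := by
    ext g
    refine ⟨fun hg => ⟨hg, ?_⟩, fun hg => hg.1⟩
    have h4 : g⁻¹.1 = star g.1 := by
      have := congrArg (g⁻¹.1 * ·) (Matrix.mem_unitaryGroup_iff.1 hg)
      simpa [← mul_assoc] using this.symm
    change g⁻¹.1 ∈ Matrix.unitaryGroup (Fin n) ℂ
    rw [h4]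
    exact Unitary.star_mem hg
  rw [h3]
  exact h2

/-- The Gram-Schmidt (QR) decomposition. -/
theorem exists_unitary_tri (g : GLn n) : ∃ t ∈ Tri n, g * t ∈ unitarySet n := by
  let E := EuclideanSpace ℂ (Fin n)
  let f : Fin n → E := fun j => WithLp.toLp 2 fun i => g.1 i j
  let b := InnerProductSpace.gramSchmidtOrthonormalBasis (𝕜 := ℂ) (E := E) (by simp [E]) f
  let u : Matrix (Fin n) (Fin n) ℂ := Matrix.of fun i j => b j i
  have hu : star u * u = 1 := by
    ext i j
    have h1 := orthonormal_iff_ite.1 b.orthonormal i j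
    rw [PiLp.inner_apply] at h1
    rw [Matrix.mul_apply, Matrix.one_apply, ← h1]
    refine Finset.sum_congr rfl fun k _ => ?_
    simp [u, Matrix.star_apply, mul_comm]
  have hu' : u * star u = 1 := mul_eq_one_comm.1 hu
  let v : GLn n := ⟨u, star u, hu', hu⟩
  have hr : v⁻¹ * g ∈ Tri n := by
    intro i j hij
    have h1 := InnerProductSpace.gramSchmidtOrthonormalBasis_inv_triangular (𝕜 := ℂ) (E := E)
      (by simp [E]) f hij
    change inner ℂ (b i) (f j) = 0 at h1
    rw [PiLp.inner_apply] at h1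
    rw [Units.val_mul, Matrix.mul_apply, ← h1]
    refine Finset.sum_congr rfl fun k _ => ?_
    change star u i k * _ = _
    simp [u, f, Matrix.star_apply, mul_comm]
  refine ⟨(v⁻¹ * g)⁻¹, (Tri n).inv_mem hr, ?_⟩
  have : g * (v⁻¹ * g)⁻¹ = v := by group
  rw [this]
  exact Matrix.mem_unitaryGroup_iff.2 hu'

instance : LocallyCompactSpace (Matrix (Fin n) (Fin n) ℂ) :=
  inferInstanceAs (LocallyCompactSpace (Fin n → Fin n → ℂ))

instance : SecondCountableTopology (Matrix (Fin n) (Fin n) ℂ) :=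
  inferInstanceAs (SecondCountableTopology (Fin n → Fin n → ℂ))

instance : SecondCountableTopology (GLn n) := by
  have : SecondCountableTopology (Matrix (Fin n) (Fin n) ℂ)ᵐᵒᵖ :=
    MulOpposite.opHomeomorph.symm.isEmbedding.secondCountableTopology
  exact Units.isEmbedding_embedProduct.secondCountableTopology

/-- The action on an orbit. -/
def orbAction (Γ : Subgroup (GLn n)) (y : GLn n) : MulAction (Γ × Tri n) (orb Γ y) where
  smul p z := ⟨p.1 * z.1 * p.2.1⁻¹, (orb_stable Γ y).2 _ ((Tri n).inv_mem p.2.2) _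
    ((orb_stable Γ y).1 _ p.1.2 _ z.2)⟩
  one_smul z := Subtype.ext (by change 1 * z.1 * 1⁻¹ = z.1; simp)
  mul_smul p q z := Subtype.ext (by
    change (p.1.1 * q.1.1) * z.1 * (p.2.1 * q.2.1)⁻¹ = p.1.1 * (q.1.1 * z.1 * q.2.1⁻¹) * p.2.1⁻¹
    group)

theorem exists_compact_of_closed_orb {Γ : Subgroup (GLn n)}
    (hΓ : IsClosed (Γ : Set (GLn n))) {y : GLn n} (hy : IsClosed (orb Γ y)) :
    ∃ K : Set (GLn n), IsCompact K ∧ K ⊆ Γ ∧ ∀ γ ∈ Γ, ∃ k ∈ K, k⁻¹ * γ ∈ flagStab y := by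
  have hT : IsClosed (Tri n : Set (GLn n)) := zc_Tri.isClosed
  letI := orbAction Γ y
  have : LocallyCompactSpace Γ := hΓ.isClosedEmbedding_subtypeVal.locallyCompactSpace
  have : LocallyCompactSpace (Tri n) := hT.isClosedEmbedding_subtypeVal.locallyCompactSpace
  have : LocallyCompactSpace (orb Γ y) := hy.isClosedEmbedding_subtypeVal.locallyCompactSpace
  have : SecondCountableTopology Γ := TopologicalSpace.Subtype.secondCountableTopology _
  have : SecondCountableTopology (Tri n) := TopologicalSpace.Subtype.secondCountableTopology _
  have : SigmaCompactSpace (Γ × Tri n) := sigmaCompactSpace_of_locallyCompact_secondCountable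
  have : ContinuousSMul (Γ × Tri n) (orb Γ y) := ⟨by
    refine Continuous.subtype_mk (f := fun p : (Γ × Tri n) × orb Γ y =>
      p.1.1.1 * p.2.1 * p.1.2.1⁻¹) ?_ _
    fun_prop⟩
  have : MulAction.IsPretransitive (Γ × Tri n) (orb Γ y) := ⟨by
    intro z w
    have hw : w.1 ∈ orb Γ z.1 := (orb_eq_of_mem z.2).symm ▸ w.2
    obtain ⟨γ, hγ, t, ht, h⟩ := hw
    exact ⟨(⟨γ, hγ⟩, ⟨t⁻¹, (Tri n).inv_mem ht⟩), Subtype.ext (by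
      change γ * z.1 * t⁻¹⁻¹ = w.1
      rw [inv_inv, h])⟩⟩
  have hopen := isOpenMap_smul_of_sigmaCompact (G := Γ × Tri n) (X := orb Γ y) ⟨y, mem_orb Γ y⟩
  choose N hN hNc using fun γ : Γ => exists_compact_mem_nhds γ
  have hC : IsCompact ((Subtype.val : orb Γ y → GLn n) ⁻¹' unitarySet n) :=
    hy.isClosedEmbedding_subtypeVal.isCompact_preimage isCompact_unitarySet
  obtain ⟨s, hs⟩ := hC.elim_finite_subcover
    (fun γ : Γ => (fun g : Γ × Tri n => g • (⟨y, mem_orb Γ y⟩ : orb Γ y)) ''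
      (interior (N γ) ×ˢ Set.univ)) (fun γ => hopen _ (isOpen_interior.prod isOpen_univ)) (by
      rintro ⟨z, γ, hγ, t, ht, rfl⟩ -
      refine Set.mem_iUnion.2 ⟨⟨γ, hγ⟩, (⟨γ, hγ⟩, ⟨t⁻¹, (Tri n).inv_mem ht⟩),
        ⟨mem_interior_iff_mem_nhds.2 (hNc _), trivial⟩, Subtype.ext ?_⟩
      change γ * y * t⁻¹⁻¹ = γ * y * t
      rw [inv_inv])
  refine ⟨⋃ γ ∈ s, Subtype.val '' N γ, s.isCompact_biUnion fun γ _ =>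
    (hN γ).image continuous_subtype_val, ?_, ?_⟩
  · simp only [Set.iUnion_subset_iff]
    rintro γ _ _ ⟨δ, _, rfl⟩
    exact δ.2
  · intro γ hγ
    obtain ⟨t, ht, hu⟩ := exists_unitary_tri (γ * y)
    have := hs (show (⟨γ * y * t, γ, hγ, t, ht, rfl⟩ : orb Γ y) ∈ _ from hu)
    simp only [Set.mem_iUnion] at this
    obtain ⟨δ, hδ, ⟨k, t'⟩, ⟨hk, -⟩, hkt⟩ := this
    have hkt' : k.1 * y * t'.1⁻¹ = γ * y * t := congrArg Subtype.val hkt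
    refine ⟨k.1, Set.mem_biUnion hδ ⟨k, interior_subset hk, rfl⟩, ?_⟩
    rw [mem_flagStab]
    have : y⁻¹ * (k.1⁻¹ * γ) * y = t'.1⁻¹ * t⁻¹ := by
      have h2 : γ = k.1 * y * t'.1⁻¹ * t⁻¹ * y⁻¹ := by rw [hkt']; group
      rw [h2]; group
    rw [this]
    exact (Tri n).mul_mem ((Tri n).inv_mem t'.2) ((Tri n).inv_mem ht)

/-- A regular function on `Γ` invariant under the stabilizer of a flag with closed orbit is
constant. -/
theorem const_of_invariant {Γ : Subgroup (GLn n)} (hΓ : ZC (Reg n) (Γ : Set (GLn n)))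
    (hirr : Irr (Reg n) (Γ : Set (GLn n))) {y : GLn n} (hy : ZC (Reg n) (orb Γ y))
    {f : GLn n → ℂ} (hf : f ∈ Reg n)
    (hinv : ∀ γ ∈ Γ, ∀ q ∈ Γ, q ∈ flagStab y → f (γ * q) = f γ) : ∃ c, ∀ γ ∈ Γ, f γ = c := by
  obtain ⟨K, hK, hKΓ, h⟩ := exists_compact_of_closed_orb hΓ.isClosed hy.isClosed
  obtain ⟨C, hC⟩ := hK.exists_bound_of_continuousOn (reg_continuous hf).continuousOn
  refine hirr.const_of_bounded (isAffine_reg n) hΓ hf (C := C) fun γ hγ => ?_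
  obtain ⟨k, hk, hkγ⟩ := h γ hγ
  have := hinv k (hKΓ hk) _ (Γ.mul_mem (Γ.inv_mem (hKΓ hk)) hγ) hkγ
  rw [mul_inv_cancel_left] at this
  rw [this]
  exact hC k hk

end Compactness

open scoped Matrix commutatorElement

section LieKolchin

variable {n : ℕ}

theorem commutator_le_self (Γ : Subgroup (GLn n)) : ⁅Γ, Γ⁆ ≤ Γ :=
  Subgroup.commutator_le.2 fun a ha b hb =>
    Γ.mul_mem (Γ.mul_mem (Γ.mul_mem ha hb) (Γ.inv_mem ha)) (Γ.inv_mem hb)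

/-- Regular functions with finitely many values on `Γ` are constant on `Γ`. -/
def FC (Γ : Subgroup (GLn n)) : Prop :=
  ∀ f ∈ Reg n, (f '' (Γ : Set (GLn n))).Finite → ∀ γ ∈ Γ, f γ = f 1

theorem fc_of_irr {Γ : Subgroup (GLn n)} (h : Irr (Reg n) (Γ : Set (GLn n))) : FC Γ := by
  intro f hf hfin γ hγ
  obtain ⟨c, hc⟩ := h.const_of_finite hf hfin
  rw [hc γ hγ, hc 1 Γ.one_mem]

theorem FC.commutator {Γ : Subgroup (GLn n)} (h : FC Γ) : FC ⁅Γ, Γ⁆ := by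
  intro f hf hfin γ hγ
  have hle : ⁅Γ, Γ⁆ ≤ Γ := commutator_le_self Γ
  have key : ∀ a ∈ Γ, ∀ b ∈ Γ, ∀ x ∈ ⁅Γ, Γ⁆, f (x * ⁅a, b⁆) = f x := by
    intro a ha b hb x hx
    have h1 : RegMap (Reg n) fun b : GLn n => x * (a * b * a⁻¹ * b⁻¹) :=
      (RegMap.const _ x).mul ((regMap_conj a).mul RegMap.id.inv)
    have h2 := h _ (h1.comp hf) (hfin.subset (by
      rintro _ ⟨b, hb, rfl⟩
      exact ⟨_, Subgroup.mul_mem _ hx (Subgroup.commutator_mem_commutator ha hb), rfl⟩)) b hb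
    simpa [commutatorElement_def] using h2
  have key2 : ∀ w ∈ ⁅Γ, Γ⁆, ∀ x ∈ ⁅Γ, Γ⁆, f (x * w) = f x := by
    intro w hw
    rw [Subgroup.commutator_def] at hw
    induction hw using Subgroup.closure_induction with
    | mem w hw =>
      obtain ⟨a, ha, b, hb, rfl⟩ := hw
      exact key a ha b hb
    | one => simp
    | mul u w hu hw ihu ihw =>
      intro x hx
      rw [← mul_assoc, ihw _ (Subgroup.mul_mem _ hx hu), ihu x hx]
    | inv w hw ih =>
      intro x hx
      rw [← ih _ (Subgroup.mul_mem _ hx (Subgroup.inv_mem _ hw)), inv_mul_cancel_right]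
  simpa using key2 γ hγ 1 (Subgroup.one_mem _)

/-- The subspace `E` is `Γ`-stable. -/
def StabSub (Γ : Subgroup (GLn n)) (E : Submodule ℂ (Fin n → ℂ)) : Prop :=
  ∀ γ ∈ Γ, ∀ v ∈ E, γ.1 *ᵥ v ∈ E

theorem map_eq_of_stable {A : Matrix (Fin n) (Fin n) ℂ} (hA : IsUnit A)
    {E : Submodule ℂ (Fin n → ℂ)} (hE : ∀ v ∈ E, A *ᵥ v ∈ E) {v : Fin n → ℂ} (hv : A *ᵥ v ∈ E) :
    v ∈ E := by
  have hinj : Function.Injective A.mulVecLin := Matrix.mulVec_injective_of_isUnit hA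
  have h1 : E.map A.mulVecLin = E := by
    refine Submodule.eq_of_le_of_finrank_eq (Submodule.map_le_iff_le_comap.2 hE) ?_
    exact (LinearEquiv.finrank_eq (Submodule.equivMapOfInjective _ hinj E)).symm
  rw [← h1] at hv
  obtain ⟨w, hw, hwv⟩ := hv
  rwa [← hinj hwv]

theorem isRoot_charpoly_of_eigenvector_mod {A : Matrix (Fin n) (Fin n) ℂ} {E : Submodule ℂ (Fin n → ℂ)}
    (hE : ∀ v ∈ E, A *ᵥ v ∈ E) {v : Fin n → ℂ} (hv : v ∉ E) {c : ℂ} (hc : A *ᵥ v - c • v ∈ E) :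
    A.charpoly.IsRoot c := by
  by_contra hne
  have h1 : IsUnit (A - Matrix.scalar (Fin n) c) := by
    rw [Matrix.isUnit_iff_isUnit_det, isUnit_iff_ne_zero]
    intro h0
    refine hne ?_
    rw [Polynomial.IsRoot, Matrix.eval_charpoly, ← neg_sub, Matrix.det_neg, h0, mul_zero]
  have h2 : ∀ v, (A - Matrix.scalar (Fin n) c) *ᵥ v = A *ᵥ v - c • v := by
    intro v
    rw [Matrix.sub_mulVec]
    congr 1
    ext i
    simp [Matrix.mulVec_diagonal]
  exact hv (map_eq_of_stable h1 (fun w hw => by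
    rw [h2]; exact E.sub_mem (hE w hw) (E.smul_mem c hw)) (by rwa [h2]))

theorem finite_roots_charpoly (A : Matrix (Fin n) (Fin n) ℂ) : {c | A.charpoly.IsRoot c}.Finite :=
  Polynomial.finite_setOf_isRoot A.charpoly_monic.ne_zero

theorem exists_eigenvector_mod {A : Matrix (Fin n) (Fin n) ℂ} {E M : Submodule ℂ (Fin n → ℂ)}
    (hE : ∀ v ∈ E, A *ᵥ v ∈ E) (hM : ∀ v ∈ M, A *ᵥ v ∈ M) (hlt : E < M) :
    ∃ (c : ℂ) (w : Fin n → ℂ), w ∈ M ∧ w ∉ E ∧ A *ᵥ w - c • w ∈ E := by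
  let f : M →ₗ[ℂ] M := A.mulVecLin.restrict hM
  let E' : Submodule ℂ M := E.comap M.subtype
  let q : (M ⧸ E') →ₗ[ℂ] (M ⧸ E') := E'.mapQ E' f fun v hv => hE v.1 hv
  obtain ⟨m, hm, hme⟩ := SetLike.exists_of_lt hlt
  have : Nontrivial (M ⧸ E') := Submodule.Quotient.nontrivial_iff.2 fun h => by
    have : (⟨m, hm⟩ : M) ∈ E' := h ▸ Submodule.mem_top
    exact hme this
  obtain ⟨c, hc⟩ := Module.End.exists_eigenvalue q
  obtain ⟨w, hw⟩ := hc.exists_hasEigenvector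
  obtain ⟨w, rfl⟩ := Submodule.Quotient.mk_surjective _ w
  refine ⟨c, w.1, w.2, fun h => hw.2 ?_, ?_⟩
  · exact (Submodule.Quotient.mk_eq_zero _).2 h
  · have h1 := hw.apply_eq_smul
    have h2 : Submodule.Quotient.mk (p := E') (f w - c • w) = 0 := by
      rw [Submodule.Quotient.mk_sub, Submodule.Quotient.mk_smul, ← h1, sub_eq_zero]
      rfl
    exact (Submodule.Quotient.mk_eq_zero E').1 h2

theorem FC.exists_eigenvector (k : ℕ) : ∀ {Γ : Subgroup (GLn n)} (_ : FC Γ)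
    (_ : (fun K : Subgroup (GLn n) => ⁅K, K⁆)^[k] Γ = ⊥) {E F : Submodule ℂ (Fin n → ℂ)}
    (_ : StabSub Γ E) (_ : StabSub Γ F) (_ : E < F),
    ∃ v ∈ F, v ∉ E ∧ ∀ γ ∈ Γ, ∃ c : ℂ, γ.1 *ᵥ v - c • v ∈ E := by
  induction k with
  | zero =>
    intro Γ _ hΓ E F _ _ hlt
    obtain ⟨v, hv, hvE⟩ := SetLike.exists_of_lt hlt
    refine ⟨v, hv, hvE, fun γ hγ => ⟨1, ?_⟩⟩
    rw [show Γ = ⊥ from hΓ, Subgroup.mem_bot] at hγ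
    simp [hγ]
  | succ k ih =>
    intro Γ hFC hΓ E F hE hF hlt
    obtain ⟨M, ⟨hM, hEM, hMF⟩, hmin⟩ := wellFounded_lt.has_min
      {M : Submodule ℂ (Fin n → ℂ) | StabSub Γ M ∧ E < M ∧ M ≤ F} ⟨F, hF, hlt, le_rfl⟩
    have hmin' : ∀ N ≤ M, StabSub Γ N → E ≤ N → (∃ w ∈ N, w ∉ E) → N = M := by
      intro N hNM hN hEN ⟨w, hw, hwE⟩
      by_contra hne
      exact hmin N ⟨hN, lt_of_le_of_ne hEN (fun h => hwE (h ▸ hw)), hNM.trans hMF⟩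
        (lt_of_le_of_ne hNM hne)
    have hle : ⁅Γ, Γ⁆ ≤ Γ := commutator_le_self Γ
    obtain ⟨v, hv, hvE, hχ⟩ := ih hFC.commutator hΓ (fun γ hγ => hE γ (hle hγ))
      (fun γ hγ => hM γ (hle hγ)) hEM
    obtain ⟨φ, hφE, hφv⟩ : ∃ φ : (Fin n → ℂ) →ₗ[ℂ] ℂ, (∀ w ∈ E, φ w = 0) ∧ φ v = 1 := by
      obtain ⟨φ, h1, h2⟩ := Submodule.exists_le_ker_of_notMem hvE
      exact ⟨(φ v)⁻¹ • φ, fun w hw => by simp [LinearMap.mem_ker.1 (h2 hw)], by simp [h1]⟩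
    let χ : GLn n → ℂ := fun g => φ (g.1 *ᵥ v)
    have hφreg : ∀ (φ : (Fin n → ℂ) →ₗ[ℂ] ℂ) (v : Fin n → ℂ), (fun g : GLn n => φ (g.1 *ᵥ v)) ∈ Reg n := by
      intro φ v
      have : (fun g : GLn n => φ (g.1 *ᵥ v)) =
          fun g => ∑ i, (∑ j, g.1 i j * v j) * φ (Pi.single i 1) := by
        ext g
        rw [LinearMap.pi_apply_eq_sum_univ]
        simp [Matrix.mulVec, dotProduct]
        refine Finset.sum_congr rfl fun i _ => ?_
        congr 2
        ext j
        simp [Pi.single_apply, eq_comm]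
      rw [this]
      exact sum_mem_fun _ _ fun i _ => mul_mem_fun (sum_mem_fun _ _ fun j _ =>
        mul_mem_fun (reg_entry i j) (const_mem_fun _ _)) (const_mem_fun _ _)
    have hχv : ∀ x ∈ ⁅Γ, Γ⁆, x.1 *ᵥ v - χ x • v ∈ E := by
      intro x hx
      obtain ⟨c, hc⟩ := hχ x hx
      have := hφE _ hc
      rw [map_sub, map_smul, hφv, smul_eq_mul, mul_one, sub_eq_zero] at this
      rwa [show χ x = c from this]
    have hconj : ∀ γ ∈ Γ, ∀ x ∈ ⁅Γ, Γ⁆, γ⁻¹ * x * γ ∈ ⁅Γ, Γ⁆ := by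
      intro γ hγ x hx
      have hw : ⁅γ⁻¹, x⁆ ∈ ⁅Γ, Γ⁆ :=
        Subgroup.commutator_mem_commutator (Γ.inv_mem hγ) (hle hx)
      have := Subgroup.mul_mem _ hw hx
      simpa [commutatorElement_def] using this
    have hχconj : ∀ γ ∈ Γ, ∀ x ∈ ⁅Γ, Γ⁆, χ (γ⁻¹ * x * γ) = χ x := by
      intro γ hγ x hx
      have h1 : RegMap (Reg n) fun γ : GLn n => γ⁻¹ * x * γ :=
        (RegMap.id.inv.mul (RegMap.const _ x)).mul RegMap.id
      have := hFC _ (h1.comp (hφreg φ v)) ((finite_roots_charpoly x.1).subset (by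
        rintro _ ⟨δ, hδ, rfl⟩
        have h2 := isRoot_charpoly_of_eigenvector_mod (fun w hw => hE _ (hle (hconj δ hδ x hx)) w hw)
          hvE (hχv _ (hconj δ hδ x hx))
        have h3 : (δ⁻¹ * x * δ).1.charpoly = x.1.charpoly := by
          simp only [Units.val_mul]
          rw [mul_assoc, Matrix.charpoly_mul_comm, mul_assoc, Units.mul_inv, mul_one]
        rwa [h3] at h2)) γ hγ
      simpa [χ] using this
    have hscal : ∀ x ∈ ⁅Γ, Γ⁆, ∀ w ∈ M, x.1 *ᵥ w - χ x • w ∈ E := by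
      let N : Submodule ℂ (Fin n → ℂ) :=
        { carrier := {w | w ∈ M ∧ ∀ x ∈ ⁅Γ, Γ⁆, x.1 *ᵥ w - χ x • w ∈ E}
          add_mem' := fun {a b} ha hb => ⟨M.add_mem ha.1 hb.1, fun x hx => by
            have := E.add_mem (ha.2 x hx) (hb.2 x hx)
            rw [Matrix.mulVec_add, smul_add]
            convert this using 1; abel⟩
          zero_mem' := ⟨M.zero_mem, fun x hx => by simp⟩
          smul_mem' := fun c a ha => ⟨M.smul_mem c ha.1, fun x hx => by
            have := E.smul_mem c (ha.2 x hx)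
            rwa [smul_sub, smul_comm c, ← Matrix.mulVec_smul] at this⟩ }
      have hN : N = M := by
        refine hmin' N (fun w hw => hw.1) (fun γ hγ w hw => ⟨hM γ hγ w hw.1, fun x hx => ?_⟩)
          (fun w hw => ⟨hEM.le hw, fun x hx => E.sub_mem (hE x (hle hx) w hw) (E.smul_mem _ hw)⟩)
          ⟨v, ⟨hv, hχv⟩, hvE⟩
        have h1 := hE γ hγ _ (hw.2 _ (hconj γ hγ x hx))
        rw [Matrix.mulVec_sub, Matrix.mulVec_smul, hχconj γ hγ x hx, Matrix.mulVec_mulVec,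
          ← Units.val_mul, mul_assoc, mul_inv_cancel_left, Units.val_mul,
          ← Matrix.mulVec_mulVec] at h1
        exact h1
      intro x hx w hw
      rw [← hN] at hw
      exact hw.2 x hx
    have hone : ∀ a ∈ Γ, ∀ b ∈ Γ, χ ⁅a, b⁆ = 1 := by
      intro a ha b hb
      obtain ⟨μ, w, hw, hwE, hμ⟩ := exists_eigenvector_mod (hE b hb) (hM b hb) hEM
      have hμ0 : μ ≠ 0 := by
        rintro rfl
        rw [zero_smul, sub_zero] at hμ
        exact hwE (map_eq_of_stable b.isUnit (hE b hb) hμ)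
      have h1 : RegMap (Reg n) fun a : GLn n => a * b * a⁻¹ * b⁻¹ :=
        (((RegMap.id.mul (RegMap.const _ b)).mul RegMap.id.inv).mul (RegMap.const _ b⁻¹))
      have hfin : ((fun a => χ (a * b * a⁻¹ * b⁻¹)) '' (Γ : Set (GLn n))).Finite := by
        refine ((finite_roots_charpoly b.1).image (fun c => c / μ)).subset ?_
        rintro _ ⟨a, ha, rfl⟩
        refine ⟨χ ⁅a, b⁆ * μ, ?_, by
          simp [commutatorElement_def, mul_div_cancel_right₀ _ hμ0]⟩
        have hab := Γ.mul_mem (Γ.mul_mem ha hb) (Γ.inv_mem ha)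
        have h2 := isRoot_charpoly_of_eigenvector_mod (c := χ ⁅a, b⁆ * μ) (hE _ hab) hwE (by
          have hx : ⁅a, b⁆ ∈ ⁅Γ, Γ⁆ := Subgroup.commutator_mem_commutator ha hb
          have h3 := hE _ (hle hx) _ hμ
          have h4 := E.smul_mem μ (hscal _ hx w hw)
          have h5 := E.add_mem h3 h4
          rw [Matrix.mulVec_sub, Matrix.mulVec_smul, Matrix.mulVec_mulVec, ← Units.val_mul,
            smul_sub, smul_smul, sub_add_sub_cancel, mul_comm μ,
            show ⁅a, b⁆ * b = a * b * a⁻¹ by simp [commutatorElement_def]] at h5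
          exact h5)
        have h3 : (a * b * a⁻¹).1.charpoly = b.1.charpoly := by
          simp only [Units.val_mul]
          rw [Matrix.charpoly_mul_comm, ← mul_assoc, Units.inv_mul, one_mul]
        rwa [h3] at h2
      have := hFC _ (h1.comp (hφreg φ v)) hfin a ha
      simpa [hφv, commutatorElement_def, χ] using this
    have hcomm : ∀ a ∈ Γ, ∀ b ∈ Γ, ∀ w ∈ M, b.1 *ᵥ (a.1 *ᵥ w) - a.1 *ᵥ (b.1 *ᵥ w) ∈ E := by
      intro a ha b hb w hw
      have hx : ⁅b, a⁆ ∈ ⁅Γ, Γ⁆ := Subgroup.commutator_mem_commutator hb ha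
      have h1 := hscal _ hx _ (hM a ha _ (hM b hb w hw))
      rw [hone b hb a ha, one_smul, Matrix.mulVec_mulVec, Matrix.mulVec_mulVec, ← Units.val_mul,
        ← Units.val_mul] at h1
      convert h1 using 1
      rw [Matrix.mulVec_mulVec, Matrix.mulVec_mulVec, ← Units.val_mul, ← Units.val_mul]
      simp [commutatorElement_def, ← mul_assoc]
    refine ⟨v, hMF hv, hvE, fun b hb => ?_⟩
    obtain ⟨μ, w0, hw0, hw0E, hμ⟩ := exists_eigenvector_mod (hE b hb) (hM b hb) hEM
    let N : Submodule ℂ (Fin n → ℂ) :=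
      { carrier := {w | w ∈ M ∧ b.1 *ᵥ w - μ • w ∈ E}
        add_mem' := fun {a c} ha hc => ⟨M.add_mem ha.1 hc.1, by
          have := E.add_mem ha.2 hc.2
          rw [Matrix.mulVec_add, smul_add]
          convert this using 1; abel⟩
        zero_mem' := ⟨M.zero_mem, by simp⟩
        smul_mem' := fun c a ha => ⟨M.smul_mem c ha.1, by
          have := E.smul_mem c ha.2
          rwa [smul_sub, smul_comm c, ← Matrix.mulVec_smul] at this⟩ }
    have hN : N = M := by
      refine hmin' N (fun w hw => hw.1) (fun a ha w hw => ⟨hM a ha w hw.1, ?_⟩)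
        (fun w hw => ⟨hEM.le hw, E.sub_mem (hE b hb w hw) (E.smul_mem _ hw)⟩) ⟨w0, ⟨hw0, hμ⟩, hw0E⟩
      have h1 := E.add_mem (hcomm a ha b hb w hw.1) (hE a ha _ hw.2)
      rwa [Matrix.mulVec_sub, sub_add_sub_cancel, Matrix.mulVec_smul] at h1
    rw [← hN] at hv
    exact ⟨μ, hv.2⟩

theorem IsSolvable.exists_iterate {Γ : Subgroup (GLn n)} (h : IsSolvable Γ) :
    ∃ k, (fun K : Subgroup (GLn n) => ⁅K, K⁆)^[k] Γ = ⊥ := by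
  obtain ⟨k, hk⟩ := h.solvable
  refine ⟨k, ?_⟩
  have : ∀ k, (fun K : Subgroup (GLn n) => ⁅K, K⁆)^[k] Γ = (derivedSeries Γ k).map Γ.subtype := by
    intro k
    induction k with
    | zero => simp [← MonoidHom.range_eq_map]
    | succ k ih =>
      rw [Function.iterate_succ_apply', ih, derivedSeries_succ, Subgroup.map_commutator]
  rw [this, hk, Subgroup.map_bot]

/-- The Lie-Kolchin theorem. -/
theorem FC.exists_flag {Γ : Subgroup (GLn n)} (h : FC Γ) (hs : IsSolvable Γ) :
    ∃ c, Γ ≤ flagStab c := by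
  obtain ⟨k, hk⟩ := hs.exists_iterate
  have key : ∀ m ≤ n, ∃ v : Fin m → (Fin n → ℂ), LinearIndependent ℂ v ∧
      ∀ i, ∀ γ ∈ Γ, γ.1 *ᵥ v i ∈ Submodule.span ℂ (v '' {j | j ≤ i}) := by
    intro m
    induction m with
    | zero => exact fun _ => ⟨Fin.elim0, linearIndependent_empty_type, fun i => i.elim0⟩
    | succ m ih =>
      intro hm
      obtain ⟨v, hv, hst⟩ := ih (by omega)
      have hE : StabSub Γ (Submodule.span ℂ (Set.range v)) := by
        intro γ hγ w hw
        have : Submodule.span ℂ (Set.range v) ≤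
            (Submodule.span ℂ (Set.range v)).comap γ.1.mulVecLin := by
          rw [Submodule.span_le]
          rintro _ ⟨i, rfl⟩
          exact Submodule.span_mono (Set.image_subset_range _ _) (hst i γ hγ)
        exact this hw
      have hlt : Submodule.span ℂ (Set.range v) < ⊤ := by
        refine lt_top_iff_ne_top.2 fun h => ?_
        have h1 := finrank_span_eq_card hv
        rw [h, finrank_top, Module.finrank_fin_fun, Fintype.card_fin] at h1
        omega
      obtain ⟨w, -, hw, hχ⟩ := h.exists_eigenvector k hk hE (fun γ _ v _ => Submodule.mem_top) hlt
      refine ⟨Fin.snoc v w, linearIndependent_finSnoc.2 ⟨hv, hw⟩, fun i => ?_⟩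
      refine Fin.lastCases ?_ (fun i => ?_) i
      · intro γ hγ
        obtain ⟨c, hc⟩ := hχ γ hγ
        rw [Fin.snoc_last, ← sub_add_cancel (γ.1 *ᵥ w) (c • w)]
        refine Submodule.add_mem _ (Submodule.span_mono ?_ hc) (Submodule.smul_mem _ _
          (Submodule.subset_span ⟨Fin.last m, le_refl (Fin.last m), Fin.snoc_last ..⟩))
        rintro _ ⟨j, rfl⟩
        exact ⟨j.castSucc, Fin.le_last _, Fin.snoc_castSucc ..⟩
      · intro γ hγ
        rw [Fin.snoc_castSucc]
        refine Submodule.span_mono ?_ (hst i γ hγ)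
        rintro _ ⟨j, hj, rfl⟩
        exact ⟨j.castSucc, Fin.castSucc_le_castSucc_iff.2 hj, Fin.snoc_castSucc ..⟩
  obtain ⟨v, hv, hst⟩ := key n le_rfl
  have hu : IsUnit (Matrix.of v)ᵀ := by
    rw [← Matrix.linearIndependent_cols_iff_isUnit]
    exact hv
  obtain ⟨c, hc⟩ := hu
  have hcol : ∀ j, c.1 *ᵥ Pi.single j 1 = v j := by
    intro j; rw [hc]; ext i; simp
  refine ⟨c, fun γ hγ => mem_flagStab.2 fun i j hij => ?_⟩
  have h1 : Submodule.span ℂ (v '' {l | l ≤ j}) ≤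
      (LinearMap.ker (LinearMap.proj (R := ℂ) (φ := fun _ : Fin n => ℂ) i)).comap
        (c⁻¹).1.mulVecLin := by
    rw [Submodule.span_le]
    rintro _ ⟨l, hl, rfl⟩
    have : (c⁻¹).1 *ᵥ v l = Pi.single l 1 := by
      rw [← hcol, Matrix.mulVec_mulVec, ← Units.val_mul, inv_mul_cancel, Units.val_one,
        Matrix.one_mulVec]
    change ((c⁻¹).1 *ᵥ v l) i = 0
    rw [this, Pi.single_eq_of_ne (ne_of_gt (lt_of_le_of_lt hl hij))]
  have h2 := h1 (hst j γ hγ)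
  change ((c⁻¹).1 *ᵥ (γ.1 *ᵥ v j)) i = 0 at h2
  rw [← hcol, Matrix.mulVec_mulVec, Matrix.mulVec_mulVec, ← Units.val_mul, ← Units.val_mul,
    Matrix.mulVec_single_one] at h2
  exact h2

end LieKolchin

section FixedPoints

variable {n : ℕ}

/-- Bounded regular functions on `Γ` are constant on `Γ`. -/
def BC (Γ : Subgroup (GLn n)) : Prop :=
  ∀ f ∈ Reg n, ∀ C : ℝ, (∀ γ ∈ Γ, ‖f γ‖ ≤ C) → ∀ γ ∈ Γ, f γ = f 1

theorem bc_of_irr {Γ : Subgroup (GLn n)} (hΓ : ZC (Reg n) (Γ : Set (GLn n)))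
    (h : Irr (Reg n) (Γ : Set (GLn n))) : BC Γ := by
  intro f hf C hC γ hγ
  obtain ⟨c, hc⟩ := h.const_of_bounded (isAffine_reg n) hΓ hf hC
  rw [hc γ hγ, hc 1 Γ.one_mem]

theorem BC.fc {Γ : Subgroup (GLn n)} (h : BC Γ) : FC Γ := by
  intro f hf hfin
  obtain ⟨C, hC⟩ := (hfin.image norm).bddAbove
  exact h f hf C fun γ hγ => hC ⟨_, ⟨γ, hγ, rfl⟩, rfl⟩

theorem IsUnipotentElt.inv {u : GLn n} (h : IsUnipotentElt u) : IsUnipotentElt u⁻¹ := by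
  have h1 : (u⁻¹).1 - 1 = -((u⁻¹).1 * (u.1 - 1)) := by
    rw [mul_sub, Units.inv_mul, mul_one]; abel
  have hc : Commute (u⁻¹).1 (u.1 - 1) := by
    refine Commute.sub_right ?_ (Commute.one_right _)
    rw [commute_iff_eq, Units.inv_mul, Units.mul_inv]
  rw [IsUnipotentElt, h1, neg_pow, hc.mul_pow, show (u.1 - 1) ^ n = 0 from h, mul_zero, mul_zero]

theorem IsUnipotentElt.conj {u : GLn n} (h : IsUnipotentElt u) (g : GLn n) :
    IsUnipotentElt (g * u * g⁻¹) := by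
  have h1 : (g * u * g⁻¹).1 - 1 = g.1 * (u.1 - 1) * (g⁻¹).1 := by
    rw [mul_sub, sub_mul, mul_one, Units.mul_inv]; rfl
  rw [IsUnipotentElt, h1, Units.conj_pow, show (u.1 - 1) ^ n = 0 from h, mul_zero, zero_mul]

theorem exists_poly_entry {u : GLn n} (h : IsUnipotentElt u) (i j : Fin n) :
    ∃ p : Polynomial ℂ, ∀ k : ℕ, (u ^ k).1 i j = p.eval (k : ℂ) := by
  refine ⟨∑ m ∈ Finset.range n, Polynomial.C (((u.1 - 1) ^ m) i j * (m.factorial : ℂ)⁻¹) *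
    descPochhammer ℂ m, fun k => ?_⟩
  have h1 : u.1 ^ k = ∑ m ∈ Finset.range n, (k.choose m : ℂ) • (u.1 - 1) ^ m := by
    have h2 : u.1 ^ k = ∑ m ∈ Finset.range (k + 1), (k.choose m : ℂ) • (u.1 - 1) ^ m := by
      conv_lhs => rw [← sub_add_cancel u.1 1]
      rw [(Commute.one_right (u.1 - 1)).add_pow]
      refine Finset.sum_congr rfl fun m _ => ?_
      rw [one_pow, mul_one, Nat.cast_smul_eq_nsmul, nsmul_eq_mul, Nat.cast_comm]
    have h3 : ∀ m, m ∉ Finset.range n → (u.1 - 1) ^ m = 0 := fun m hm =>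
      pow_eq_zero_of_le (not_lt.1 fun h' => hm (Finset.mem_range.2 h')) (show (u.1 - 1) ^ n = 0 from h)
    rw [h2]
    trans ∑ m ∈ Finset.range (max (k + 1) n), (k.choose m : ℂ) • (u.1 - 1) ^ m
    · refine Finset.sum_subset (Finset.range_subset_range.2 (le_max_left _ _)) fun m _ hm => ?_
      rw [Nat.choose_eq_zero_of_lt (not_le.1 fun h' => hm (Finset.mem_range.2 (Nat.lt_succ_of_le h')))]; simp
    · refine (Finset.sum_subset (Finset.range_subset_range.2 (le_max_right _ _)) fun m _ hm => ?_).symm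
      rw [h3 m hm, smul_zero]
  rw [Units.val_pow_eq_pow_val, h1, Matrix.sum_apply, Polynomial.eval_finsetSum]
  refine Finset.sum_congr rfl fun m _ => ?_
  rw [Polynomial.eval_mul, Polynomial.eval_C, descPochhammer_eval_eq_descFactorial,
    Nat.descFactorial_eq_factorial_mul_choose, Matrix.smul_apply, smul_eq_mul, Nat.cast_mul]
  have : (m.factorial : ℂ) ≠ 0 := Nat.cast_ne_zero.2 m.factorial_ne_zero
  field_simp

theorem exists_poly_pow {u : GLn n} (h : IsUnipotentElt u) {f : GLn n → ℂ} (hf : f ∈ Reg n) :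
    ∃ p : Polynomial ℂ, ∀ k : ℕ, f (u ^ k) = p.eval (k : ℂ) := by
  induction hf using reg_induction with
  | h1 i j => exact exists_poly_entry h i j
  | h2 i j => simpa using exists_poly_entry h.inv i j
  | h3 c => exact ⟨Polynomial.C c, fun k => by simp⟩
  | h4 f g _ _ hf hg =>
    obtain ⟨p, hp⟩ := hf
    obtain ⟨q, hq⟩ := hg
    exact ⟨p + q, fun k => by simp [hp, hq]⟩
  | h5 f g _ _ hf hg =>
    obtain ⟨p, hp⟩ := hf
    obtain ⟨q, hq⟩ := hg
    exact ⟨p * q, fun k => by simp [hp, hq]⟩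

theorem poly_const_of_bounded {p : Polynomial ℂ} {C : ℝ} (h : ∀ k : ℕ, ‖p.eval (k : ℂ)‖ ≤ C) (z : ℂ) :
    p.eval z = p.eval 0 := by
  have hd : p.degree ≤ 0 := by
    by_contra hd
    have h1 := p.tendsto_norm_atTop (not_le.1 hd) (l := Filter.atTop) (z := fun k : ℕ => (k : ℂ)) (by
      simpa using tendsto_natCast_atTop_atTop (R := ℝ))
    obtain ⟨k, hk⟩ := (h1.eventually (Filter.eventually_gt_atTop C)).exists
    exact absurd (h k) (not_le.2 hk)
  rw [Polynomial.eq_C_of_degree_le_zero hd]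
  simp

theorem bc_of_unipotent {Γ : Subgroup (GLn n)} (h : ∀ u ∈ Γ, IsUnipotentElt u) : BC Γ := by
  intro f hf C hC γ hγ
  obtain ⟨p, hp⟩ := exists_poly_pow (h γ hγ) hf
  have h1 := poly_const_of_bounded (p := p) (C := C)
    (fun k => by rw [← hp]; exact hC _ (Γ.pow_mem hγ k))
  have h2 := hp 1
  have h3 := hp 0
  rw [pow_one, h1] at h2
  rw [pow_zero] at h3
  rw [h2, h3]; simp

/-- The group of matrices whose first `m` columns are upper triangular. -/
def Par (n m : ℕ) : Subgroup (GLn n) where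
  carrier := {g | ∀ i j, j.1 < m → j < i → g.1 i j = 0}
  one_mem' := fun i j _ h => Matrix.one_apply_ne h.ne'
  mul_mem' := fun {a b} ha hb i j hm h => by
    rw [Units.val_mul, Matrix.mul_apply]
    refine Finset.sum_eq_zero fun k _ => ?_
    rcases lt_or_ge j k with hk | hk
    · rw [hb k j hm hk, mul_zero]
    · rw [ha i k (lt_of_le_of_lt hk hm) (lt_of_le_of_lt hk h), zero_mul]
  inv_mem' := fun {a} ha i j hm h => by
    have h1 : a.1.BlockTriangular (fun i => min i.1 m) := fun i j h => by
      change min j.1 m < min i.1 m at h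
      exact ha i j (by omega) (Fin.lt_def.2 (by omega))
    have := a.invertible
    have h2 := Matrix.blockTriangular_inv_of_blockTriangular h1
    rw [← Matrix.coe_units_inv] at h2
    exact h2 (by change min j.1 m < min i.1 m; have : j.1 < i.1 := h; omega)

theorem tri_le_par (m : ℕ) : Tri n ≤ Par n m := fun _ hg i j _ h => hg i j h

/-- The span of the first `m` standard basis vectors. -/
def coordSub (n m : ℕ) : Submodule ℂ (Fin n → ℂ) where
  carrier := {v | ∀ i : Fin n, m ≤ i.1 → v i = 0}
  add_mem' := fun ha hb i h => by simp [ha i h, hb i h]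
  zero_mem' := fun _ _ => rfl
  smul_mem' := fun c a ha i h => by simp [ha i h]

theorem par_mulVec {m : ℕ} {g : GLn n} (hg : g ∈ Par n m) {m' : ℕ} (hm : m' ≤ m) {v : Fin n → ℂ}
    (hv : v ∈ coordSub n m') : g.1 *ᵥ v ∈ coordSub n m' := by
  intro i hi
  change ∑ j, g.1 i j * v j = 0
  refine Finset.sum_eq_zero fun j _ => ?_
  rcases lt_or_ge j.1 m' with hj | hj
  · rw [hg i j (by omega) (by have : j.1 < i.1 := by omega
                              exact this), zero_mul]
  · rw [hv j hj, mul_zero]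

theorem tri_mulVec {g : GLn n} (hg : g ∈ Tri n) {m' : ℕ} {v : Fin n → ℂ}
    (hv : v ∈ coordSub n m') : g.1 *ᵥ v ∈ coordSub n m' :=
  par_mulVec (tri_le_par m' hg) le_rfl hv

theorem zc_par (m : ℕ) : ZC (Reg n) (Par n m : Set (GLn n)) :=
  fun _ hg i j hm h => hg _ (reg_entry i j) fun _ hs => hs i j hm h

theorem reg_functional (φ : (Fin n → ℂ) →ₗ[ℂ] ℂ) (v : Fin n → ℂ) :
    (fun g : GLn n => φ (g.1 *ᵥ v)) ∈ Reg n := by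
  have : (fun g : GLn n => φ (g.1 *ᵥ v)) =
      fun g => ∑ i, (∑ j, g.1 i j * v j) * φ (Pi.single i 1) := by
    ext g
    rw [LinearMap.pi_apply_eq_sum_univ]
    simp [Matrix.mulVec, dotProduct]
    refine Finset.sum_congr rfl fun i _ => ?_
    congr 2
    ext j
    simp [Pi.single_apply, eq_comm]
  rw [this]
  exact sum_mem_fun _ _ fun i _ => mul_mem_fun (sum_mem_fun _ _ fun j _ =>
    mul_mem_fun (reg_entry i j) (const_mem_fun _ _)) (const_mem_fun _ _)

theorem mulVec_inv_cancel (c : GLn n) (v : Fin n → ℂ) : c.1 *ᵥ ((c⁻¹).1 *ᵥ v) = v := by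
  rw [Matrix.mulVec_mulVec, Units.mul_inv, Matrix.one_mulVec]

theorem inv_mulVec_cancel (c : GLn n) (v : Fin n → ℂ) : (c⁻¹).1 *ᵥ (c.1 *ᵥ v) = v := by
  rw [Matrix.mulVec_mulVec, Units.inv_mul, Matrix.one_mulVec]

theorem mulVec_mul (a b : GLn n) (v : Fin n → ℂ) : (a * b).1 *ᵥ v = a.1 *ᵥ (b.1 *ᵥ v) := by
  rw [Units.val_mul, Matrix.mulVec_mulVec]

theorem exists_mem_par_succ {Γ : Subgroup (GLn n)} (hBC : BC Γ) {c : GLn n} (hc : Γ ≤ flagStab c)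
    {Y : Set (GLn n)} (hY : IsClosed Y) (hst : Stable Γ Y) {m : ℕ} (hm : m < n) {y : GLn n}
    (hy : y ∈ Y) (hyΓ : ∀ γ ∈ Γ, y⁻¹ * γ * y ∈ Par n m) :
    ∃ y' ∈ Y, ∀ γ ∈ Γ, y'⁻¹ * γ * y' ∈ Par n (m + 1) := by
  let E : Submodule ℂ (Fin n → ℂ) := (coordSub n m).comap (y⁻¹).1.mulVecLin
  have hEst : StabSub Γ E := by
    intro γ hγ v hv
    have h1 := par_mulVec (hyΓ γ hγ) le_rfl (show (y⁻¹).1 *ᵥ v ∈ coordSub n m from hv)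
    rwa [mulVec_mul, mulVec_mul, mulVec_inv_cancel] at h1
  let C : Set (GLn n) := {y' | y' ∈ Y ∧ y' ∈ unitarySet n ∧ y⁻¹ * y' ∈ Par n m}
  have hC : IsCompact C := by
    have h1 : IsClosed {y' : GLn n | y⁻¹ * y' ∈ Par n m} :=
      ((zc_par m).preimage (regMap_mulLeft y⁻¹)).isClosed
    have h2 := isCompact_unitarySet.inter_right (hY.inter h1)
    convert h2 using 1
    ext; simp only [C, Set.mem_setOf_eq, Set.mem_inter_iff]; tauto
  have hCγ : ∀ γ ∈ Γ, ∀ y' ∈ C, ∃ t ∈ Tri n, γ * y' * t ∈ C := by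
    rintro γ hγ y' ⟨h1, h2, h3⟩
    obtain ⟨t, ht, hu⟩ := exists_unitary_tri (γ * y')
    refine ⟨t, ht, hst.2 t ht _ (hst.1 γ hγ _ h1), hu, ?_⟩
    have : y⁻¹ * (γ * y' * t) = (y⁻¹ * γ * y) * (y⁻¹ * y') * t := by group
    rw [this]
    exact Subgroup.mul_mem _ (Subgroup.mul_mem _ (hyΓ γ hγ) h3) (tri_le_par m ht)
  let W : ℕ → Submodule ℂ (Fin n → ℂ) := fun i => (coordSub n i).comap (c⁻¹).1.mulVecLin ⊔ E
  have hex : ∃ i, ∃ y' ∈ C, y'.1 *ᵥ Pi.single ⟨m, hm⟩ 1 ∈ W i := by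
    obtain ⟨t, ht, hu⟩ := exists_unitary_tri y
    refine ⟨n, y * t, ⟨hst.2 t ht y hy, hu, by simpa using tri_le_par m ht⟩, ?_⟩
    refine (le_sup_left : _ ≤ W n) ?_
    intro i hi
    exact absurd i.2 (not_lt.2 hi)
  classical
  obtain ⟨y', hy', hyW⟩ := Nat.find_spec hex
  have hmin : ∀ i < Nat.find hex, ∀ y' ∈ C, y'.1 *ᵥ Pi.single ⟨m, hm⟩ 1 ∉ W i :=
    fun i hi y' hy' h => Nat.find_min hex hi ⟨y', hy', h⟩
  have hfn : Nat.find hex ≤ n := by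
    refine Nat.find_min' hex ⟨y', hy', (le_sup_left : _ ≤ W n) ?_⟩
    intro i hi
    exact absurd i.2 (not_lt.2 hi)
  have hEnot : ∀ y' ∈ C, y'.1 *ᵥ Pi.single ⟨m, hm⟩ 1 ∉ E := by
    intro y' hy' h
    have h1 := par_mulVec (Subgroup.inv_mem _ hy'.2.2) le_rfl
      (show (y⁻¹).1 *ᵥ _ ∈ coordSub n m from h)
    rw [← mulVec_mul, ← mulVec_mul] at h1
    have h2 : (y⁻¹ * y')⁻¹ * y⁻¹ * y' = 1 := by group
    rw [h2, Units.val_one, Matrix.one_mulVec] at h1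
    simpa using h1 ⟨m, hm⟩ le_rfl
  generalize hi : Nat.find hex = i1 at *
  obtain _ | i0 := i1
  · exfalso
    refine hEnot y' hy' ?_
    have h1 : W 0 ≤ E := by
      refine sup_le ?_ le_rfl
      intro v hv
      have h2 : (c⁻¹).1 *ᵥ v = 0 := funext fun i => hv i (Nat.zero_le _)
      have h3 := mulVec_inv_cancel c v
      rw [h2, Matrix.mulVec_zero] at h3
      rw [← h3]; exact E.zero_mem
    exact h1 hyW
  let ii : Fin n := ⟨i0, hfn⟩
  let b : Fin n → ℂ := c.1 *ᵥ Pi.single ii 1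
  have hWst : StabSub Γ (W i0) := by
    intro γ hγ v hv
    obtain ⟨a, ha, e, he, rfl⟩ := Submodule.mem_sup.1 hv
    rw [Matrix.mulVec_add]
    refine Submodule.add_mem_sup ?_ (hEst γ hγ e he)
    have h1 := tri_mulVec (mem_flagStab.1 (hc hγ)) (show (c⁻¹).1 *ᵥ a ∈ coordSub n i0 from ha)
    rwa [mulVec_mul, mulVec_mul, mulVec_inv_cancel] at h1
  have hWsucc : ∀ v ∈ W (i0 + 1), ∃ a : ℂ, v - a • b ∈ W i0 := by
    intro v hv
    obtain ⟨a, ha, e, he, rfl⟩ := Submodule.mem_sup.1 hv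
    refine ⟨((c⁻¹).1 *ᵥ a) ii, ?_⟩
    rw [add_sub_right_comm]
    refine Submodule.add_mem_sup ?_ he
    intro i hi
    change ((c⁻¹).1 *ᵥ (a - _ • b)) i = 0
    rw [Matrix.mulVec_sub, Matrix.mulVec_smul, inv_mulVec_cancel]
    rcases hi.eq_or_lt with h | h
    · obtain rfl : ii = i := Fin.ext h
      simp
    · have : i ≠ ii := fun h' => by rw [h'] at h; exact lt_irrefl _ h
      have h3 := ha i h
      change ((c⁻¹).1 *ᵥ a) i = 0 at h3
      simp only [Pi.sub_apply, Pi.smul_apply, Pi.single_eq_of_ne this, h3, smul_zero, sub_zero]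
  have hbγ : ∀ γ ∈ Γ, γ.1 *ᵥ b - (c⁻¹ * γ * c).1 ii ii • b ∈ W i0 := by
    intro γ hγ
    refine (le_sup_left : _ ≤ W i0) ?_
    intro i hi
    change ((c⁻¹).1 *ᵥ (γ.1 *ᵥ b - _ • b)) i = 0
    rw [Matrix.mulVec_sub, Matrix.mulVec_smul, inv_mulVec_cancel, ← mulVec_mul, ← mulVec_mul]
    rcases hi.eq_or_lt with h | h
    · obtain rfl : ii = i := Fin.ext h
      simp
    · have h1 : i ≠ ii := fun h' => by rw [h'] at h; exact lt_irrefl _ h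
      have h2 : (c⁻¹ * γ * c).1 i ii = 0 := mem_flagStab.1 (hc hγ) i ii h
      rw [Matrix.mulVec_single_one]
      simp only [Pi.sub_apply, Pi.smul_apply, Pi.single_eq_of_ne h1, smul_zero, sub_zero]
      exact h2
  let k : Fin n → ℂ := y'.1 *ᵥ Pi.single ⟨m, hm⟩ 1
  obtain ⟨ℓ, hℓk, hℓ⟩ := Submodule.exists_le_ker_of_notMem (hmin i0 (Nat.lt_succ_self _) y' hy')
  have hℓb : ∀ v ∈ W (i0 + 1), v ∉ W i0 → ℓ v ≠ 0 := by
    intro v hv hvn h0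
    obtain ⟨a, ha⟩ := hWsucc v hv
    obtain ⟨a', ha'⟩ := hWsucc k hyW
    have h1 := hℓ ha
    have h2 := hℓ ha'
    rw [LinearMap.mem_ker, map_sub, map_smul, sub_eq_zero] at h1 h2
    rw [h0, eq_comm, smul_eq_mul, mul_eq_zero] at h1
    rcases h1 with rfl | h1
    · rw [zero_smul, sub_zero] at ha
      exact hvn ha
    · rw [h1, smul_zero] at h2
      exact hℓk h2
  have hℓγ : ∀ γ ∈ Γ, ∀ v ∈ W (i0 + 1), ℓ (γ.1 *ᵥ v) = (c⁻¹ * γ * c).1 ii ii * ℓ v := by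
    intro γ hγ v hv
    obtain ⟨a, ha⟩ := hWsucc v hv
    have h1 := hℓ ha
    have h2 := hℓ (hWst γ hγ _ ha)
    have h3 := hℓ (hbγ γ hγ)
    rw [LinearMap.mem_ker, map_sub, sub_eq_zero] at h1 h3
    rw [LinearMap.mem_ker, Matrix.mulVec_sub, Matrix.mulVec_smul, map_sub, sub_eq_zero] at h2
    rw [h2, h1, map_smul, map_smul, h3]
    simp only [map_smul, smul_eq_mul]; ring
  have hψ : ∀ γ ∈ Γ, (c⁻¹ * γ * c).1 ii ii * (c⁻¹ * γ⁻¹ * c).1 ii ii = 1 := by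
    intro γ hγ
    have h1 : (c⁻¹ * γ * c) * (c⁻¹ * γ⁻¹ * c) = 1 := by group
    have h2 := congrArg (fun g : GLn n => g.1 ii ii) h1
    simp only [Units.val_mul (c⁻¹ * γ * c), Units.val_one, Matrix.one_apply_eq, Matrix.mul_apply] at h2
    rw [Finset.sum_eq_single ii] at h2
    · exact h2
    · intro j _ hj
      rcases lt_or_gt_of_ne hj with h | h
      · rw [mem_flagStab.1 (hc hγ) ii j h, zero_mul]
      · rw [mem_flagStab.1 (hc (Γ.inv_mem hγ)) j ii h, mul_zero]
    · simp
  have hkE : ∀ γ ∈ Γ, γ.1 *ᵥ k - (c⁻¹ * γ * c).1 ii ii • k ∈ E := by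
    intro γ hγ
    by_contra hne
    obtain ⟨φ, hφ, hφE⟩ := Submodule.exists_le_ker_of_notMem hne
    have hcont : ∀ φ : (Fin n → ℂ) →ₗ[ℂ] ℂ, Continuous fun g : GLn n =>
        φ (g.1 *ᵥ Pi.single ⟨m, hm⟩ 1) := fun φ => reg_continuous (reg_functional φ _)
    let C' : Set (GLn n) := {g | g ∈ C ∧ g.1 *ᵥ Pi.single ⟨m, hm⟩ 1 ∈ W (i0 + 1)}
    have hC' : IsCompact C' := by
      refine hC.inter_right (t := {g : GLn n | g.1 *ᵥ Pi.single ⟨m, hm⟩ 1 ∈ W (i0 + 1)}) ?_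
      exact (Submodule.closed_of_finiteDimensional (W (i0 + 1))).preimage
        (Units.continuous_val.matrix_mulVec continuous_const)
    obtain ⟨D, hD⟩ := hC'.exists_bound_of_continuousOn
      (f := fun g : GLn n => φ (g.1 *ᵥ Pi.single ⟨m, hm⟩ 1) / ℓ (g.1 *ᵥ Pi.single ⟨m, hm⟩ 1))
      ((hcont φ).continuousOn.div (hcont ℓ).continuousOn fun g hg =>
        hℓb _ hg.2 (hmin i0 (Nat.lt_succ_self _) g hg.1))
    have hreg : (fun g : GLn n => φ (g.1 *ᵥ k) * (c⁻¹ * g⁻¹ * c).1 ii ii) ∈ Reg n :=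
      mul_mem_fun (reg_functional φ k)
        (RegMap.comp (((RegMap.const _ c⁻¹).mul RegMap.id.inv).mul (RegMap.const _ c))
          (reg_entry ii ii))
    have hbd := hBC _ hreg (D * ‖ℓ k‖) (fun δ hδ => by
      obtain ⟨t, ht, hδt⟩ := hCγ δ hδ y' hy'
      have h1 : (δ * y' * t).1 *ᵥ Pi.single ⟨m, hm⟩ 1 - t.1 ⟨m, hm⟩ ⟨m, hm⟩ • (δ.1 *ᵥ k) ∈ E := by
        have h2 : t.1 *ᵥ Pi.single ⟨m, hm⟩ 1 - t.1 ⟨m, hm⟩ ⟨m, hm⟩ • Pi.single ⟨m, hm⟩ 1 ∈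
            coordSub n m := by
          intro i hi
          rw [Matrix.mulVec_single_one]
          rcases hi.eq_or_lt with h | h
          · obtain rfl : (⟨m, hm⟩ : Fin n) = i := Fin.ext h
            simp
          · have h1 : i ≠ ⟨m, hm⟩ := fun h' => by rw [h'] at h; exact lt_irrefl _ h
            simp only [Pi.sub_apply, Pi.smul_apply, Pi.single_eq_of_ne h1, smul_zero, sub_zero]
            exact ht i ⟨m, hm⟩ h
        have h3 := par_mulVec hy'.2.2 le_rfl h2
        have h4 : y'.1 *ᵥ (t.1 *ᵥ Pi.single ⟨m, hm⟩ 1 -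
            t.1 ⟨m, hm⟩ ⟨m, hm⟩ • Pi.single ⟨m, hm⟩ 1) ∈ E := by
          rwa [mulVec_mul] at h3
        have h5 := hEst δ hδ _ h4
        rw [Matrix.mulVec_sub, Matrix.mulVec_sub, Matrix.mulVec_smul, Matrix.mulVec_smul,
          ← mulVec_mul, ← mulVec_mul] at h5
        exact h5
      have hEW : ∀ i, E ≤ W i := fun i => le_sup_right
      have hδk : δ.1 *ᵥ k ∈ W (i0 + 1) := by
        obtain ⟨a, ha, e, he, hae⟩ := Submodule.mem_sup.1 hyW
        change δ.1 *ᵥ (y'.1 *ᵥ Pi.single ⟨m, hm⟩ 1) ∈ _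
        rw [← hae, Matrix.mulVec_add]
        refine Submodule.add_mem_sup ?_ (hEst δ hδ e he)
        have h1 := tri_mulVec (mem_flagStab.1 (hc hδ))
          (show (c⁻¹).1 *ᵥ a ∈ coordSub n (i0 + 1) from ha)
        rwa [mulVec_mul, mulVec_mul, mulVec_inv_cancel] at h1
      have hmem : (δ * y' * t).1 *ᵥ Pi.single ⟨m, hm⟩ 1 ∈ W (i0 + 1) := by
        have := Submodule.add_mem _ (hEW _ h1) (Submodule.smul_mem _ (t.1 ⟨m, hm⟩ ⟨m, hm⟩) hδk)
        rwa [sub_add_cancel] at this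
      have h6 := hD _ ⟨hδt, hmem⟩
      have h7 := hℓb _ hmem (hmin i0 (Nat.lt_succ_self _) _ hδt)
      have h8 := hφE h1
      have h9 := hℓ (hEW _ h1)
      rw [LinearMap.mem_ker, map_sub, sub_eq_zero, map_smul, smul_eq_mul] at h8 h9
      rw [h9, hℓγ δ hδ _ hyW] at h7
      have h15 : ℓ (δ.1 *ᵥ k) = (c⁻¹ * δ * c).1 ii ii * ℓ k := hℓγ δ hδ _ hyW
      simp only [h8, h9] at h6
      rw [h15] at h6
      have h10 := hψ δ hδ
      change ‖φ (δ.1 *ᵥ k) * (c⁻¹ * δ⁻¹ * c).1 ii ii‖ ≤ _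
      have h11 : φ (δ.1 *ᵥ k) * (c⁻¹ * δ⁻¹ * c).1 ii ii = (t.1 ⟨m, hm⟩ ⟨m, hm⟩ * φ (δ.1 *ᵥ k) /
          (t.1 ⟨m, hm⟩ ⟨m, hm⟩ * ((c⁻¹ * δ * c).1 ii ii * ℓ k))) * ℓ k := by
        have h12 : t.1 ⟨m, hm⟩ ⟨m, hm⟩ ≠ 0 := left_ne_zero_of_mul h7
        have h13 : (c⁻¹ * δ * c).1 ii ii ≠ 0 := left_ne_zero_of_mul (h10.trans_ne one_ne_zero)
        have h14 : ℓ k ≠ 0 := hℓk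
        rw [eq_inv_of_mul_eq_one_right h10]
        field_simp
      rw [h11, norm_mul]
      exact mul_le_mul_of_nonneg_right h6 (norm_nonneg _)) γ hγ
    apply hφ
    rw [map_sub, map_smul, smul_eq_mul, sub_eq_zero]
    have h1 := hψ γ hγ
    simp only [Units.val_one, Matrix.one_mulVec, inv_one, mul_one, inv_mul_cancel,
      Matrix.one_apply_eq] at hbd
    rw [← hbd, mul_left_comm, h1, mul_one]
  refine ⟨y', hy'.1, fun γ hγ i j hj hij => ?_⟩
  rcases Nat.lt_succ_iff_lt_or_eq.1 hj with h | h
  · have h1 : y'⁻¹ * γ * y' = (y⁻¹ * y')⁻¹ * (y⁻¹ * γ * y) * (y⁻¹ * y') := by group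
    rw [h1]
    exact Subgroup.mul_mem _ (Subgroup.mul_mem _ (Subgroup.inv_mem _ hy'.2.2) (hyΓ γ hγ))
      hy'.2.2 i j h hij
  · obtain rfl : j = ⟨m, hm⟩ := Fin.ext h
    have h1 := par_mulVec (Subgroup.inv_mem _ hy'.2.2) le_rfl
      (show (y⁻¹).1 *ᵥ _ ∈ coordSub n m from hkE γ hγ)
    rw [← mulVec_mul, show (y⁻¹ * y')⁻¹ * y⁻¹ = y'⁻¹ by group, Matrix.mulVec_sub,
      Matrix.mulVec_smul, inv_mulVec_cancel, ← mulVec_mul, ← mulVec_mul,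
      Matrix.mulVec_single_one] at h1
    have h2 := h1 i (le_of_lt hij)
    simpa [Pi.single_eq_of_ne (ne_of_gt hij)] using h2

/-- The fixed point theorem for trigonalizable groups acting on closed sets of flags. -/
theorem exists_fixed_flag {Γ : Subgroup (GLn n)} (hBC : BC Γ) {c : GLn n} (hc : Γ ≤ flagStab c)
    {Y : Set (GLn n)} (hY : IsClosed Y) (hne : Y.Nonempty) (hst : Stable Γ Y) :
    ∃ y ∈ Y, Γ ≤ flagStab y := by
  have key : ∀ m ≤ n, ∃ y ∈ Y, ∀ γ ∈ Γ, y⁻¹ * γ * y ∈ Par n m := by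
    intro m
    induction m with
    | zero =>
      obtain ⟨y, hy⟩ := hne
      exact fun _ => ⟨y, hy, fun γ _ i j h => absurd h (Nat.not_lt_zero _)⟩
    | succ m ih =>
      intro hm
      obtain ⟨y, hy, h⟩ := ih (by omega)
      exact exists_mem_par_succ hBC hc hY hst hm hy h
  obtain ⟨y, hy, h⟩ := key n le_rfl
  exact ⟨y, hy, fun γ hγ => mem_flagStab.2 fun i j hij => h γ hγ i j j.2 hij⟩

end FixedPoints

section Chevalley

variable {n : ℕ}

/-- The span of the constants, the entries, and the entries of the inverse. -/
def regGen (n : ℕ) : Submodule ℂ (GLn n → ℂ) :=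
  Submodule.span ℂ (insert 1
    (Set.range (fun (q : Fin n × Fin n) (g : GLn n) => g.1 q.1 q.2) ∪
      Set.range (fun (q : Fin n × Fin n) (g : GLn n) => (g⁻¹).1 q.1 q.2)))

theorem regGen_entry (i j : Fin n) : (fun g : GLn n => g.1 i j) ∈ regGen n :=
  Submodule.subset_span (Or.inr (Or.inl ⟨(i, j), rfl⟩))

theorem regGen_inv_entry (i j : Fin n) : (fun g : GLn n => (g⁻¹).1 i j) ∈ regGen n :=
  Submodule.subset_span (Or.inr (Or.inr ⟨(i, j), rfl⟩))

theorem one_mem_regGen : (1 : GLn n → ℂ) ∈ regGen n := Submodule.subset_span (Or.inl rfl)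

theorem regGen_fg : (regGen n).FG :=
  Submodule.fg_span ((Set.finite_range _ |>.union (Set.finite_range _)).insert _)

theorem regGen_pow_mono {d e : ℕ} (h : d ≤ e) : regGen n ^ d ≤ regGen n ^ e :=
  pow_right_mono₀ (Submodule.one_le.2 one_mem_regGen) h

theorem exists_mem_regGen_pow {f : GLn n → ℂ} (hf : f ∈ Reg n) : ∃ d, f ∈ regGen n ^ d := by
  induction hf using reg_induction with
  | h1 i j => exact ⟨1, by rw [pow_one]; exact regGen_entry i j⟩
  | h2 i j => exact ⟨1, by rw [pow_one]; exact regGen_inv_entry i j⟩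
  | h3 c => exact ⟨1, by rw [pow_one]; convert (regGen n).smul_mem c one_mem_regGen using 1; ext; simp⟩
  | h4 f g _ _ hf hg =>
    obtain ⟨d, hd⟩ := hf
    obtain ⟨e, he⟩ := hg
    exact ⟨max d e, Submodule.add_mem _ (regGen_pow_mono (le_max_left _ _) hd)
      (regGen_pow_mono (le_max_right _ _) he)⟩
  | h5 f g _ _ hf hg =>
    obtain ⟨d, hd⟩ := hf
    obtain ⟨e, he⟩ := hg
    exact ⟨d + e, by rw [pow_add]; exact Submodule.mul_mem_mul hd he⟩

theorem regGen_le_reg : regGen n ≤ Subalgebra.toSubmodule (Reg n) := by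
  refine Submodule.span_le.2 ?_
  rintro f (rfl | ⟨q, rfl⟩ | ⟨q, rfl⟩)
  · exact (Reg n).one_mem
  · exact reg_entry _ _
  · exact reg_inv_entry _ _

theorem regGen_pow_le_reg (d : ℕ) : regGen n ^ d ≤ Subalgebra.toSubmodule (Reg n) := by
  induction d with
  | zero => rw [pow_zero]; exact Submodule.one_le.2 (Reg n).one_mem
  | succ d ih =>
    rw [pow_succ]
    refine Submodule.mul_le.2 fun a ha b hb => (Reg n).mul_mem (ih ha) (regGen_le_reg hb)

theorem regGen_pow_comp {m : GLn n → GLn n} (hm : ∀ i j, (fun z => (m z).1 i j) ∈ regGen n)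
    (hm' : ∀ i j, (fun z => (m z)⁻¹.1 i j) ∈ regGen n) {d : ℕ} {f : GLn n → ℂ}
    (hf : f ∈ regGen n ^ d) : (fun z => f (m z)) ∈ regGen n ^ d := by
  let φ : (GLn n → ℂ) →ₐ[ℂ] (GLn n → ℂ) := pullback m
  have h1 : (regGen n).map φ.toLinearMap ≤ regGen n := by
    rw [regGen, Submodule.map_span_le]
    rintro f (rfl | ⟨q, rfl⟩ | ⟨q, rfl⟩)
    · exact one_mem_regGen
    · exact hm q.1 q.2
    · exact hm' q.1 q.2
  have h2 : (regGen n ^ d).map φ.toLinearMap ≤ regGen n ^ d := by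
    rw [Submodule.map_pow]
    exact pow_le_pow_left' h1 d
  exact h2 ⟨f, hf, rfl⟩

theorem regGen_sum {ι : Type*} (s : Finset ι) (c : ι → ℂ) (f : ι → GLn n → ℂ)
    (hf : ∀ i ∈ s, f i ∈ regGen n) : (fun z => ∑ i ∈ s, c i * f i z) ∈ regGen n := by
  have : (fun z => ∑ i ∈ s, c i * f i z) = ∑ i ∈ s, c i • f i := by ext z; simp
  rw [this]
  exact Submodule.sum_mem _ fun i hi => Submodule.smul_mem _ _ (hf i hi)

theorem regGen_mulLeft (a : GLn n) {d : ℕ} {f : GLn n → ℂ} (hf : f ∈ regGen n ^ d) :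
    (fun z => f (a * z)) ∈ regGen n ^ d := by
  refine regGen_pow_comp (m := fun z => a * z) (fun i j => ?_) (fun i j => ?_) hf
  · simp only [Units.val_mul, Matrix.mul_apply]
    exact regGen_sum _ _ _ fun k _ => regGen_entry k j
  · simp only [mul_inv_rev, Units.val_mul, Matrix.mul_apply, mul_comm _ ((a⁻¹).1 _ _)]
    exact regGen_sum _ _ _ fun k _ => regGen_inv_entry i k

theorem regGen_mulRight (a : GLn n) {d : ℕ} {f : GLn n → ℂ} (hf : f ∈ regGen n ^ d) :
    (fun z => f (z * a)) ∈ regGen n ^ d := by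
  refine regGen_pow_comp (m := fun z => z * a) (fun i j => ?_) (fun i j => ?_) hf
  · simp only [Units.val_mul, Matrix.mul_apply, mul_comm _ (a.1 _ _)]
    exact regGen_sum _ _ _ fun k _ => regGen_entry i k
  · simp only [mul_inv_rev, Units.val_mul, Matrix.mul_apply]
    exact regGen_sum _ _ _ fun k _ => regGen_inv_entry k j

theorem regGen_det {k d : ℕ} (f : Fin k → Fin k → GLn n → ℂ) (hf : ∀ i j, f i j ∈ regGen n ^ d) :
    (fun z => (Matrix.of fun i j => f i j z).det) ∈ regGen n ^ (d * k) := by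
  have h1 : ∀ (σ : Equiv.Perm (Fin k)) (t : Finset (Fin k)),
      ∏ i ∈ t, f (σ i) i ∈ regGen n ^ (d * t.card) := by
    intro σ t
    induction t using Finset.induction_on with
    | empty => simpa using Submodule.one_le.1 le_rfl
    | insert a t ha ih =>
      rw [Finset.prod_insert ha, Finset.card_insert_of_notMem ha, mul_add, mul_one, add_comm, pow_add]
      exact Submodule.mul_mem_mul (hf _ _) ih
  have h2 : (fun z => (Matrix.of fun i j => f i j z).det) =
      ∑ σ : Equiv.Perm (Fin k), (Equiv.Perm.sign σ : ℤ) • ∏ i, f (σ i) i := by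
    ext z
    rw [Matrix.det_apply, Finset.sum_apply]
    refine Finset.sum_congr rfl fun σ _ => ?_
    rw [Pi.smul_apply, Finset.prod_apply]
    rfl
  rw [h2]
  refine Submodule.sum_mem _ fun σ _ => ?_
  have := h1 σ Finset.univ
  rw [Finset.card_univ, Fintype.card_fin] at this
  exact zsmul_mem this _

theorem exists_points {X : Type*} {k : ℕ} {p : Fin k → X → ℂ} (hp : LinearIndependent ℂ p) :
    ∃ y : Fin k → X, (Matrix.of fun i j => p j (y i)).det ≠ 0 := by
  let v : X → Fin k → ℂ := fun x j => p j x
  have hspan : Submodule.span ℂ (Set.range v) = ⊤ := by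
    by_contra hne
    obtain ⟨φ, hφ0, hφ⟩ := Submodule.exists_le_ker_of_lt_top _ (lt_top_iff_ne_top.2 hne)
    apply hφ0
    have h1 : ∀ j, φ (Pi.single j 1) = 0 := by
      refine Fintype.linearIndependent_iff.1 hp _ ?_
      ext x
      have h2 : φ (v x) = 0 := hφ (Submodule.subset_span ⟨x, rfl⟩)
      rw [LinearMap.pi_apply_eq_sum_univ] at h2
      rw [Finset.sum_apply, Pi.zero_apply, ← h2]
      refine Finset.sum_congr rfl fun j _ => ?_
      rw [Pi.smul_apply, smul_eq_mul, smul_eq_mul, mul_comm]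
      congr 2
      ext i
      simp [Pi.single_apply, eq_comm]
    refine LinearMap.pi_ext' fun j => LinearMap.ext_ring ?_
    simpa using h1 j
  have hex := Submodule.exists_fun_fin_finrank_span_eq ℂ (Set.range v)
  have hk : Module.finrank ℂ (Submodule.span ℂ (Set.range v)) = k := by
    rw [hspan, finrank_top, Module.finrank_fin_fun]
  rw [hk] at hex
  obtain ⟨f, hf, -, hli⟩ := hex
  choose y hy using hf
  refine ⟨y, ?_⟩
  have h1 : (Matrix.of fun i j => p j (y i)) = Matrix.of f := by
    ext i j
    exact congrFun (hy i) j
  rw [h1]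
  have h2 := (Matrix.linearIndependent_rows_iff_isUnit (A := Matrix.of f)).1 hli
  exact ((Matrix.isUnit_iff_isUnit_det _).1 h2).ne_zero

/-- Semi-invariant functions cutting out a closed subgroup. -/
theorem exists_chevalley {H : Subgroup (GLn n)} (hH : ZC (Reg n) (H : Set (GLn n))) :
    ∃ (ι : Type) (F : ι → GLn n → ℂ) (χ : GLn n → ℂ) (M : Submodule ℂ (GLn n → ℂ)),
      M.FG ∧ (∀ f ∈ M, f ∈ Reg n) ∧ (∀ i, F i ∈ M) ∧ χ ∈ Reg n ∧
      (∀ w i, ∃ i', ∀ z, F i (z * w) = F i' z) ∧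
      (∀ h ∈ H, ∀ i z, F i (h * z) = χ h * F i z) ∧
      (∀ g c, (∀ i, F i g = c * F i 1) → g ∈ H) ∧ ∃ i, F i 1 ≠ 0 := by
  have := (isAffine_reg n).noetherian
  obtain ⟨s, hs⟩ := (inferInstance : IsNoetherian (Reg n) (Reg n)).noetherian
    (vanIdeal (Reg n) (H : Set (GLn n)))
  have hd : ∃ d, ∀ f ∈ s, f.1 ∈ regGen n ^ d := by
    choose e he using fun f : Reg n => exists_mem_regGen_pow f.2
    exact ⟨s.sup e, fun f hf => regGen_pow_mono (Finset.le_sup hf) (he f)⟩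
  obtain ⟨d, hd⟩ := hd
  let V0 : Submodule ℂ (GLn n → ℂ) :=
    { carrier := {f | ∀ h ∈ H, f h = 0}
      add_mem' := fun ha hb h hh => by simp [ha h hh, hb h hh]
      zero_mem' := fun _ _ => rfl
      smul_mem' := fun c a ha h hh => by simp [ha h hh] }
  let W := regGen n ^ d ⊓ V0
  have hfin : (regGen n ^ d).FG := regGen_fg.pow d
  have : Module.Finite ℂ (regGen n ^ d : Submodule ℂ (GLn n → ℂ)) := Module.Finite.iff_fg.2 hfin
  have : Module.Finite ℂ W := Submodule.finiteDimensional_of_le (inf_le_left : W ≤ regGen n ^ d)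
  let b := Module.finBasis ℂ W
  let k := Module.finrank ℂ W
  let p : Fin k → GLn n → ℂ := fun j => (b j).1
  have hp : LinearIndependent ℂ p := b.linearIndependent.map' W.subtype W.ker_subtype
  have hpd : ∀ j, p j ∈ regGen n ^ d := fun j => (b j).2.1
  have hp1 : ∀ j, ∀ h ∈ H, p j h = 0 := fun j => (b j).2.2
  have hpH : ∀ g, (∀ j, p j g = 0) → g ∈ H := by
    intro g hg
    refine hH fun f hf hf0 => ?_
    have h1 : (⟨f, hf⟩ : Reg n) ∈ vanIdeal (Reg n) (H : Set (GLn n)) := hf0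
    have h2 : vanIdeal (Reg n) (H : Set (GLn n)) ≤ vanIdeal (Reg n) {g} := by
      rw [← hs]
      refine Ideal.span_le.2 fun f hf => ?_
      intro g' hg'
      rw [Set.mem_singleton_iff.1 hg']
      have h3 : f ∈ vanIdeal (Reg n) (H : Set (GLn n)) := hs ▸ Ideal.subset_span hf
      have h4 := b.sum_repr ⟨f.1, hd f hf, h3⟩
      have h5 := congrFun (congrArg Subtype.val h4) g
      change _ = f.1 g at h5
      rw [← h5, Submodule.coe_sum, Finset.sum_apply]
      refine Finset.sum_eq_zero fun j _ => ?_
      change _ * p j g = 0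
      rw [hg j, mul_zero]
    exact h2 h1 g rfl
  let F : (Fin k → GLn n) → GLn n → ℂ := fun y z => (Matrix.of fun i j => p j (z * y i)).det
  obtain ⟨y0, hy0⟩ := exists_points hp
  have hy0' : F y0 1 ≠ 0 := by simpa only [F, one_mul] using hy0
  have hFi : ∀ h ∈ H, ∃ A : Matrix (Fin k) (Fin k) ℂ, ∀ y z, F y (h * z) = A.det * F y z := by
    intro h hh
    have h1 : ∀ j, (fun z => p j (h * z)) ∈ W := fun j =>
      ⟨regGen_mulLeft h (hpd j), fun x hx => hp1 j _ (H.mul_mem hh hx)⟩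
    refine ⟨Matrix.of fun i j => b.repr ⟨_, h1 j⟩ i, fun y z => ?_⟩
    have h2 : (Matrix.of fun i j => p j (h * z * y i)) =
        (Matrix.of fun i j => p j (z * y i)) * Matrix.of fun i j => b.repr ⟨_, h1 j⟩ i := by
      ext i j
      rw [Matrix.mul_apply]
      have h3 := congrFun (congrArg Subtype.val (b.sum_repr ⟨_, h1 j⟩)) (z * y i)
      change _ = p j (h * (z * y i)) at h3
      rw [Matrix.of_apply, mul_assoc, ← h3, Submodule.coe_sum, Finset.sum_apply]
      exact Finset.sum_congr rfl fun l _ => mul_comm _ _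
    change (Matrix.of fun i j => p j (h * z * y i)).det = _
    rw [h2, Matrix.det_mul, mul_comm]
  have hFreg : ∀ y, F y ∈ regGen n ^ (d * k) := by
    intro y
    exact regGen_det (fun i j z => p j (z * y i)) fun i j => regGen_mulRight (y i) (hpd j)
  refine ⟨Fin k → GLn n, F, fun z => F y0 z * (F y0 1)⁻¹, Submodule.span ℂ (Set.range F),
    ?_, ?_, fun i => Submodule.subset_span ⟨i, rfl⟩, ?_, ?_, ?_, ?_, y0, hy0'⟩
  · have : Module.Finite ℂ (regGen n ^ (d * k) : Submodule ℂ (GLn n → ℂ)) :=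
      Module.Finite.iff_fg.2 (regGen_fg.pow _)
    refine Module.Finite.iff_fg.1 (Submodule.finiteDimensional_of_le
      (S₂ := regGen n ^ (d * k)) (Submodule.span_le.2 ?_))
    rintro _ ⟨y, rfl⟩
    exact hFreg y
  · intro f hf
    have h1 : Submodule.span ℂ (Set.range F) ≤ Subalgebra.toSubmodule (Reg n) := by
      refine Submodule.span_le.2 ?_
      rintro _ ⟨y, rfl⟩
      exact regGen_pow_le_reg _ (hFreg y)
    exact h1 hf
  · exact mul_mem_fun (regGen_pow_le_reg _ (hFreg y0)) (const_mem_fun _ _)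
  · refine fun w y => ⟨fun i => w * y i, fun z => ?_⟩
    simp only [F, mul_assoc]
  · intro h hh y z
    obtain ⟨A, hA⟩ := hFi h hh
    have h1 := hA y0 1
    rw [mul_one] at h1
    change _ = F y0 h * _ * _
    rw [h1, hA, mul_assoc A.det, mul_inv_cancel₀ hy0', mul_one]
  · intro g c hgc
    refine hpH g fun j => ?_
    let y : Fin k → GLn n := fun i => g⁻¹ * y0 i
    have hy : F y g ≠ 0 := by
      simpa only [F, y, mul_inv_cancel_left] using hy0
    let A : Matrix (Fin k) (Fin k) ℂ := Matrix.of fun i j => p j (g * y i)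
    let r : Fin k → ℂ := fun j => p j g
    have h1 : Aᵀ *ᵥ Matrix.cramer Aᵀ r = Aᵀ.det • r := Matrix.mulVec_cramer Aᵀ r
    have h2 : Matrix.cramer Aᵀ r = 0 := by
      ext i
      rw [Matrix.cramer_transpose_apply]
      have h3 : A.updateRow i r = Matrix.of fun i' j => p j (g * Function.update y i 1 i') := by
        ext i' j
        rcases eq_or_ne i' i with rfl | hi
        · simp [r]
        · simp [hi, A]
      rw [h3]
      change F (Function.update y i 1) g = 0
      rw [hgc]
      refine mul_eq_zero_of_right _ (Matrix.det_eq_zero_of_row_eq_zero i fun j => ?_)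
      simp [hp1 j 1 H.one_mem]
    rw [h2, Matrix.mulVec_zero, Matrix.det_transpose] at h1
    have h4 := congrFun h1 j
    exact (mul_eq_zero.1 h4.symm).resolve_left hy

/-- Semi-invariant functions for right translations cutting out a closed subgroup. -/
theorem exists_chevalley_right {H : Subgroup (GLn n)} (hH : ZC (Reg n) (H : Set (GLn n))) :
    ∃ (ι : Type) (F : ι → GLn n → ℂ) (χ : GLn n → ℂ) (M : Submodule ℂ (GLn n → ℂ)),
      M.FG ∧ (∀ f ∈ M, f ∈ Reg n) ∧ (∀ i, F i ∈ M) ∧ χ ∈ Reg n ∧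
      (∀ w, ∀ f ∈ M, (fun z => f (w * z)) ∈ M) ∧
      (∀ h ∈ H, ∀ f ∈ M, ∀ z, f (z * h) = χ h * f z) ∧
      (∀ g c, (∀ i, F i g = c * F i 1) → g ∈ H) ∧ ∃ i, F i 1 ≠ 0 := by
  obtain ⟨ι, F, χ, M, hM, hMR, hFM, hχ, hw, hh, hg, i, hi⟩ := exists_chevalley hH
  let F' : ι → GLn n → ℂ := fun i z => F i z⁻¹
  let N : Submodule ℂ (GLn n → ℂ) := Submodule.span ℂ (Set.range F')
  have hN : N ≤ M.map (pullback fun z : GLn n => z⁻¹).toLinearMap := by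
    refine Submodule.span_le.2 ?_
    rintro _ ⟨i, rfl⟩
    exact ⟨F i, hFM i, rfl⟩
  have : Module.Finite ℂ (M.map (pullback fun z : GLn n => z⁻¹).toLinearMap) :=
    Module.Finite.iff_fg.2 (hM.map _)
  refine ⟨ι, F', fun z => χ z⁻¹, N, Module.Finite.iff_fg.1 (Submodule.finiteDimensional_of_le hN),
    ?_, fun i => Submodule.subset_span ⟨i, rfl⟩, RegMap.id.inv.comp hχ, ?_, ?_, ?_, i, ?_⟩
  · intro f hf
    obtain ⟨f', hf', rfl⟩ := hN hf
    exact RegMap.id.inv.comp (hMR f' hf')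
  · intro w f hf
    have h1 : N ≤ N.comap (pullback fun z : GLn n => w * z).toLinearMap := by
      refine Submodule.span_le.2 ?_
      rintro _ ⟨i, rfl⟩
      obtain ⟨i', hi'⟩ := hw w⁻¹ i
      refine Submodule.subset_span ⟨i', funext fun z => ?_⟩
      change F i' z⁻¹ = F i (w * z)⁻¹
      rw [mul_inv_rev, hi']
    exact h1 hf
  · intro h hH f hf z
    induction hf using Submodule.span_induction with
    | mem f hf =>
      obtain ⟨i, rfl⟩ := hf
      change F i (z * h)⁻¹ = _
      rw [mul_inv_rev, hh _ (H.inv_mem hH)]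
    | zero => simp
    | add f g _ _ hf hg => simp only [Pi.add_apply, hf, hg, mul_add]
    | smul c f _ hf => simp only [Pi.smul_apply, hf, smul_eq_mul]; ring
  · intro g c h
    refine inv_inv g ▸ H.inv_mem (hg _ c fun i => ?_)
    have := h i
    simp only [F', inv_one] at this
    exact this
  · simpa only [F', inv_one] using hi

end Chevalley

section ExpSum

open Filter Topology

theorem le_one_of_bounded {ι : Type*} (s : Finset ι) (ρ : ι → ℝ) (c : ι → ℂ)
    (hρ : ∀ i ∈ s, 0 < ρ i) (hinj : Set.InjOn ρ s) (hc : ∀ i ∈ s, c i ≠ 0) {C : ℝ}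
    (hC : ∀ k : ℕ, ‖∑ i ∈ s, c i * (ρ i : ℂ) ^ k‖ ≤ C) : ∀ i ∈ s, ρ i ≤ 1 := by
  classical
  intro i hi
  obtain ⟨m, hm, hmax⟩ := s.exists_max_image ρ ⟨i, hi⟩
  refine (hmax i hi).trans ?_
  by_contra hlt
  push Not at hlt
  have h0 : (ρ m : ℂ) ≠ 0 := Complex.ofReal_ne_zero.2 (hρ m hm).ne'
  have h1 : Tendsto (fun k : ℕ => ∑ i ∈ s, c i * ((ρ i : ℂ) / ρ m) ^ k) atTop
      (𝓝 (∑ i ∈ s, if i = m then c m else 0)) := by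
    refine tendsto_finsetSum _ fun j hj => ?_
    split_ifs with h
    · subst h
      simp [div_self h0]
    · have h2 : ρ j < ρ m := lt_of_le_of_ne (hmax j hj) fun h' => h (hinj hj hm h')
      have h3 : ‖(ρ j : ℂ) / ρ m‖ < 1 := by
        rw [norm_div, Complex.norm_real, Complex.norm_real, Real.norm_of_nonneg (hρ j hj).le,
          Real.norm_of_nonneg (hρ m hm).le]
        exact (div_lt_one (hρ m hm)).2 h2
      simpa using (tendsto_pow_atTop_nhds_zero_of_norm_lt_one h3).const_mul (c j)
  rw [Finset.sum_ite_eq' s m, if_pos hm] at h1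
  have h2 : Tendsto (fun k : ℕ => ∑ i ∈ s, c i * ((ρ i : ℂ) / ρ m) ^ k) atTop (𝓝 0) := by
    have h3 : Tendsto (fun k : ℕ => C * ((ρ m)⁻¹) ^ k) atTop (𝓝 0) := by
      simpa using (tendsto_pow_atTop_nhds_zero_of_lt_one (inv_nonneg.2 (hρ m hm).le)
        (inv_lt_one_of_one_lt₀ hlt)).const_mul C
    refine squeeze_zero_norm (fun k => ?_) h3
    have h4 : ∑ i ∈ s, c i * ((ρ i : ℂ) / ρ m) ^ k =
        (∑ i ∈ s, c i * (ρ i : ℂ) ^ k) * ((ρ m : ℂ)⁻¹) ^ k := by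
      rw [Finset.sum_mul]
      exact Finset.sum_congr rfl fun i _ => by rw [div_eq_mul_inv, mul_pow, mul_assoc]
    rw [h4, norm_mul, norm_pow, norm_inv, Complex.norm_real, Real.norm_of_nonneg (hρ m hm).le]
    exact mul_le_mul_of_nonneg_right (hC k) (by have := hρ m hm; positivity)
  exact hc m hm (tendsto_nhds_unique h1 h2)

/-- The positive exponential sequences. -/
def posExp : Submonoid (ℤ → ℂ) where
  carrier := Set.range fun (ρ : {ρ : ℝ // 0 < ρ}) (k : ℤ) => ((ρ.1 : ℂ)) ^ k
  one_mem' := ⟨⟨1, one_pos⟩, by ext; simp⟩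
  mul_mem' := by
    rintro _ _ ⟨ρ, rfl⟩ ⟨σ, rfl⟩
    exact ⟨⟨ρ.1 * σ.1, mul_pos ρ.2 σ.2⟩, by ext; simp [mul_zpow]⟩

/-- The algebra of positive exponential sums. -/
def expSum : Subalgebra ℂ (ℤ → ℂ) := Algebra.adjoin ℂ (posExp : Set (ℤ → ℂ))

theorem zpow_mem_expSum {ρ : ℝ} (hρ : 0 < ρ) : (fun k : ℤ => (ρ : ℂ) ^ k) ∈ expSum :=
  Algebra.subset_adjoin ⟨⟨ρ, hρ⟩, rfl⟩

theorem expSum_const {f : ℤ → ℂ} (hf : f ∈ expSum) {C C' : ℝ} (hC : ∀ k : ℕ, ‖f k‖ ≤ C)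
    (hC' : ∀ k : ℕ, ‖f (-k)‖ ≤ C') (k : ℤ) : f k = f 0 := by
  have h1 : f ∈ Submodule.span ℂ
      (Set.range fun (ρ : {ρ : ℝ // 0 < ρ}) (k : ℤ) => ((ρ.1 : ℂ)) ^ k) := by
    have h2 : f ∈ Subalgebra.toSubmodule expSum := hf
    rw [expSum, Algebra.adjoin_eq_span, Submonoid.closure_eq] at h2
    exact h2
  obtain ⟨c, rfl⟩ := Finsupp.mem_span_range_iff_exists_finsupp.1 h1
  have h3 : ∀ k : ℤ, (c.sum fun i a => a • fun k : ℤ => ((i.1 : ℂ)) ^ k) k =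
      ∑ i ∈ c.support, c i * (i.1 : ℂ) ^ k := fun k => by
    rw [Finsupp.sum, Finset.sum_apply]; rfl
  have h4 : ∀ i ∈ c.support, i.1 ≤ 1 := le_one_of_bounded c.support (fun i => i.1) c
    (fun i _ => i.2) Subtype.val_injective.injOn (fun i hi => Finsupp.mem_support_iff.1 hi)
    (C := C) fun k => by have := hC k; rw [h3] at this; simpa using this
  have h5 : ∀ i ∈ c.support, (i.1)⁻¹ ≤ 1 := le_one_of_bounded c.support (fun i => (i.1)⁻¹) c
    (fun i _ => inv_pos.2 i.2) (inv_injective.comp Subtype.val_injective).injOn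
    (fun i hi => Finsupp.mem_support_iff.1 hi)
    (C := C') fun k => by have := hC' k; rw [h3] at this; simpa using this
  rw [h3, h3]
  refine Finset.sum_congr rfl fun i hi => ?_
  have h6 : i.1 = 1 := le_antisymm (h4 i hi) ((inv_le_one₀ i.2).1 (h5 i hi))
  rw [h6]; simp

end ExpSum

section Hyperbolic

open Filter Topology

variable {n : ℕ}

/-- `a` is diagonalizable with positive real eigenvalues. -/
def IsHyp (a : GLn n) : Prop :=
  ∃ (c : GLn n) (d : Fin n → ℝ), (∀ i, 0 < d i) ∧ (c⁻¹ * a * c).1 = Matrix.diagonal fun i => (d i : ℂ)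

theorem diagonal_zpow {A : GLn n} {d : Fin n → ℝ} (hd : ∀ i, 0 < d i)
    (hA : A.1 = Matrix.diagonal fun i => (d i : ℂ)) (k : ℤ) :
    (A ^ k).1 = Matrix.diagonal fun i => (d i : ℂ) ^ k := by
  have h0 : ∀ i, (d i : ℂ) ≠ 0 := fun i => Complex.ofReal_ne_zero.2 (hd i).ne'
  have hinv : (A⁻¹).1 = Matrix.diagonal fun i => (d i : ℂ)⁻¹ := by
    refine Units.inv_eq_of_mul_eq_one_right ?_
    rw [hA, Matrix.diagonal_mul_diagonal, ← Matrix.diagonal_one]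
    congr 1; ext i; exact mul_inv_cancel₀ (h0 i)
  induction k using Int.induction_on with
  | zero => simp
  | succ k ih =>
    rw [zpow_add_one, Units.val_mul, ih, hA, Matrix.diagonal_mul_diagonal]
    exact congrArg Matrix.diagonal (funext fun i => (zpow_add_one₀ (h0 i) _).symm)
  | pred k ih =>
    rw [zpow_sub_one, Units.val_mul, ih, hinv, Matrix.diagonal_mul_diagonal]
    congr 1; ext i; rw [zpow_sub_one₀ (h0 i)]

theorem regMap_diagonal {A : GLn n} {d : Fin n → ℝ} (hd : ∀ i, 0 < d i)
    (hA : A.1 = Matrix.diagonal fun i => (d i : ℂ)) : RegMap expSum fun k : ℤ => A ^ k := by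
  refine regMap_iff.2 ⟨fun i j => ?_, fun i j => ?_⟩
  · simp only [diagonal_zpow hd hA, Matrix.diagonal_apply]
    split_ifs
    · exact zpow_mem_expSum (hd i)
    · exact const_mem_fun _ 0
  · simp only [← zpow_neg, diagonal_zpow hd hA, Matrix.diagonal_apply]
    split_ifs
    · have := zpow_mem_expSum (inv_pos.2 (hd i))
      simpa using this
    · exact const_mem_fun _ 0

theorem IsHyp.regMap {a : GLn n} (h : IsHyp a) : RegMap expSum fun k : ℤ => a ^ k := by
  obtain ⟨c, d, hd, hA⟩ := h
  have h1 := ((RegMap.const expSum c).mul (regMap_diagonal hd hA)).mul (RegMap.const expSum c⁻¹)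
  have h2 : ∀ k : ℤ, c * (c⁻¹ * a * c) ^ k * c⁻¹ = a ^ k := fun k => by
    have := conj_zpow (a := c) (b := c⁻¹ * a * c) (i := k)
    rw [← this]; congr 1; group
  simpa only [h2] using h1

theorem IsHyp.conj {a : GLn n} (h : IsHyp a) (g : GLn n) : IsHyp (g * a * g⁻¹) := by
  obtain ⟨c, d, hd, hA⟩ := h
  exact ⟨g * c, d, hd, by rw [← hA]; congr 1; group⟩

theorem IsHyp.inv {a : GLn n} (h : IsHyp a) : IsHyp a⁻¹ := by
  obtain ⟨c, d, hd, hA⟩ := h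
  refine ⟨c, fun i => (d i)⁻¹, fun i => inv_pos.2 (hd i), ?_⟩
  have h1 := diagonal_zpow hd hA (-1)
  have h2 : (c⁻¹ * a * c) ^ (-1 : ℤ) = c⁻¹ * a⁻¹ * c := by group
  rw [h2] at h1
  simpa using h1

/-- Conjugation by positive powers of `a` contracts `s` to `l`. -/
def Contr (a s l : GLn n) : Prop :=
  Tendsto (fun k : ℕ => a ^ k * s * (a ^ k)⁻¹) atTop (𝓝 l)

theorem Contr.mul {a s l s' l' : GLn n} (h : Contr a s l) (h' : Contr a s' l') :
    Contr a (s * s') (l * l') := by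
  have := Tendsto.mul h h'
  refine this.congr fun k => by group

theorem Contr.inv {a s l : GLn n} (h : Contr a s l) : Contr a s⁻¹ l⁻¹ := by
  have := Tendsto.inv h
  refine this.congr fun k => by group

theorem Contr.conj {a s l : GLn n} (h : Contr a s l) (c : GLn n) :
    Contr (c * a * c⁻¹) (c * s * c⁻¹) (c * l * c⁻¹) := by
  have := (Tendsto.mul (tendsto_const_nhds (x := c)) h).mul (tendsto_const_nhds (x := c⁻¹))
  refine this.congr fun k => ?_
  rw [conj_pow]; group

theorem Contr.comm {a s l : GLn n} (h : Contr a s l) : l * a = a * l := by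
  have h1 := (Tendsto.mul (tendsto_const_nhds (x := a)) h).mul (tendsto_const_nhds (x := a⁻¹))
  have h2 := h.comp (tendsto_add_atTop_nat 1)
  have h3 : a * l * a⁻¹ = l := tendsto_nhds_unique h1 (h2.congr fun k => by
    simp only [Function.comp, pow_succ']; group)
  rw [mul_inv_eq_iff_eq_mul] at h3
  exact h3.symm

theorem contr_of_comm {a s : GLn n} (h : s * a = a * s) : Contr a s s := by
  refine tendsto_const_nhds.congr fun k => ?_
  have : Commute s (a ^ k) := Commute.pow_right h k
  rw [← this.eq]; group

theorem Contr.bounded {a s l : GLn n} (h : Contr a s l) {f : GLn n → ℂ} (hf : f ∈ Reg n) :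
    ∃ C : ℝ, ∀ k : ℕ, ‖f (a ^ k * s * (a ^ k)⁻¹)‖ ≤ C := by
  have h1 := (((reg_continuous hf).tendsto l).comp h).norm
  obtain ⟨C, hC⟩ := h1.bddAbove_range
  exact ⟨C, fun k => hC ⟨k, rfl⟩⟩

theorem Contr.mem {a s l : GLn n} (h : Contr a s l) {Γ : Subgroup (GLn n)}
    (hΓ : ZC (Reg n) (Γ : Set (GLn n))) (ha : a ∈ Γ) (hs : s ∈ Γ) : l ∈ Γ :=
  hΓ.isClosed.mem_of_tendsto h (Eventually.of_forall fun k =>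
    Γ.mul_mem (Γ.mul_mem (Γ.pow_mem ha k) hs) (Γ.inv_mem (Γ.pow_mem ha k)))

/-- A function bounded along both ends of a conjugation orbit takes its limit value. -/
theorem IsHyp.const {a : GLn n} (ha : IsHyp a) {f : GLn n → ℂ} (hf : f ∈ Reg n) (s : GLn n)
    {C C' : ℝ} (hC : ∀ k : ℕ, ‖f (a ^ k * s * (a ^ k)⁻¹)‖ ≤ C)
    (hC' : ∀ k : ℕ, ‖f ((a⁻¹) ^ k * s * ((a⁻¹) ^ k)⁻¹)‖ ≤ C') (k : ℤ) :
    f (a ^ k * s * (a ^ k)⁻¹) = f s := by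
  have h1 : (fun k : ℤ => f (a ^ k * s * (a ^ k)⁻¹)) ∈ expSum :=
    ((ha.regMap.mul (RegMap.const _ s)).mul ha.regMap.inv).comp hf
  have h2 := expSum_const h1 (C := C) (C' := C') (fun k => by simpa using hC k)
    (fun k => by simpa using hC' k) k
  simpa using h2

theorem tendsto_of_entries {x : ℕ → GLn n} {l : GLn n}
    (h : ∀ i j, Tendsto (fun k => (x k).1 i j) atTop (𝓝 (l.1 i j))) : Tendsto x atTop (𝓝 l) := by
  have h1 : Tendsto (fun k => (x k).1) atTop (𝓝 l.1) :=
    tendsto_pi_nhds.2 fun i => tendsto_pi_nhds.2 fun j => h i j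
  have hinv : ∀ g : GLn n, (g⁻¹).1 = (g.1.det)⁻¹ • g.1.adjugate := fun g => by
    rw [Matrix.coe_units_inv, Matrix.inv_def, Ring.inverse_eq_inv']
  have h2 : Tendsto (fun k => ((x k)⁻¹).1) atTop (𝓝 (l⁻¹).1) := by
    simp only [hinv]
    refine Tendsto.smul (Tendsto.inv₀ ?_ (det_ne_zero' l)) ?_
    · exact ((continuous_id.matrix_det).tendsto l.1).comp h1
    · exact ((continuous_id.matrix_adjugate).tendsto l.1).comp h1
  rw [Units.isInducing_embedProduct.tendsto_nhds_iff]
  exact h1.prodMk_nhds ((MulOpposite.continuous_op.tendsto _).comp h2)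

end Hyperbolic

section BigCell

open Filter Topology

variable {n : ℕ}

/-- The block of `M` on the indices with `d i ≤ r`, completed by the identity. -/
noncomputable def hatMat (d : Fin n → ℝ) (r : ℝ) (M : Matrix (Fin n) (Fin n) ℂ) : Matrix (Fin n) (Fin n) ℂ :=
  Matrix.of fun i j => if d i ≤ r ∧ d j ≤ r then M i j else if i = j then 1 else 0

theorem hatMat_of_le {d : Fin n → ℝ} {r : ℝ} (M : Matrix (Fin n) (Fin n) ℂ) {i j : Fin n}
    (hi : d i ≤ r) (hj : d j ≤ r) : hatMat d r M i j = M i j := by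
  simp [hatMat, hi, hj]

theorem hatMat_of_lt {d : Fin n → ℝ} {r : ℝ} (M : Matrix (Fin n) (Fin n) ℂ) {i : Fin n}
    (hi : r < d i) (j : Fin n) : hatMat d r M i j = (1 : Matrix (Fin n) (Fin n) ℂ) i j := by
  simp [hatMat, hi.not_ge, Matrix.one_apply]

theorem det_hatMat_ne_zero {d : Fin n → ℝ} (r : ℝ) {c : GLn n}
    (hc : ∀ i j, d i ≠ d j → c.1 i j = 0) (hc' : ∀ i j, d i ≠ d j → (c⁻¹).1 i j = 0) :
    (hatMat d r c.1).det ≠ 0 := by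
  have h0 : ∀ M : Matrix (Fin n) (Fin n) ℂ, (∀ i j, d i ≠ d j → M i j = 0) → ∀ i j, d i ≤ r →
      hatMat d r M i j = M i j := fun M hM i j hi => by
    rcases le_or_gt (d j) r with hj | hj
    · exact hatMat_of_le M hi hj
    · have hij : d i ≠ d j := (hi.trans_lt hj).ne
      rw [hM i j hij, hatMat, Matrix.of_apply, if_neg (fun h => hj.not_ge h.2),
        if_neg (fun h => hij (congrArg d h))]
  have h1 : hatMat d r c.1 * hatMat d r (c⁻¹).1 = 1 := by
    ext i j
    rw [Matrix.mul_apply]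
    rcases le_or_gt (d i) r with hi | hi
    · have h2 : (c.1 * (c⁻¹).1) i j = (1 : Matrix (Fin n) (Fin n) ℂ) i j := by
        rw [← Units.val_mul, mul_inv_cancel, Units.val_one]
      rw [← h2, Matrix.mul_apply]
      refine Finset.sum_congr rfl fun k _ => ?_
      rw [h0 _ hc i k hi]
      by_cases hk : d i = d k
      · rw [h0 _ hc' k j (hk ▸ hi)]
      · rw [hc i k hk, zero_mul, zero_mul]
    · simp only [hatMat_of_lt _ hi, ← Matrix.mul_apply, one_mul]
  intro h
  have := congrArg Matrix.det h1
  rw [Matrix.det_mul, h, zero_mul, Matrix.det_one] at this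
  exact zero_ne_one this

theorem mem_fun_ite {X : Type} {A : Subalgebra ℂ (X → ℂ)} (p : Prop) [Decidable p] {f g : X → ℂ} (hf : f ∈ A)
    (hg : g ∈ A) : (fun x => if p then f x else g x) ∈ A := by
  split_ifs <;> assumption

theorem hatMat_mem (d : Fin n → ℝ) (r : ℝ) (i j : Fin n) :
    (fun g : GLn n => hatMat d r g.1 i j) ∈ Reg n :=
  mem_fun_ite _ (reg_entry i j) (const_mem_fun _ _)

theorem eq_zero_of_commute {d : Fin n → ℝ} {a c : GLn n}
    (ha : a.1 = Matrix.diagonal fun i => (d i : ℂ)) (h : c * a = a * c) (i j : Fin n)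
    (hij : d i ≠ d j) : c.1 i j = 0 := by
  have h1 : (c.1 * a.1) i j = (a.1 * c.1) i j := by
    rw [← Units.val_mul, h, Units.val_mul]
  rw [ha, Matrix.mul_diagonal, Matrix.diagonal_mul] at h1
  have h2 : ((d i : ℂ) - d j) * c.1 i j = 0 := by linear_combination -h1
  refine (mul_eq_zero.1 h2).resolve_left ?_
  exact sub_ne_zero.2 fun h => hij (Complex.ofReal_injective h)

theorem tendsto_conj_entry {x y : ℝ} (hx : 0 < x) (hy : 0 < y) (z : ℂ) (hz : y < x → z = 0) :
    Tendsto (fun k : ℕ => (x : ℂ) ^ k * z * ((y : ℂ)⁻¹) ^ k) atTop (𝓝 (if x = y then z else 0)) := by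
  have hy0 : (y : ℂ) ≠ 0 := Complex.ofReal_ne_zero.2 hy.ne'
  have h0 : ∀ k : ℕ, (x : ℂ) ^ k * z * ((y : ℂ)⁻¹) ^ k = z * ((x : ℂ) / y) ^ k := fun k => by
    rw [div_eq_mul_inv, mul_pow]; ring
  simp only [h0]
  rcases lt_trichotomy x y with h | h | h
  · rw [if_neg h.ne]
    have h3 : ‖(x : ℂ) / y‖ < 1 := by
      rw [norm_div, Complex.norm_real, Complex.norm_real, Real.norm_of_nonneg hx.le,
        Real.norm_of_nonneg hy.le]
      exact (div_lt_one hy).2 h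
    simpa using (tendsto_pow_atTop_nhds_zero_of_norm_lt_one h3).const_mul z
  · subst h
    simp [div_self hy0]
  · rw [if_neg h.ne', hz h]
    simp

/-- Conjugation by a positive diagonal matrix, entrywise. -/
theorem conj_diagonal_entry {d : Fin n → ℝ} {a : GLn n} (hd : ∀ i, 0 < d i)
    (ha : a.1 = Matrix.diagonal fun i => (d i : ℂ)) (s : GLn n) (k : ℕ) (i j : Fin n) :
    (a ^ k * s * (a ^ k)⁻¹).1 i j = (d i : ℂ) ^ k * s.1 i j * ((d j : ℂ)⁻¹) ^ k := by
  have h1 := diagonal_zpow hd ha k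
  have h2 := diagonal_zpow hd ha (-k)
  rw [zpow_neg, zpow_natCast] at h2
  rw [zpow_natCast] at h1
  rw [Units.val_mul, Units.val_mul, h1, h2, Matrix.mul_diagonal, Matrix.diagonal_mul]
  simp

theorem contr_diagonal {d : Fin n → ℝ} {a s : GLn n} (hd : ∀ i, 0 < d i)
    (ha : a.1 = Matrix.diagonal fun i => (d i : ℂ)) (hs : ∀ i j, d j < d i → s.1 i j = 0) :
    ∃ l : GLn n, Contr a s l ∧ ∀ i j, l.1 i j = if d i = d j then s.1 i j else 0 := by
  set L : Matrix (Fin n) (Fin n) ℂ := Matrix.of fun i j => if d i = d j then s.1 i j else 0 with hL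
  have h1 : ∀ i j, Tendsto (fun k : ℕ => (a ^ k * s * (a ^ k)⁻¹).1 i j) atTop (𝓝 (L i j)) :=
    fun i j => by
      simp only [conj_diagonal_entry hd ha]
      exact tendsto_conj_entry (hd i) (hd j) _ (hs i j)
  have h2 : Tendsto (fun k : ℕ => (a ^ k * s * (a ^ k)⁻¹).1) atTop (𝓝 L) :=
    tendsto_pi_nhds.2 fun i => tendsto_pi_nhds.2 fun j => h1 i j
  have h3 := ((continuous_id.matrix_det).tendsto L).comp h2
  have h4 : L.det = s.1.det := by
    refine tendsto_nhds_unique h3 (tendsto_const_nhds.congr fun k => ?_)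
    simp only [Function.comp, id]
    rw [← Matrix.det_units_conj (a ^ k) s.1]
    simp
  have h5 : IsUnit L.det := by
    rw [h4]; exact isUnit_iff_ne_zero.2 (det_ne_zero' s)
  refine ⟨Matrix.GeneralLinearGroup.mk'' L h5, tendsto_of_entries h1, fun i j => rfl⟩

theorem exists_lu_diagonal {d : Fin n → ℝ} {a : GLn n} (hd : ∀ i, 0 < d i)
    (ha : a.1 = Matrix.diagonal fun i => (d i : ℂ)) :
    ∃ Δ ∈ Reg n, ∃ Λ : Fin n → Fin n → GLn n → ℂ, (∀ i j, Λ i j ∈ Reg n) ∧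
      (∀ c, c * a = a * c → Δ c ≠ 0) ∧ ∀ g, Δ g ≠ 0 → ∃ s u l : GLn n, g * s = u ∧ Contr a s l ∧
        Contr a⁻¹ u 1 ∧ ∀ i j, Δ g * l.1 i j = Λ i j g := by
  refine ⟨fun g => ∏ j, (hatMat d (d j) g.1).det,
    prod_mem_fun _ _ fun j _ => det_mem_fun fun i k => hatMat_mem d (d j) i k,
    fun i j g => if d i = d j then (∏ k ∈ Finset.univ.erase j, (hatMat d (d k) g.1).det) *
      (hatMat d (d j) g.1).adjugate i j else 0, fun i j => ?_, fun c hc => ?_, fun g hg => ?_⟩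
  · refine mem_fun_ite _ (mul_mem_fun (prod_mem_fun _ _ fun j _ =>
      det_mem_fun fun i k => hatMat_mem d (d j) i k) ?_) (const_mem_fun _ _)
    simp only [Matrix.adjugate_apply]
    refine det_mem_fun fun i' k => ?_
    simp only [Matrix.updateRow_apply]
    exact mem_fun_ite _ (const_mem_fun _ _) (hatMat_mem d (d j) i' k)
  · refine Finset.prod_ne_zero_iff.2 fun j _ => det_hatMat_ne_zero _ (eq_zero_of_commute ha hc)
      (eq_zero_of_commute ha ?_)
    have : Commute c a := hc
    exact this.inv_left
  · have hdet : ∀ j, (hatMat d (d j) g.1).det ≠ 0 := fun j =>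
      Finset.prod_ne_zero_iff.1 hg j (Finset.mem_univ j)
    set S : Matrix (Fin n) (Fin n) ℂ := Matrix.of fun i j => (hatMat d (d j) g.1)⁻¹ i j with hS
    have hmul : ∀ j i, ∑ k, hatMat d (d j) g.1 i k * S k j = (1 : Matrix (Fin n) (Fin n) ℂ) i j :=
      fun j i => by
        have := Matrix.mul_nonsing_inv (hatMat d (d j) g.1) (isUnit_iff_ne_zero.2 (hdet j))
        rw [← this, Matrix.mul_apply]; rfl
    have hS0 : ∀ i j, d j < d i → S i j = 0 := fun i j hij => by
      have h1 := hmul j i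
      simp only [hatMat_of_lt _ hij] at h1
      have h2 : ∑ k, (1 : Matrix (Fin n) (Fin n) ℂ) i k * S k j = S i j := by
        rw [← Matrix.mul_apply, one_mul]
      rw [h2] at h1
      rw [h1, Matrix.one_apply_ne fun h => hij.ne' (congrArg d h)]
    have hu : ∀ i j, d i ≤ d j → (g.1 * S) i j = (1 : Matrix (Fin n) (Fin n) ℂ) i j :=
      fun i j hij => by
        rw [← hmul j i, Matrix.mul_apply]
        refine Finset.sum_congr rfl fun k _ => ?_
        rcases le_or_gt (d k) (d j) with hk | hk
        · rw [hatMat_of_le _ hij hk]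
        · rw [hS0 k j hk, mul_zero, mul_zero]
    have hudet : (g.1 * S).det ≠ 0 := fun h0 => by
      obtain ⟨v, hv, hv0⟩ := Matrix.exists_mulVec_eq_zero_iff.2 h0
      obtain ⟨i0, hi0⟩ := Function.ne_iff.1 hv
      obtain ⟨i, hi, hmin⟩ := (Finset.univ.filter fun i => v i ≠ 0).exists_min_image d
        ⟨i0, by simpa using hi0⟩
      have h1 := congrFun hv0 i
      rw [Matrix.mulVec, dotProduct] at h1
      have h2 : ∀ j, (g.1 * S) i j * v j = (1 : Matrix (Fin n) (Fin n) ℂ) i j * v j := fun j => by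
        by_cases hj : v j = 0
        · rw [hj, mul_zero, mul_zero]
        · rw [hu i j (hmin j (by simpa using hj))]
      simp only [h2] at h1
      have h3 : ((1 : Matrix (Fin n) (Fin n) ℂ) *ᵥ v) i = 0 := h1
      rw [Matrix.one_mulVec] at h3
      exact (by simpa using hi : v i ≠ 0) h3
    have hsdet : S.det ≠ 0 := fun h => hudet (by rw [Matrix.det_mul, h, mul_zero])
    set s : GLn n := Matrix.GeneralLinearGroup.mk'' S (isUnit_iff_ne_zero.2 hsdet) with hs
    obtain ⟨l, hl, hl'⟩ := contr_diagonal (s := s) hd ha hS0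
    have hinv : (a⁻¹).1 = Matrix.diagonal fun i => (((d i)⁻¹ : ℝ) : ℂ) := by
      have := diagonal_zpow hd ha (-1)
      simpa using this
    have hval : (g * s).1 = g.1 * S := rfl
    obtain ⟨l', hl1, hl2⟩ := contr_diagonal (a := a⁻¹) (s := g * s) (fun i => inv_pos.2 (hd i)) hinv
      fun i j hij => by
        have h1 : d i < d j := (inv_lt_inv₀ (hd j) (hd i)).1 hij
        rw [hval, hu i j h1.le, Matrix.one_apply_ne fun h => h1.ne (congrArg d h)]
    have hl1' : l' = 1 := by
      ext i j
      rw [hl2, hval]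
      split_ifs with h
      · exact hu i j (inv_injective h).le
      · exact (Matrix.one_apply_ne fun h' => h (by rw [h'])).symm
    refine ⟨s, g * s, l, rfl, hl, hl1' ▸ hl1, fun i j => ?_⟩
    change (∏ j, (hatMat d (d j) g.1).det) * l.1 i j =
      if d i = d j then (∏ k ∈ Finset.univ.erase j, (hatMat d (d k) g.1).det) *
        (hatMat d (d j) g.1).adjugate i j else 0
    rw [hl']
    split_ifs with h
    · have h1 : s.1 i j = ((hatMat d (d j) g.1).det)⁻¹ * (hatMat d (d j) g.1).adjugate i j := by
        change (hatMat d (d j) g.1)⁻¹ i j = _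
        rw [Matrix.inv_def, Ring.inverse_eq_inv', Matrix.smul_apply, smul_eq_mul]
      rw [h1, ← Finset.prod_erase_mul _ _ (Finset.mem_univ j)]
      field_simp [hdet j]
    · rw [mul_zero]

end BigCell

section LUFactorization

open Filter Topology

variable {n : ℕ}

theorem IsHyp.exists_lu {a : GLn n} (h : IsHyp a) :
    ∃ Δ ∈ Reg n, ∃ Λ : Fin n → Fin n → GLn n → ℂ, (∀ i j, Λ i j ∈ Reg n) ∧
      (∀ c, c * a = a * c → Δ c ≠ 0) ∧ ∀ g, Δ g ≠ 0 → ∃ s u l : GLn n, g * s = u ∧ Contr a s l ∧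
        Contr a⁻¹ u 1 ∧ ∀ i j, Δ g * l.1 i j = Λ i j g := by
  obtain ⟨c, d, hd, hA⟩ := h
  obtain ⟨Δ, hΔ, Λ, hΛ, h1, h2⟩ := exists_lu_diagonal hd hA
  have hconj : RegMap (Reg n) fun g : GLn n => c⁻¹ * g * c :=
    ((RegMap.const _ c⁻¹).mul RegMap.id).mul (RegMap.const _ c)
  have ha : c * (c⁻¹ * a * c) * c⁻¹ = a := by group
  have ha' : c * (c⁻¹ * a * c)⁻¹ * c⁻¹ = a⁻¹ := by group
  refine ⟨fun g => Δ (c⁻¹ * g * c), hconj.comp hΔ,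
    fun i j g => ∑ m, (∑ k, c.1 i k * Λ k m (c⁻¹ * g * c)) * (c⁻¹).1 m j,
    fun i j => sum_mem_fun _ _ fun m _ => mul_mem_fun (sum_mem_fun _ _ fun k _ =>
      mul_mem_fun (const_mem_fun _ _) (hconj.comp (hΛ k m))) (const_mem_fun _ _),
    fun x hx => h1 _ ?_, fun g hg => ?_⟩
  · have : c⁻¹ * x * c * (c⁻¹ * a * c) = c⁻¹ * (x * a) * c := by group
    rw [this, hx]; group
  · obtain ⟨s, u, l, hgs, hs, hu, hl⟩ := h2 _ hg
    have hs' := hs.conj c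
    have hu' := hu.conj c
    rw [ha] at hs'
    rw [ha', mul_one, mul_inv_cancel] at hu'
    refine ⟨c * s * c⁻¹, c * u * c⁻¹, c * l * c⁻¹, ?_, hs', hu', fun i j => ?_⟩
    · rw [← hgs]; group
    · simp only [← hl, Units.val_mul, Matrix.mul_apply, Finset.mul_sum, Finset.sum_mul]
      refine Finset.sum_congr rfl fun m _ => Finset.sum_congr rfl fun k _ => by ring

theorem char_mul {ι : Type} {F : ι → GLn n → ℂ} {χ : GLn n → ℂ} {H : Subgroup (GLn n)}
    (hχ : ∀ h ∈ H, ∀ i z, F i (h * z) = χ h * F i z) (hne : ∃ i, F i 1 ≠ 0) {h h' : GLn n}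
    (hh : h ∈ H) (hh' : h' ∈ H) : χ (h * h') = χ h * χ h' := by
  obtain ⟨i, hi⟩ := hne
  have h1 := hχ _ (H.mul_mem hh hh') i 1
  rw [mul_assoc, hχ h hh, hχ h' hh', ← mul_assoc] at h1
  exact (mul_right_cancel₀ hi h1).symm

theorem char_one {ι : Type} {F : ι → GLn n → ℂ} {χ : GLn n → ℂ} {H : Subgroup (GLn n)}
    (hχ : ∀ h ∈ H, ∀ i z, F i (h * z) = χ h * F i z) (hne : ∃ i, F i 1 ≠ 0) : χ 1 = 1 := by
  obtain ⟨i, hi⟩ := hne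
  have h1 := hχ 1 H.one_mem i 1
  rw [mul_one] at h1
  exact (mul_eq_right₀ hi).1 h1.symm

theorem IsHyp.lu_mem {Γ : Subgroup (GLn n)} (hΓ : ZC (Reg n) (Γ : Set (GLn n))) {a : GLn n}
    (ha : IsHyp a) (haΓ : a ∈ Γ) {g s u l : GLn n} (hg : g ∈ Γ) (hgs : g * s = u)
    (hs : Contr a s l) (hu : Contr a⁻¹ u 1) : s ∈ Γ ∧ u ∈ Γ ∧ l ∈ Γ := by
  obtain ⟨ι, F, χ, M, -, hM, hFM, -, -, hχ, hmem, hne⟩ := exists_chevalley hΓ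
  have hχg : χ g * χ g⁻¹ = 1 := by
    rw [← char_mul hχ hne hg (Γ.inv_mem hg), mul_inv_cancel, char_one hχ hne]
  have hχg0 : χ g ≠ 0 := left_ne_zero_of_mul_eq_one hχg
  have key : ∀ i, ∀ k : ℤ, F i (a ^ k * u * (a ^ k)⁻¹) = χ g * F i (a ^ k * s * (a ^ k)⁻¹) := by
    intro i k
    have hk := Γ.zpow_mem haΓ k
    rw [← hgs, mul_assoc, mul_assoc, hχ _ hk, hχ _ hg, mul_assoc, hχ _ hk]
    ring
  have hconst : ∀ i, ∀ k : ℤ, F i (a ^ k * u * (a ^ k)⁻¹) = F i u := fun i k => by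
    obtain ⟨C, hC⟩ := hs.bounded (hM _ (hFM i))
    obtain ⟨C', hC'⟩ := hu.bounded (hM _ (hFM i))
    refine ha.const (hM _ (hFM i)) u (C := ‖χ g‖ * C) (fun k => ?_) hC' k
    have := key i k
    rw [zpow_natCast] at this
    rw [this, norm_mul]
    exact mul_le_mul_of_nonneg_left (hC k) (norm_nonneg _)
  have h1 : ∀ i, F i u = F i 1 := fun i => by
    have h2 := ((reg_continuous (hM _ (hFM i))).tendsto 1).comp hu
    refine tendsto_nhds_unique (tendsto_const_nhds.congr fun k => ?_) h2
    have := hconst i (-k)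
    rw [zpow_neg, zpow_natCast, ← inv_pow] at this
    exact this.symm
  have h2 : ∀ i, F i u = χ g * F i l := fun i => by
    have h2 := (((reg_continuous (hM _ (hFM i))).tendsto l).comp hs).const_mul (χ g)
    refine tendsto_nhds_unique (tendsto_const_nhds.congr fun k => ?_) h2
    have := key i k
    rw [hconst, zpow_natCast] at this
    exact this
  have hu' : u ∈ Γ := hmem u 1 fun i => by rw [h1, one_mul]
  refine ⟨?_, hu', hmem l (χ g)⁻¹ fun i => ?_⟩
  · have : s = g⁻¹ * u := by rw [← hgs]; group
    rw [this]; exact Γ.mul_mem (Γ.inv_mem hg) hu'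
  · rw [← h1, h2]; field_simp

theorem IsHyp.eq_one_of_contr {a : GLn n} (ha : IsHyp a) {u l : GLn n} (hu : Contr a u l)
    (hu' : Contr a⁻¹ u 1) : u = 1 ∧ l = 1 := by
  have h : ∀ f ∈ Reg n, f u = f l ∧ f u = f 1 := fun f hf => by
    obtain ⟨C, hC⟩ := hu.bounded hf
    obtain ⟨C', hC'⟩ := hu'.bounded hf
    have hconst := ha.const hf u hC hC'
    constructor
    · refine tendsto_nhds_unique (tendsto_const_nhds.congr fun k => ?_)
        (((reg_continuous hf).tendsto l).comp hu)
      have := hconst k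
      rw [zpow_natCast] at this
      exact this.symm
    · refine tendsto_nhds_unique (tendsto_const_nhds.congr fun k => ?_)
        (((reg_continuous hf).tendsto 1).comp hu')
      have := hconst (-k)
      rw [zpow_neg, zpow_natCast, ← inv_pow] at this
      exact this.symm
  constructor
  · ext i j; exact (h _ (reg_entry i j)).2
  · ext i j; exact ((h _ (reg_entry i j)).1.symm.trans (h _ (reg_entry i j)).2)

theorem exists_homogenization {Δ : GLn n → ℂ} (hΔ : Δ ∈ Reg n)
    {Λ : Fin n × Fin n → GLn n → ℂ} (hΛ : ∀ q, Λ q ∈ Reg n)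
    (p : MvPolynomial (Fin n × Fin n) ℂ) :
    ∃ (N : ℕ), ∃ P ∈ Reg n, ∀ g x, (∀ q, Δ g * x q = Λ q g) →
      Δ g ^ N * MvPolynomial.eval x p = P g := by
  induction p using MvPolynomial.induction_on with
  | C c => exact ⟨0, _, const_mem_fun _ c, fun g x _ => by simp⟩
  | add p q hp hq =>
    obtain ⟨N, P, hP, h⟩ := hp
    obtain ⟨N', P', hP', h'⟩ := hq
    refine ⟨N + N', _, add_mem_fun (mul_mem_fun (pow_mem_fun hΔ N') hP)
      (mul_mem_fun (pow_mem_fun hΔ N) hP'), fun g x hx => ?_⟩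
    rw [← h g x hx, ← h' g x hx, map_add]; ring
  | mul_X p q hp =>
    obtain ⟨N, P, hP, h⟩ := hp
    refine ⟨N + 1, _, mul_mem_fun hP (hΛ q), fun g x hx => ?_⟩
    rw [← h g x hx, ← hx q, map_mul, MvPolynomial.eval_X]; ring

/-- The centralizer of `a` in `Γ`. -/
def centIn (Γ : Subgroup (GLn n)) (a : GLn n) : Subgroup (GLn n) := Γ ⊓ Subgroup.centralizer {a}

theorem mem_centIn {Γ : Subgroup (GLn n)} {a g : GLn n} :
    g ∈ centIn Γ a ↔ g ∈ Γ ∧ g * a = a * g := by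
  rw [centIn, Subgroup.mem_inf, Subgroup.mem_centralizer_singleton_iff]

theorem zc_centIn {Γ : Subgroup (GLn n)} (hΓ : ZC (Reg n) (Γ : Set (GLn n))) (a : GLn n) :
    ZC (Reg n) (centIn Γ a : Set (GLn n)) := by
  have h1 : (centIn Γ a : Set (GLn n)) = (Γ : Set (GLn n)) ∩
      ⋂ q : Fin n × Fin n, {g | (g * a).1 q.1 q.2 - (a * g).1 q.1 q.2 = 0} := by
    ext g
    simp only [SetLike.mem_coe, mem_centIn, Set.mem_inter_iff, Set.mem_iInter, Set.mem_setOf_eq]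
    refine and_congr_right fun _ => ⟨fun h q => by rw [h, sub_self], fun h => ?_⟩
    ext i j
    exact sub_eq_zero.1 (h (i, j))
  rw [h1]
  refine hΓ.inter (ZC.iInter fun q => ?_)
  have := zc_zeros (A := Reg n) {fun g : GLn n => (g * a).1 q.1 q.2 - (a * g).1 q.1 q.2} (by
    rintro _ rfl
    exact sub_mem_fun ((RegMap.id.mul (RegMap.const _ a)).comp (reg_entry q.1 q.2))
      (((RegMap.const _ a).mul RegMap.id).comp (reg_entry q.1 q.2)))
  simpa using this

theorem IsHyp.irr_centIn {Γ : Subgroup (GLn n)} (hΓ : ZC (Reg n) (Γ : Set (GLn n)))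
    (hirr : Irr (Reg n) (Γ : Set (GLn n))) {a : GLn n} (ha : IsHyp a) (haΓ : a ∈ Γ) :
    Irr (Reg n) (centIn Γ a : Set (GLn n)) := by
  obtain ⟨Δ, hΔ, Λ, hΛ, h1, h2⟩ := ha.exists_lu
  refine ⟨⟨1, (centIn Γ a).one_mem⟩, fun f hf f' hf' hff' => ?_⟩
  have hl : ∀ g ∈ Γ, Δ g ≠ 0 → ∃ l ∈ centIn Γ a, ∀ q : Fin n × Fin n,
      Δ g * entriesOf l q = Λ q.1 q.2 g := fun g hg hg0 => by
    obtain ⟨s, u, l, hgs, hs, hu, hl⟩ := h2 g hg0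
    exact ⟨l, mem_centIn.2 ⟨(ha.lu_mem hΓ haΓ hg hgs hs hu).2.2, hs.comm⟩, fun q => hl q.1 q.2⟩
  have hc : ∀ c ∈ centIn Γ a, Δ c⁻¹ ≠ 0 ∧ ∀ q : Fin n × Fin n,
      Δ c⁻¹ * entriesOf c q = Λ q.1 q.2 c⁻¹ := fun c hc => by
    have hc' := (mem_centIn.1 ((centIn Γ a).inv_mem hc)).2
    have h0 := h1 _ hc'
    obtain ⟨s, u, l, hgs, hs, hu, hl⟩ := h2 _ h0
    have h3 := (contr_of_comm hc').mul hs
    rw [hgs] at h3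
    have h4 := (ha.eq_one_of_contr h3 hu).2
    rw [inv_mul_eq_one] at h4
    exact ⟨h0, fun q => by
      rw [show entriesOf c q = l.1 q.1 q.2 by rw [h4]; rfl]; exact hl q.1 q.2⟩
  obtain ⟨k, p, hp⟩ := reg_exists_poly hf
  obtain ⟨k', p', hp'⟩ := reg_exists_poly hf'
  obtain ⟨N, P, hP, hPp⟩ := exists_homogenization hΔ (fun q : Fin n × Fin n => hΛ q.1 q.2) p
  obtain ⟨N', P', hP', hPp'⟩ := exists_homogenization hΔ (fun q : Fin n × Fin n => hΛ q.1 q.2) p'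
  have hprod : ∀ g ∈ Γ, Δ g * (P g * P' g) = 0 := fun g hg => by
    by_cases h0 : Δ g = 0
    · rw [h0, zero_mul]
    · obtain ⟨l, hlC, hlq⟩ := hl g hg h0
      rw [← hPp g _ hlq, ← hPp' g _ hlq, ← hp, ← hp']
      linear_combination (Δ g * Δ g ^ N * l.1.det ^ k * Δ g ^ N' * l.1.det ^ k') * hff' l hlC
  have hback : ∀ {f : GLn n → ℂ} {k N : ℕ} {p : MvPolynomial (Fin n × Fin n) ℂ} {P : GLn n → ℂ},
      (∀ g : GLn n, g.1.det ^ k * f g = MvPolynomial.eval (entriesOf g) p) →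
      (∀ g x, (∀ q : Fin n × Fin n, Δ g * x q = Λ q.1 q.2 g) →
        Δ g ^ N * MvPolynomial.eval x p = P g) →
      (∀ g ∈ Γ, P g = 0) → ∀ c ∈ centIn Γ a, f c = 0 := fun hp hPp h0 c hcC => by
    have h3 := hPp c⁻¹ _ (hc c hcC).2
    rw [h0 _ (Γ.inv_mem (mem_centIn.1 hcC).1), ← hp] at h3
    have h4 := (mul_eq_zero.1 h3).resolve_left (pow_ne_zero _ (hc c hcC).1)
    exact (mul_eq_zero.1 h4).resolve_left (pow_ne_zero _ (det_ne_zero' c))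
  rcases hirr.2 _ hΔ _ (mul_mem_fun hP hP') hprod with h | h
  · exact absurd (h 1 Γ.one_mem) (h1 1 (by group))
  · exact (hirr.2 _ hP _ hP' h).imp (hback hp hPp) (hback hp' hPp')

theorem isUnipotentElt_of_contr {b u : GLn n} (h : Contr b u 1) : IsUnipotentElt u := by
  have h0 : Tendsto (fun k : ℕ => (b ^ k * u * (b ^ k)⁻¹).1) atTop (𝓝 1) :=
    (Units.continuous_val.tendsto 1).comp h
  have h1 : u.1.charpoly = (1 : Matrix (Fin n) (Fin n) ℂ).charpoly := by
    refine Polynomial.funext fun z => ?_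
    rw [Matrix.eval_charpoly, Matrix.eval_charpoly]
    have hc : Continuous fun M : Matrix (Fin n) (Fin n) ℂ => (Matrix.scalar (Fin n) z - M).det :=
      (continuous_const.sub continuous_id).matrix_det
    refine tendsto_nhds_unique (tendsto_const_nhds.congr fun k => ?_) ((hc.tendsto 1).comp h0)
    have h2 : (b ^ k).1 * (Matrix.scalar (Fin n) z - u.1) * ((b ^ k)⁻¹).1 =
        Matrix.scalar (Fin n) z - (b ^ k * u * (b ^ k)⁻¹).1 := by
      rw [mul_sub, sub_mul, ← (Matrix.scalar_commute z (fun _ => Commute.all _ _) (b ^ k).1).eq, mul_assoc,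
        ← Units.val_mul, mul_inv_cancel, Units.val_one, mul_one, Units.val_mul, Units.val_mul]
    simp only [Function.comp]
    rw [← h2, Matrix.det_mul, Matrix.det_mul, mul_right_comm, ← Matrix.det_mul, ← Units.val_mul,
      mul_inv_cancel, Units.val_one, Matrix.det_one, one_mul]
  have h2 := Matrix.aeval_self_charpoly u.1
  rw [h1, Matrix.charpoly_one] at h2
  simpa [IsUnipotentElt] using h2

end LUFactorization

section HyperbolicPart

variable {n : ℕ}

/-- The functions `k ↦ k ^ m * ν ^ k`, together with the value `0 ^ m * |ν|` at an extra point. -/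
def expPoly : Submonoid (Option ℕ → ℂ) where
  carrier := Set.range fun (q : ℕ × ℂˣ) (o : Option ℕ) =>
    o.elim ((0 : ℂ) ^ q.1 * (‖q.2.1‖ : ℂ)) fun k => (k : ℂ) ^ q.1 * q.2.1 ^ k
  one_mem' := ⟨(0, 1), by ext o; cases o <;> simp⟩
  mul_mem' := by
    rintro _ _ ⟨p, rfl⟩ ⟨q, rfl⟩
    refine ⟨(p.1 + q.1, p.2 * q.2), ?_⟩
    ext o
    cases o
    · simp [pow_add]; ring
    · simp [pow_add, mul_pow]; ring

/-- The algebra of exponential polynomials with the extra point. -/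
def expPolySum : Subalgebra ℂ (Option ℕ → ℂ) := Algebra.adjoin ℂ (expPoly : Set (Option ℕ → ℂ))

theorem expPoly_mem (m : ℕ) (ν : ℂˣ) : (fun o : Option ℕ =>
    o.elim ((0 : ℂ) ^ m * (‖ν.1‖ : ℂ)) fun k => (k : ℂ) ^ m * ν.1 ^ k) ∈ expPolySum :=
  Algebra.subset_adjoin ⟨(m, ν), rfl⟩

/-- The shift operator on sequences. -/
def shiftSeq : Module.End ℂ (ℕ → ℂ) where
  toFun f k := f (k + 1)
  map_add' _ _ := rfl
  map_smul' _ _ := rfl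

theorem expPoly_mem_maxGenEigenspace (ν : ℂ) (m : ℕ) :
    (fun k : ℕ => (k : ℂ) ^ m * ν ^ k) ∈ shiftSeq.maxGenEigenspace ν := by
  induction m using Nat.strong_induction_on with
  | _ m ih =>
    have h1 : (shiftSeq - ν • (1 : Module.End ℂ (ℕ → ℂ))) (fun k : ℕ => (k : ℂ) ^ m * ν ^ k) ∈
        shiftSeq.maxGenEigenspace ν := by
      have h2 : (shiftSeq - ν • (1 : Module.End ℂ (ℕ → ℂ))) (fun k : ℕ => (k : ℂ) ^ m * ν ^ k) =
          ∑ j ∈ Finset.range m, (ν * m.choose j) • fun k : ℕ => (k : ℂ) ^ j * ν ^ k := by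
        ext k
        have h3 : (((k + 1 : ℕ) : ℂ)) ^ m = ∑ j ∈ Finset.range m, (k : ℂ) ^ j * m.choose j +
            (k : ℂ) ^ m := by
          rw [Nat.cast_add, add_pow, Finset.sum_range_succ]; simp
        have h4 : (shiftSeq - ν • (1 : Module.End ℂ (ℕ → ℂ)))
            (fun k : ℕ => (k : ℂ) ^ m * ν ^ k) k =
            ((k + 1 : ℕ) : ℂ) ^ m * ν ^ (k + 1) - ν * ((k : ℂ) ^ m * ν ^ k) := rfl
        rw [h4, h3, Finset.sum_apply]
        simp only [Pi.smul_apply, smul_eq_mul]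
        have h5 : ∑ j ∈ Finset.range m, ν * (m.choose j : ℂ) * ((k : ℂ) ^ j * ν ^ k) =
            (∑ j ∈ Finset.range m, (k : ℂ) ^ j * m.choose j) * ν ^ (k + 1) := by
          rw [Finset.sum_mul]
          exact Finset.sum_congr rfl fun j _ => by ring
        rw [h5]; ring
      rw [h2]
      exact Submodule.sum_mem _ fun j hj => Submodule.smul_mem _ _ (ih j (Finset.mem_range.1 hj))
    obtain ⟨N, hN⟩ := (Module.End.mem_maxGenEigenspace _ _ _).1 h1
    exact (Module.End.mem_maxGenEigenspace _ _ _).2 ⟨N + 1, by rw [pow_succ]; exact hN⟩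

theorem expPolySum_eq_zero {x : Option ℕ → ℂ} (hx : x ∈ expPolySum) (h : ∀ k : ℕ, x (some k) = 0) :
    x none = 0 := by
  classical
  have h1 : x ∈ Submodule.span ℂ (Set.range fun (q : ℕ × ℂˣ) (o : Option ℕ) =>
      o.elim ((0 : ℂ) ^ q.1 * (‖q.2.1‖ : ℂ)) fun k => (k : ℂ) ^ q.1 * q.2.1 ^ k) := by
    have h2 : x ∈ Subalgebra.toSubmodule expPolySum := hx
    rw [expPolySum, Algebra.adjoin_eq_span, Submonoid.closure_eq] at h2
    exact h2
  obtain ⟨c, rfl⟩ := Finsupp.mem_span_range_iff_exists_finsupp.1 h1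
  have h3 : ∀ o : Option ℕ, (c.sum fun q a => a • fun o : Option ℕ =>
      o.elim ((0 : ℂ) ^ q.1 * (‖q.2.1‖ : ℂ)) fun k => (k : ℂ) ^ q.1 * q.2.1 ^ k) o =
      ∑ q ∈ c.support, c q * o.elim ((0 : ℂ) ^ q.1 * (‖q.2.1‖ : ℂ))
        fun k => (k : ℂ) ^ q.1 * q.2.1 ^ k := fun o => by
    rw [Finsupp.sum, Finset.sum_apply]; rfl
  simp only [h3, Option.elim_some, Option.elim_none] at h ⊢
  have hmaps : ∀ q ∈ c.support, q.2 ∈ c.support.image Prod.snd := fun q hq =>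
    Finset.mem_image_of_mem _ hq
  have hind : iSupIndep fun ν : ℂˣ => shiftSeq.maxGenEigenspace ν.1 :=
    (Module.End.independent_maxGenEigenspace shiftSeq).comp Units.val_injective
  have h4 := (iSupIndep_iff_finsetSum_eq_zero_imp_eq_zero _).1 hind (c.support.image Prod.snd)
    (fun ν => ∑ q ∈ c.support with q.2 = ν, c q • fun k : ℕ => (k : ℂ) ^ q.1 * ν.1 ^ k)
    (fun ν _ => Submodule.sum_mem _ fun q _ =>
      Submodule.smul_mem _ _ (expPoly_mem_maxGenEigenspace ν.1 q.1)) (by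
    ext k
    rw [Finset.sum_apply, Pi.zero_apply, ← h k, ← Finset.sum_fiberwise_of_maps_to hmaps]
    refine Finset.sum_congr rfl fun ν _ => ?_
    rw [Finset.sum_apply]
    refine Finset.sum_congr rfl fun q hq => ?_
    rw [(Finset.mem_filter.1 hq).2]; rfl)
  rw [← Finset.sum_fiberwise_of_maps_to hmaps]
  refine Finset.sum_eq_zero fun ν hν => ?_
  have h5 : ∑ q ∈ c.support with q.2 = ν, Polynomial.C (c q) * Polynomial.X ^ q.1 = 0 := by
    refine Polynomial.eq_zero_of_infinite_isRoot _ (Set.infinite_of_injective_forall_mem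
      (f := fun k : ℕ => (k : ℂ)) Nat.cast_injective fun k => ?_)
    have h6 := congrFun (h4 ν hν) k
    rw [Finset.sum_apply, Pi.zero_apply] at h6
    have h7 : ν.1 ^ k ≠ 0 := pow_ne_zero _ ν.ne_zero
    simp only [Set.mem_setOf_eq, Polynomial.IsRoot.def, Polynomial.eval_finsetSum,
      Polynomial.eval_mul, Polynomial.eval_C, Polynomial.eval_pow, Polynomial.eval_X]
    refine (mul_eq_zero.1 ?_).resolve_right h7
    rw [← h6, Finset.sum_mul]
    exact Finset.sum_congr rfl fun q _ => by simp [mul_assoc]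
  have h6 := congrArg (Polynomial.eval 0) h5
  simp only [Polynomial.eval_finsetSum,
      Polynomial.eval_mul, Polynomial.eval_C, Polynomial.eval_pow, Polynomial.eval_X,
      Polynomial.eval_zero] at h6
  have h7 : ∑ q ∈ c.support with q.2 = ν, c q * ((0 : ℂ) ^ q.1 * (‖q.2.1‖ : ℂ)) =
      (∑ q ∈ c.support with q.2 = ν, c q * 0 ^ q.1) * (‖ν.1‖ : ℂ) := by
    rw [Finset.sum_mul]
    refine Finset.sum_congr rfl fun q hq => ?_
    rw [(Finset.mem_filter.1 hq).2, mul_assoc]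
  rw [h7, h6, zero_mul]

theorem poly_mem_expPolySum (p : Polynomial ℂ) :
    (fun o : Option ℕ => o.elim (p.eval 0) fun k => p.eval (k : ℂ)) ∈ expPolySum := by
  have hX : (fun o : Option ℕ => o.elim 0 fun k => (k : ℂ)) ∈ expPolySum := by
    have := expPoly_mem 1 1
    convert this using 1
    ext o; cases o <;> simp
  induction p using Polynomial.induction_on' with
  | add p q hp hq =>
    convert add_mem_fun hp hq using 1
    ext o; cases o <;> simp
  | monomial m c =>
    convert mul_mem_fun (const_mem_fun expPolySum c) (pow_mem_fun hX m) using 1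
    ext o; cases o <;> simp [Polynomial.eval_monomial]

theorem choose_mem_expPolySum (m : ℕ) :
    (fun o : Option ℕ => o.elim (Nat.choose 0 m : ℂ) fun k => (k.choose m : ℂ)) ∈ expPolySum := by
  have h : ∀ k : ℕ, (Polynomial.C ((m.factorial : ℂ)⁻¹) * descPochhammer ℂ m).eval (k : ℂ) =
      k.choose m := fun k => by
    have : (m.factorial : ℂ) ≠ 0 := Nat.cast_ne_zero.2 m.factorial_ne_zero
    rw [Polynomial.eval_mul, Polynomial.eval_C, descPochhammer_eval_eq_descFactorial,
      Nat.descFactorial_eq_factorial_mul_choose, Nat.cast_mul]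
    field_simp
  convert poly_mem_expPolySum (Polynomial.C ((m.factorial : ℂ)⁻¹) * descPochhammer ℂ m) using 1
  ext o
  cases o with
  | none => rw [Option.elim_none, Option.elim_none, ← h 0, Nat.cast_zero]
  | some k => exact (h k).symm

theorem pow_mulVec_of_nilpotent {q : Matrix (Fin n) (Fin n) ℂ} {ν : ℂ} (hν : ν ≠ 0)
    {v : Fin n → ℂ} {N : ℕ} (h : ((q - Matrix.scalar (Fin n) ν) ^ N) *ᵥ v = 0) (k : ℕ) :
    q ^ k *ᵥ v = ∑ m ∈ Finset.range N, ((k.choose m : ℂ) * ν ^ k * (ν⁻¹) ^ m) •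
      (((q - Matrix.scalar (Fin n) ν) ^ m) *ᵥ v) := by
  set A := q - Matrix.scalar (Fin n) ν with hA
  have h2 : q ^ k *ᵥ v = ∑ m ∈ Finset.range (k + 1),
      ((k.choose m : ℂ) * ν ^ k * (ν⁻¹) ^ m) • ((A ^ m) *ᵥ v) := by
    have hc : Commute A (Matrix.scalar (Fin n) ν) :=
      (Matrix.scalar_commute ν (fun _ => Commute.all _ _) A).symm
    conv_lhs => rw [← sub_add_cancel q (Matrix.scalar (Fin n) ν)]
    rw [← hA, hc.add_pow, Matrix.sum_mulVec]
    refine Finset.sum_congr rfl fun m hm => ?_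
    have h3 : ν ^ k = ν ^ (k - m) * ν ^ m := by
      rw [← pow_add, Nat.sub_add_cancel (Nat.lt_succ_iff.1 (Finset.mem_range.1 hm))]
    have h4 : A ^ m * Matrix.scalar (Fin n) ν ^ (k - m) * (k.choose m : Matrix (Fin n) (Fin n) ℂ) =
        ((k.choose m : ℂ) * ν ^ (k - m)) • A ^ m := by
      rw [← map_pow, ← Nat.cast_comm, ← nsmul_eq_mul, ← Nat.cast_smul_eq_nsmul ℂ, mul_smul]
      congr 1
      ext i j
      simp [mul_comm]
    rw [h4, Matrix.smul_mulVec, h3]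
    congr 1
    rw [mul_assoc, mul_assoc (ν ^ (k - m)), ← mul_pow, mul_inv_cancel₀ hν, one_pow, mul_one]
  have h3 : ∀ m, m ∉ Finset.range N → (A ^ m) *ᵥ v = 0 := fun m hm => by
    obtain ⟨l, rfl⟩ := Nat.exists_eq_add_of_le (not_lt.1 fun h' => hm (Finset.mem_range.2 h'))
    rw [add_comm, pow_add, ← Matrix.mulVec_mulVec, h, Matrix.mulVec_zero]
  rw [h2]
  trans ∑ m ∈ Finset.range (max (k + 1) N), ((k.choose m : ℂ) * ν ^ k * (ν⁻¹) ^ m) • ((A ^ m) *ᵥ v)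
  · refine Finset.sum_subset (Finset.range_subset_range.2 (le_max_left _ _)) fun m _ hm => ?_
    rw [Nat.choose_eq_zero_of_lt (not_le.1 fun h' => hm (Finset.mem_range.2 (Nat.lt_succ_of_le h')))]
    simp
  · refine (Finset.sum_subset (Finset.range_subset_range.2 (le_max_right _ _)) fun m _ hm => ?_).symm
    rw [h3 m hm, smul_zero]

theorem matIn_expPolySum {q c : GLn n} {ν : Fin n → ℂ} (hν : ∀ j, ν j ≠ 0)
    (h : ∀ j, ∃ N, ((q.1 - Matrix.scalar (Fin n) (ν j)) ^ N) *ᵥ (fun i => c.1 i j) = 0) :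
    MatIn expPolySum fun o : Option ℕ => o.elim
      (c.1 * Matrix.diagonal (fun j => (‖ν j‖ : ℂ)) * (c⁻¹).1) fun k => q.1 ^ k := by
  have h1 : MatIn expPolySum fun o : Option ℕ => o.elim
      (c.1 * Matrix.diagonal (fun j => (‖ν j‖ : ℂ))) fun k => q.1 ^ k * c.1 := fun i j => by
    obtain ⟨N, hN⟩ := h j
    have hN' : ((q.1 - Matrix.scalar (Fin n) (ν j)) ^ (N + 1)) *ᵥ (fun i => c.1 i j) = 0 := by
      rw [pow_succ', ← Matrix.mulVec_mulVec, hN, Matrix.mulVec_zero]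
    have h2 : (fun o : Option ℕ => ∑ m ∈ Finset.range (N + 1),
        ((o.elim (Nat.choose 0 m : ℂ) fun k => (k.choose m : ℂ)) *
          (o.elim ((0 : ℂ) ^ 0 * (‖(Units.mk0 _ (hν j)).1‖ : ℂ)) fun k =>
            (k : ℂ) ^ 0 * (Units.mk0 _ (hν j)).1 ^ k)) *
          (((ν j)⁻¹) ^ m *
            ((((q.1 - Matrix.scalar (Fin n) (ν j)) ^ m) *ᵥ (fun i => c.1 i j)) i))) ∈
        expPolySum :=
      sum_mem_fun _ _ fun m _ => mul_mem_fun (mul_mem_fun (choose_mem_expPolySum m)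
        (expPoly_mem 0 (Units.mk0 _ (hν j)))) (const_mem_fun _ _)
    convert h2 using 1
    ext o
    cases o with
    | none =>
      rw [Finset.sum_range_succ']
      simp [Matrix.mul_diagonal, mul_comm]
    | some k =>
      have h3 : (q.1 ^ k * c.1) i j = (q.1 ^ k *ᵥ fun i => c.1 i j) i := rfl
      simp only [Option.elim_some]
      rw [h3, pow_mulVec_of_nilpotent (hν j) hN', Finset.sum_apply]
      refine Finset.sum_congr rfl fun m _ => ?_
      simp [mul_assoc]
  convert h1.mul (MatIn.const _ (c⁻¹).1) using 1
  ext o : 1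
  cases o with
  | none => rfl
  | some k =>
    simp only [Option.elim_some]
    rw [mul_assoc, ← Units.val_mul, mul_inv_cancel, Units.val_one, mul_one]

/-- A basis of generalized eigenvectors. -/
theorem exists_columns_mem {t : Set (Fin n → ℂ)} (hspan : Submodule.span ℂ t = ⊤) :
    ∃ c : GLn n, ∀ j, (fun i => c.1 i j) ∈ t := by
  obtain ⟨b, hbt, hb, hli⟩ := exists_linearIndependent ℂ t
  rw [hspan] at hb
  let B : Module.Basis b ℂ (Fin n → ℂ) := Module.Basis.mk hli (by rw [Subtype.range_coe, hb])
  have : Fintype b := Module.Basis.fintypeIndexOfRankLtAleph0 B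
    (Module.rank_lt_aleph0 ℂ (Fin n → ℂ))
  have hcard : Fintype.card b = n := by
    rw [← Module.finrank_eq_card_basis B]; simp
  let B' : Module.Basis (Fin n) ℂ (Fin n → ℂ) :=
    B.reindex (Fintype.equivFinOfCardEq hcard)
  have hdet : IsUnit (Matrix.of fun i j => B' j i).det := by
    have h1 : (Matrix.of fun i j => B' j i) = (Pi.basisFun ℂ (Fin n)).toMatrix B' := by
      ext i j; simp [Module.Basis.toMatrix]
    rw [h1]
    refine Matrix.isUnit_det_of_right_inverse (B := B'.toMatrix (Pi.basisFun ℂ (Fin n))) ?_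
    exact Module.Basis.toMatrix_mul_toMatrix_flip _ _
  refine ⟨Matrix.GeneralLinearGroup.mk'' (Matrix.of fun i j => B' j i) hdet, fun j => ?_⟩
  have h1 : B' j = ((Fintype.equivFinOfCardEq hcard).symm j).1 := by
    simp [B', B]
  have h2 := hbt ((Fintype.equivFinOfCardEq hcard).symm j).2
  rw [← h1] at h2
  exact h2

theorem exists_generalized_eigenbasis (q : GLn n) : ∃ (c : GLn n) (ν : Fin n → ℂ),
    (∀ j, ν j ≠ 0) ∧
    ∀ j, ∃ N, ((q.1 - Matrix.scalar (Fin n) (ν j)) ^ N) *ᵥ (fun i => c.1 i j) = 0 := by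
  set f : Module.End ℂ (Fin n → ℂ) := Matrix.toLin' q.1 with hf
  have hpow : ∀ (ν : ℂ) (N : ℕ) (v : Fin n → ℂ), ((f - ν • (1 : Module.End ℂ (Fin n → ℂ))) ^ N) v =
      ((q.1 - Matrix.scalar (Fin n) ν) ^ N) *ᵥ v := fun ν N v => by
    have h1 : f - ν • (1 : Module.End ℂ (Fin n → ℂ)) =
        Matrix.toLin' (q.1 - Matrix.scalar (Fin n) ν) := by
      rw [map_sub, hf]
      congr 1
      ext i j
      simp [Pi.single_apply]
    rw [h1, ← Matrix.toLin'_pow, Matrix.toLin'_apply]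
  set t : Set (Fin n → ℂ) := ⋃ ν : ℂ, (f.maxGenEigenspace ν : Set (Fin n → ℂ)) with ht
  have hspan : Submodule.span ℂ t = ⊤ := by
    rw [ht, Submodule.span_iUnion, ← Module.End.iSup_maxGenEigenspace_eq_top f]
    exact iSup_congr fun ν => Submodule.span_eq _
  obtain ⟨c, hc⟩ := exists_columns_mem hspan
  choose ν hν using fun j => Set.mem_iUnion.1 (hc j)
  refine ⟨c, ν, fun j h0 => ?_, fun j => ?_⟩
  · obtain ⟨N, hN⟩ := (Module.End.mem_maxGenEigenspace _ _ _).1 (hν j)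
    rw [hpow, h0] at hN
    have h1 : (q ^ N).1 *ᵥ (fun i => c.1 i j) = 0 := by simpa using hN
    have h2 := congrArg (fun v => (c⁻¹).1 *ᵥ (((q ^ N)⁻¹).1 *ᵥ v)) h1
    have h3 : (fun i => c.1 i j) = c.1 *ᵥ Pi.single j 1 := by
      ext i; simp
    rw [h3] at h2
    simp only [Matrix.mulVec_mulVec, ← Units.val_mul, inv_mul_cancel, Units.val_one,
      Matrix.one_mulVec, Matrix.mulVec_zero] at h2
    simpa using congrFun h2 j
  · obtain ⟨N, hN⟩ := (Module.End.mem_maxGenEigenspace _ _ _).1 (hν j)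
    rw [hpow] at hN
    exact ⟨N, hN⟩

/-- The hyperbolic part of `q`. -/
theorem exists_hyperbolic_part (q : GLn n) : ∃ h : GLn n, IsHyp h ∧
    (∀ f ∈ Reg n, (∀ k : ℕ, f (q ^ k) = 0) → f h = 0) ∧
    ∀ f ∈ Reg n, ∀ c : ℂ, c ≠ 0 → (∀ k : ℕ, f (q ^ k) = c ^ k) → f h = (‖c‖ : ℂ) := by
  obtain ⟨c, ν, hν, hc⟩ := exists_generalized_eigenbasis q
  have hinv : ∀ j, ∃ N, (((q⁻¹).1 - Matrix.scalar (Fin n) (ν j)⁻¹) ^ N) *ᵥ (fun i => c.1 i j) = 0 :=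
    fun j => by
      obtain ⟨N, hN⟩ := hc j
      refine ⟨N, ?_⟩
      have hS : Matrix.scalar (Fin n) (ν j)⁻¹ * Matrix.scalar (Fin n) (ν j) = 1 := by
        rw [← map_mul, inv_mul_cancel₀ (hν j), map_one]
      have hcm : ∀ z : ℂ, ∀ M : Matrix (Fin n) (Fin n) ℂ, Commute (Matrix.scalar (Fin n) z) M :=
        fun z M => Matrix.scalar_commute z (fun _ => Commute.all _ _) M
      have hq : (q⁻¹).1 * q.1 = 1 := by rw [← Units.val_mul, inv_mul_cancel, Units.val_one]
      have hq' : q.1 * (q⁻¹).1 = 1 := by rw [← Units.val_mul, mul_inv_cancel, Units.val_one]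
      have h1 : (q⁻¹).1 - Matrix.scalar (Fin n) (ν j)⁻¹ =
          (-(Matrix.scalar (Fin n) (ν j)⁻¹ * (q⁻¹).1)) * (q.1 - Matrix.scalar (Fin n) (ν j)) := by
        rw [neg_mul, mul_sub, mul_assoc, hq, mul_one, (hcm _ _).eq, mul_assoc, hS, mul_one, neg_sub]
      have h2 : Commute (-(Matrix.scalar (Fin n) (ν j)⁻¹ * (q⁻¹).1))
          (q.1 - Matrix.scalar (Fin n) (ν j)) := by
        refine Commute.neg_left (Commute.mul_left (hcm _ _) ?_)
        exact Commute.sub_right (hq.trans hq'.symm) (hcm _ _).symm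
      rw [h1, h2.mul_pow, ← Matrix.mulVec_mulVec, hN, Matrix.mulVec_zero]
  have hd : IsUnit (Matrix.diagonal fun j => (‖ν j‖ : ℂ)).det := by
    rw [Matrix.det_diagonal]
    exact isUnit_iff_ne_zero.2 (Finset.prod_ne_zero_iff.2 fun j _ =>
      Complex.ofReal_ne_zero.2 (norm_ne_zero_iff.2 (hν j)))
  set D : GLn n := Matrix.GeneralLinearGroup.mk'' _ hd with hD
  have hDinv : (D⁻¹).1 = Matrix.diagonal fun j => (‖(ν j)⁻¹‖ : ℂ) := by
    have := diagonal_zpow (A := D) (fun j => norm_pos_iff.2 (hν j)) rfl (-1)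
    simpa using this
  have hreg : RegMap expPolySum fun o : Option ℕ => o.elim (c * D * c⁻¹) fun k => q ^ k := by
    refine regMap_iff.2 ⟨?_, ?_⟩
    · convert matIn_expPolySum hν hc using 1
      ext o : 1
      cases o <;> rfl
    · convert matIn_expPolySum (fun j => inv_ne_zero (hν j)) hinv using 1
      ext o : 1
      cases o with
      | none =>
        simp only [Option.elim_none]
        rw [← hDinv, ← Units.val_mul, ← Units.val_mul]
        congr 1; group
      | some k => simp only [Option.elim_some]; rw [← inv_pow, Units.val_pow_eq_pow_val]
  refine ⟨c * D * c⁻¹, ⟨c, fun j => ‖ν j‖, fun j => norm_pos_iff.2 (hν j), ?_⟩,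
    fun f hf h0 => expPolySum_eq_zero (hreg.comp hf) h0, fun f hf z hz h0 => ?_⟩
  · have : c⁻¹ * (c * D * c⁻¹) * c = D := by group
    rw [this]; rfl
  · have h1 := expPolySum_eq_zero (sub_mem_fun (hreg.comp hf) (expPoly_mem 0 (Units.mk0 z hz)))
      fun k => by simp [h0 k]
    simp only [Option.elim_none, pow_zero, one_mul, Units.val_mk0] at h1
    exact sub_eq_zero.1 h1

end HyperbolicPart

section CentralHyperbolic

variable {n : ℕ}

theorem exists_translation_det (L : Subgroup (GLn n)) {M : Submodule ℂ (GLn n → ℂ)} (hM : M.FG)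
    (hMR : ∀ f ∈ M, f ∈ Reg n) (hw : ∀ w, ∀ f ∈ M, (fun z => f (w * z)) ∈ M) :
    ∃ (d : ℕ), ∃ δ ∈ Reg n, δ 1 = 1 ∧ (∀ g ∈ L, ∀ g' ∈ L, δ (g * g') = δ g * δ g') ∧
      (∀ g c, (∀ f ∈ M, ∀ z ∈ L, f (g * z) = c * f z) → δ g = c ^ d) ∧
      ∀ f ∈ M, ∀ z ∈ L, f z ≠ 0 → d ≠ 0 := by
  let R : (GLn n → ℂ) →ₗ[ℂ] (↥L → ℂ) := LinearMap.funLeft ℂ ℂ Subtype.val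
  have : Module.Finite ℂ (M.map R) := Module.Finite.iff_fg.2 (hM.map R)
  let b := Module.finBasis ℂ (M.map R)
  have hlift : ∀ i, ∃ P ∈ M, R P = b i := fun i => Submodule.mem_map.1 (b i).2
  choose P hPM hPb using hlift
  have hPz : ∀ i (z : L), P i z = (b i : ↥L → ℂ) z := fun i z => congrFun (hPb i) z
  have hli : LinearIndependent ℂ fun i => (b i : ↥L → ℂ) :=
    b.linearIndependent.map' (M.map R).subtype (Submodule.ker_subtype _)
  obtain ⟨y, hy⟩ := exists_points hli
  set D : GLn n → Matrix (Fin _) (Fin _) ℂ := fun g => Matrix.of fun i j => P i (g * y j) with hD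
  have hD1 : (D 1).det ≠ 0 := by
    rw [← Matrix.det_transpose] at hy
    convert hy using 3
    ext i j
    simp [hD, hPz]
  have hexp : ∀ g ∈ L, ∀ i, ∃ A : Fin _ → ℂ, ∀ z ∈ L, P i (g * z) = ∑ k, A k * P k z := by
    intro g hg i
    have hmem : R (fun z => P i (g * z)) ∈ M.map R := ⟨_, hw g _ (hPM i), rfl⟩
    refine ⟨b.repr ⟨_, hmem⟩, fun z hz => ?_⟩
    have h1 := congrArg (fun w : M.map R => (w : ↥L → ℂ) ⟨z, hz⟩) (b.sum_repr ⟨_, hmem⟩)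
    have h2 : P i (g * z) = R (fun z => P i (g * z)) ⟨z, hz⟩ := rfl
    rw [h2]
    refine h1.symm.trans ?_
    simp only [Submodule.coe_sum, Submodule.coe_smul, Finset.sum_apply, Pi.smul_apply, smul_eq_mul]
    exact Finset.sum_congr rfl fun k _ => by rw [← hPz]
  refine ⟨Module.finrank ℂ (M.map R), fun g => (D g).det * (D 1).det⁻¹,
    mul_mem_fun (det_mem_fun fun i j => (regMap_mulRight _).comp (hMR _ (hPM i)))
      (const_mem_fun _ _), mul_inv_cancel₀ hD1, ?_, ?_, ?_⟩
  · intro g hg g' hg'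
    choose A hA using hexp g hg
    have h1 : ∀ x ∈ L, D (g * x) = Matrix.of A * D x := fun x hx => by
      ext i j
      simp only [hD, Matrix.of_apply, Matrix.mul_apply, mul_assoc]
      exact hA i _ (L.mul_mem hx (y j).2)
    have h2 := h1 1 L.one_mem
    rw [mul_one] at h2
    change (D (g * g')).det * _ = (D g).det * _ * ((D g').det * _)
    rw [h1 g' hg', h2, Matrix.det_mul, Matrix.det_mul]
    field_simp
  · intro g c h
    have h1 : D g = c • D 1 := by
      ext i j
      simp only [hD, Matrix.of_apply, Matrix.smul_apply, smul_eq_mul, one_mul]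
      exact h _ (hPM i) _ (y j).2
    change (D g).det * _ = _
    rw [h1, Matrix.det_smul, Fintype.card_fin]
    field_simp
  · intro f hf z hz hne hd
    have hmem : R f ∈ M.map R := ⟨f, hf, rfl⟩
    have := Module.finrank_zero_iff.1 hd
    have h0 : (⟨R f, hmem⟩ : M.map R) = 0 := Subsingleton.elim _ _
    exact hne (congrFun (congrArg Subtype.val h0) ⟨z, hz⟩)

theorem exists_pow_eq_one_of_finite {Γ : Type*} [Group Γ] (φ : Γ →* ℂ)
    (h : (Set.range φ).Finite) : ∃ r, 0 < r ∧ ∀ g, φ g ^ r = 1 := by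
  have : Finite φ.toHomUnits.range := by
    have h1 : (Units.val '' (φ.toHomUnits.range : Set ℂˣ)).Finite := by
      refine h.subset ?_
      rintro _ ⟨_, ⟨g, rfl⟩, rfl⟩
      exact ⟨g, rfl⟩
    exact (h1.of_finite_image Units.val_injective.injOn).to_subtype
  refine ⟨Nat.card φ.toHomUnits.range, Nat.card_pos, fun g => ?_⟩
  have h1 := pow_card_eq_one' (x := (⟨φ.toHomUnits g, g, rfl⟩ : φ.toHomUnits.range))
  have h2 : φ.toHomUnits g ^ Nat.card φ.toHomUnits.range = 1 := by
    simpa using congrArg Subtype.val h1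
  have h3 : ((φ.toHomUnits g ^ Nat.card φ.toHomUnits.range : ℂˣ) : ℂ) = 1 := by
    rw [h2, Units.val_one]
  rwa [Units.val_pow_eq_pow_val] at h3

theorem norm_eq_of_multiplicative {q h : GLn n} {f : GLn n → ℂ} (hf : f ∈ Reg n)
    {Q : Subgroup (GLn n)} (hq : q ∈ Q) (h1 : f 1 = 1)
    (hmul : ∀ g ∈ Q, ∀ g' ∈ Q, f (g * g') = f g * f g')
    (hh : ∀ f ∈ Reg n, ∀ c : ℂ, c ≠ 0 → (∀ k : ℕ, f (q ^ k) = c ^ k) → f h = (‖c‖ : ℂ)) :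
    f h = (‖f q‖ : ℂ) := by
  refine hh f hf _ ?_ fun k => ?_
  · refine left_ne_zero_of_mul_eq_one (b := f q⁻¹) ?_
    rw [← hmul _ hq _ (Q.inv_mem hq), mul_inv_cancel, h1]
  · induction k with
    | zero => simpa using h1
    | succ k ih => rw [pow_succ, pow_succ, hmul _ (Q.pow_mem hq k) _ hq, ih]

/-- A connected group all of whose hyperbolic elements are central is trigonalizable. -/
theorem exists_flag_of_central {L : Subgroup (GLn n)} (hL : ZC (Reg n) (L : Set (GLn n)))
    (hirr : Irr (Reg n) (L : Set (GLn n)))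
    (hcent : ∀ b ∈ L, IsHyp b → ∀ g ∈ L, g * b = b * g) : ∃ c, L ≤ flagStab c := by
  obtain ⟨c, -, hc⟩ := exists_closed_orb (Y := Set.univ) hL (zc_univ _) ⟨1, trivial⟩
    ⟨fun _ _ _ _ => trivial, fun _ _ _ _ => trivial⟩
  refine ⟨c, ?_⟩
  set Q : Subgroup (GLn n) := L ⊓ flagStab c with hQ
  have hQc : ZC (Reg n) (Q : Set (GLn n)) := hL.inter (zc_flagStab c)
  obtain ⟨ι, F, χ, M, hM, hMR, hFM, hχ, hw, hh, hg, i, hi⟩ := exists_chevalley_right hQc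
  obtain ⟨d, δ, hδ, hδ1, hδm, hδc, hd⟩ := exists_translation_det L hM hMR hw
  replace hd := hd _ (hFM i) 1 L.one_mem hi
  have hχm : ∀ g ∈ Q, ∀ g' ∈ Q, χ (g * g') = χ g * χ g' := fun g hgQ g' hg' => by
    have h1 := hh _ (Q.mul_mem hgQ hg') _ (hFM i) 1
    rw [← mul_assoc, hh _ hg' _ (hFM i), hh _ hgQ _ (hFM i), ← mul_assoc] at h1
    rw [← mul_right_cancel₀ hi h1, mul_comm]
  have hχ1 : χ 1 = 1 := by
    have h1 := hh 1 Q.one_mem _ (hFM i) 1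
    rw [mul_one] at h1
    exact (mul_eq_right₀ hi).1 h1.symm
  have hQL : Q ≤ L := inf_le_left
  have hδinv : ∀ g ∈ L, δ g * δ g⁻¹ = 1 := fun g hgL => by
    rw [← hδm _ hgL _ (L.inv_mem hgL), mul_inv_cancel, hδ1]
  have hnorm : ∀ q ∈ Q, ‖δ q‖ = ‖χ q‖ ^ d := fun q hq => by
    obtain ⟨h, hhyp, h0, h1⟩ := exists_hyperbolic_part q
    have hhQ : h ∈ Q := hQc fun f hf hfQ => h0 f hf fun k => hfQ _ (Q.pow_mem hq k)
    have h2 := norm_eq_of_multiplicative hδ hq hδ1 (fun g hg g' hg' => hδm g (hQL hg) g' (hQL hg')) h1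
    have h3 := norm_eq_of_multiplicative hχ hq hχ1 hχm h1
    have h4 : δ h = χ h ^ d := hδc _ _ fun f hf z hz => by
      rw [← hcent h (hQL hhQ) hhyp z hz, hh h hhQ f hf]
    rw [h2, h3] at h4
    exact_mod_cast h4
  have hinvR : ∀ {f : GLn n → ℂ}, f ∈ Reg n → (fun g => f g⁻¹) ∈ Reg n :=
    fun hf => RegMap.id.inv.comp hf
  have hfin : ((fun g => χ g ^ d * δ g⁻¹) '' (Q : Set (GLn n))).Finite := by
    refine (isAffine_reg n).finite_image_of_bounded hQc
      (mul_mem_fun (pow_mem_fun hχ d) (hinvR hδ)) (C := 1) fun q hq => ?_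
    rw [norm_mul, norm_pow, ← hnorm q hq, ← norm_mul, hδinv q (hQL hq), norm_one]
  let φ : Q →* ℂ :=
    { toFun := fun q => χ q ^ d * δ (q : GLn n)⁻¹
      map_one' := by simp [hχ1, hδ1]
      map_mul' := fun q q' => by
        rw [Subgroup.coe_mul, mul_inv_rev, hχm _ q.2 _ q'.2,
          hδm _ (L.inv_mem (hQL q'.2)) _ (L.inv_mem (hQL q.2))]
        ring }
  obtain ⟨r, hr, hφ⟩ := exists_pow_eq_one_of_finite φ (hfin.subset (by
    rintro _ ⟨q, rfl⟩
    exact ⟨q, q.2, rfl⟩))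
  have hconst : ∀ f ∈ M, ∃ c, ∀ γ ∈ L, f γ * F i γ ^ (d * r - 1) * δ γ⁻¹ ^ r = c := fun f hf => by
    refine const_of_invariant hL hirr hc (mul_mem_fun (mul_mem_fun (hMR f hf)
      (pow_mem_fun (hMR _ (hFM i)) _)) (pow_mem_fun (hinvR hδ) _)) fun γ hγ q hqL hqc => ?_
    have hq : q ∈ Q := ⟨hqL, hqc⟩
    have h1 : χ q * χ q ^ (d * r - 1) = χ q ^ (d * r) := by
      rw [← pow_succ', Nat.sub_add_cancel (Nat.mul_pos (Nat.pos_of_ne_zero hd) hr)]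
    have h2 : (χ q ^ d * δ q⁻¹) ^ r = 1 := hφ ⟨q, hq⟩
    rw [mul_pow, ← pow_mul, ← h1] at h2
    rw [hh q hq f hf, hh q hq _ (hFM i), mul_inv_rev, hδm _ (L.inv_mem hqL) _ (L.inv_mem hγ)]
    linear_combination (f γ * F i γ ^ (d * r - 1) * δ γ⁻¹ ^ r) * h2
  have hval : ∀ f ∈ M, ∀ γ ∈ L, f γ * F i γ ^ (d * r - 1) * δ γ⁻¹ ^ r =
      f 1 * F i 1 ^ (d * r - 1) := fun f hf γ hγ => by
    obtain ⟨c, hc⟩ := hconst f hf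
    rw [hc γ hγ, ← hc 1 L.one_mem]
    simp [hδ1]
  intro g hgL
  have h0 := hval _ (hFM i) g hgL
  have hgi : F i g ≠ 0 := fun h => by
    rw [h, zero_mul, zero_mul] at h0
    exact mul_ne_zero hi (pow_ne_zero _ hi) h0.symm
  have hδ0 : δ g⁻¹ ≠ 0 := right_ne_zero_of_mul_eq_one (hδinv g hgL)
  have hgQ : g ∈ Q := hg g (F i g / F i 1) fun j => by
    have h1 := hval _ (hFM j) g hgL
    have h2 : F j g * F i 1 = F i g * F j 1 := by
      refine mul_right_cancel₀ (mul_ne_zero (pow_ne_zero (d * r - 1) hgi) (pow_ne_zero r hδ0))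
        (mul_right_cancel₀ (pow_ne_zero (d * r - 1) hi) ?_)
      linear_combination (F i 1 * F i 1 ^ (d * r - 1)) * h1 - (F j 1 * F i 1 ^ (d * r - 1)) * h0
    field_simp
    linear_combination h2
  exact hgQ.2

end CentralHyperbolic

section CommutingHyperbolic

variable {n : ℕ}

theorem diagonal_comm_iff {y : Matrix (Fin n) (Fin n) ℂ} {f : Fin n → ℂ} :
    y * Matrix.diagonal f = Matrix.diagonal f * y ↔ ∀ i j, y i j ≠ 0 → f i = f j := by
  rw [← Matrix.ext_iff]
  refine forall₂_congr fun i j => ?_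
  rw [Matrix.mul_diagonal, Matrix.diagonal_mul, mul_comm, mul_eq_mul_right_iff]
  tauto

theorem comm_iff_of_diagonal {c a g : GLn n} {f : Fin n → ℂ}
    (h : (c⁻¹ * a * c).1 = Matrix.diagonal f) :
    g * a = a * g ↔ ∀ i j, (c⁻¹ * g * c).1 i j ≠ 0 → f i = f j := by
  rw [← diagonal_comm_iff, ← h, ← Units.val_mul, ← Units.val_mul, Units.val_inj]
  constructor
  · intro hc
    have : c⁻¹ * g * c * (c⁻¹ * a * c) = c⁻¹ * (g * a) * c := by group
    rw [this, hc]; group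
  · intro hc
    have h1 : c * (c⁻¹ * g * c * (c⁻¹ * a * c)) * c⁻¹ = g * a := by group
    rw [← h1, hc]; group

theorem diagonal_of_mulVec {c a : GLn n} {f : Fin n → ℂ}
    (h : ∀ j, a.1 *ᵥ (fun i => c.1 i j) = f j • fun i => c.1 i j) :
    (c⁻¹ * a * c).1 = Matrix.diagonal f := by
  have h1 : (a * c).1 = c.1 * Matrix.diagonal f := by
    ext i j
    rw [Matrix.mul_diagonal, mul_comm]
    exact congrFun (h j) i
  rw [mul_assoc, Units.val_mul, h1, ← mul_assoc, ← Units.val_mul, inv_mul_cancel, Units.val_one,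
    one_mul]

theorem mulVec_of_diagonal {c a : GLn n} {f : Fin n → ℂ}
    (h : (c⁻¹ * a * c).1 = Matrix.diagonal f) (j : Fin n) :
    a.1 *ᵥ (fun i => c.1 i j) = f j • fun i => c.1 i j := by
  have h1 : (a * c).1 = c.1 * Matrix.diagonal f := by
    rw [← h, ← Units.val_mul]; congr 1; group
  ext i
  have h2 := congrFun (congrFun h1 i) j
  rw [Matrix.mul_diagonal, mul_comm] at h2
  exact h2

theorem IsHyp.exists_common_diagonal {a b : GLn n} (ha : IsHyp a) (hb : IsHyp b)
    (hab : a * b = b * a) : ∃ (c : GLn n) (d e : Fin n → ℝ), (∀ i, 0 < d i) ∧ (∀ i, 0 < e i) ∧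
      ((c⁻¹ * a * c).1 = Matrix.diagonal fun i => (d i : ℂ)) ∧
      (c⁻¹ * b * c).1 = Matrix.diagonal fun i => (e i : ℂ) := by
  classical
  obtain ⟨c, d, hd, hA⟩ := ha
  obtain ⟨c', e, he, hB⟩ := hb
  let t : Set (Fin n → ℂ) := {v | ∃ x y : ℝ, 0 < x ∧ 0 < y ∧ a.1 *ᵥ v = (x : ℂ) • v ∧
    b.1 *ᵥ v = (y : ℂ) • v}
  let π : ℝ → Matrix (Fin n) (Fin n) ℂ := fun y =>
    c'.1 * (Matrix.diagonal fun i => if e i = y then 1 else 0) * (c'⁻¹).1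
  have hcc : (c'⁻¹).1 * c'.1 = 1 := by rw [← Units.val_mul, inv_mul_cancel, Units.val_one]
  have hcc' : c'.1 * (c'⁻¹).1 = 1 := by rw [← Units.val_mul, mul_inv_cancel, Units.val_one]
  have hπb : ∀ y, b.1 * π y = (y : ℂ) • π y := fun y => by
    have h1 : (b * c').1 = c'.1 * Matrix.diagonal fun i => (e i : ℂ) := by
      rw [← hB, ← Units.val_mul]; congr 1; group
    change b.1 * (c'.1 * _ * _) = _
    rw [← mul_assoc, ← mul_assoc, ← Units.val_mul, h1, mul_assoc c'.1, Matrix.diagonal_mul_diagonal,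
      ← smul_mul_assoc, ← mul_smul_comm, ← Matrix.diagonal_smul]
    congr 3
    ext i
    by_cases h : e i = y <;> simp [h]
  have hπa : ∀ y, a.1 * π y = π y * a.1 := fun y => by
    have h1 := (comm_iff_of_diagonal hB).1 hab
    have h2 : (c'⁻¹ * a * c').1 * (Matrix.diagonal fun i => if e i = y then (1 : ℂ) else 0) =
        (Matrix.diagonal fun i => if e i = y then (1 : ℂ) else 0) * (c'⁻¹ * a * c').1 :=
      diagonal_comm_iff.2 fun i j hij => by rw [Complex.ofReal_injective (h1 i j hij)]
    have h3 := congrArg (fun m => c'.1 * m * (c'⁻¹).1) h2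
    simp only [Units.val_mul] at h3
    simp only [π]
    calc _ = c'.1 * ((c'⁻¹).1 * a.1 * c'.1 *
          (Matrix.diagonal fun i => if e i = y then (1 : ℂ) else 0)) * (c'⁻¹).1 := by
          simp only [← mul_assoc, hcc', one_mul]
      _ = _ := h3
      _ = _ := by simp only [mul_assoc, hcc', mul_one]
  have hπ1 : ∑ y ∈ Finset.univ.image e, π y = 1 := by
    simp only [π]
    rw [← Finset.sum_mul, ← Finset.mul_sum]
    have : ∑ y ∈ Finset.univ.image e,
        (Matrix.diagonal fun i => if e i = y then (1 : ℂ) else 0) = 1 := by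
      ext i j
      rw [Matrix.sum_apply]
      rcases eq_or_ne i j with rfl | h
      · simp
      · simp [h]
    rw [this, mul_one, hcc']
  have hcol : ∀ j, (fun i => c.1 i j) ∈ Submodule.span ℂ t := fun j => by
    have h1 : (fun i => c.1 i j) = ∑ y ∈ Finset.univ.image e, π y *ᵥ fun i => c.1 i j := by
      rw [← Matrix.sum_mulVec, hπ1, Matrix.one_mulVec]
    rw [h1]
    refine Submodule.sum_mem _ fun y hy => Submodule.subset_span ?_
    obtain ⟨i, -, rfl⟩ := Finset.mem_image.1 hy
    refine ⟨d j, e i, hd j, he i, ?_, ?_⟩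
    · rw [Matrix.mulVec_mulVec, hπa, ← Matrix.mulVec_mulVec, mulVec_of_diagonal hA,
        Matrix.mulVec_smul]
    · rw [Matrix.mulVec_mulVec, hπb, Matrix.smul_mulVec]
  have hspan : Submodule.span ℂ t = ⊤ := by
    refine eq_top_iff.2 fun v _ => ?_
    have h1 : v = ∑ j, ((c⁻¹).1 *ᵥ v) j • fun i => c.1 i j := by
      conv_lhs => rw [← mulVec_inv_cancel c v]
      ext i
      simp [Matrix.mulVec, dotProduct, Finset.sum_apply, mul_comm]
    rw [h1]
    exact Submodule.sum_mem _ fun j _ => Submodule.smul_mem _ _ (hcol j)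
  obtain ⟨c₀, hc₀⟩ := exists_columns_mem hspan
  choose x y hx hy hax hby using hc₀
  exact ⟨c₀, x, y, hx, hy, diagonal_of_mulVec hax, diagonal_of_mulVec hby⟩

theorem IsHyp.exists_comm_both {a b : GLn n} (ha : IsHyp a) (hb : IsHyp b)
    (hab : a * b = b * a) : ∃ N : ℕ, IsHyp (a ^ N * b) ∧
      ∀ g, g * (a ^ N * b) = a ^ N * b * g → g * a = a * g ∧ g * b = b * g := by
  obtain ⟨c, d, e, hd, he, hA, hB⟩ := ha.exists_common_diagonal hb hab
  have hpow : ∀ N : ℕ, (c⁻¹ * (a ^ N * b) * c).1 =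
      Matrix.diagonal fun i => ((d i ^ N * e i : ℝ) : ℂ) := fun N => by
    have h1 := diagonal_zpow hd hA N
    have h2 : c⁻¹ * (a ^ N * b) * c = (c⁻¹ * a * c) ^ (N : ℤ) * (c⁻¹ * b * c) := by
      have h3 : (c⁻¹ * a * c) ^ (N : ℤ) = c⁻¹ * a ^ N * c := by
        rw [zpow_natCast]
        have := conj_pow (i := N) (a := c⁻¹) (b := a)
        rwa [inv_inv] at this
      rw [h3]; group
    rw [h2, Units.val_mul, h1, hB, Matrix.diagonal_mul_diagonal]
    simp
  have hfin : (⋃ q : Fin n × Fin n, {N : ℕ | d q.1 ≠ d q.2 ∧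
      d q.1 ^ N * e q.1 = d q.2 ^ N * e q.2}).Finite := by
    refine Set.finite_iUnion fun q => Set.Subsingleton.finite ?_
    have key : ∀ N N' : ℕ, N < N' → d q.1 ≠ d q.2 → d q.1 ^ N * e q.1 = d q.2 ^ N * e q.2 →
        d q.1 ^ N' * e q.1 = d q.2 ^ N' * e q.2 → False := by
      intro N N' hN hne h1 h2
      obtain ⟨k, rfl⟩ := Nat.exists_eq_add_of_lt hN
      rw [add_assoc, pow_add (d q.1), pow_add (d q.2)] at h2
      have h3 : d q.1 ^ (k + 1) = d q.2 ^ (k + 1) := by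
        refine mul_left_cancel₀ (mul_pos (pow_pos (hd q.2) N) (he q.2)).ne' ?_
        linear_combination h2 - d q.1 ^ (k + 1) * h1
      exact hne ((pow_left_inj₀ (hd _).le (hd _).le (Nat.succ_ne_zero k)).1 h3)
    rintro N ⟨hne, h1⟩ N' ⟨-, h2⟩
    rcases lt_trichotomy N N' with h | h | h
    · exact (key _ _ h hne h1 h2).elim
    · exact h
    · exact (key _ _ h hne h2 h1).elim
  obtain ⟨N, hN⟩ := hfin.exists_notMem
  simp only [Set.mem_iUnion, Set.mem_setOf_eq, not_exists, not_and] at hN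
  refine ⟨N, ⟨c, fun i => d i ^ N * e i, fun i => mul_pos (pow_pos (hd i) N) (he i), hpow N⟩,
    fun g hg => ?_⟩
  have h1 := (comm_iff_of_diagonal (hpow N)).1 hg
  have hd' : ∀ i j, (c⁻¹ * g * c).1 i j ≠ 0 → d i = d j := fun i j hij => by
    by_contra hne
    exact hN (i, j) hne (Complex.ofReal_injective (h1 i j hij))
  refine ⟨(comm_iff_of_diagonal hA).2 fun i j hij => by rw [hd' i j hij],
    (comm_iff_of_diagonal hB).2 fun i j hij => ?_⟩
  have h2 := Complex.ofReal_injective (h1 i j hij)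
  rw [hd' i j hij] at h2
  rw [mul_left_cancel₀ (pow_pos (hd j) N).ne' h2]

/-- A closed connected group contains a hyperbolic element whose centralizer is
trigonalizable. -/
theorem exists_hyp_trig_centralizer {G : Subgroup (GLn n)} (hG : ZC (Reg n) (G : Set (GLn n)))
    (hirr : Irr (Reg n) (G : Set (GLn n))) :
    ∃ a ∈ G, IsHyp a ∧ ∃ c, centIn G a ≤ flagStab c := by
  obtain ⟨S, hS, ⟨a, haG, ha, rfl⟩, hmin⟩ := exists_min_ZC (isAffine_reg n)
    (fun S => ∃ a ∈ G, IsHyp a ∧ S = (centIn G a : Set (GLn n)))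
    ⟨_, zc_centIn hG 1, 1, G.one_mem, ⟨1, fun _ => 1, fun _ => one_pos, by simp⟩, rfl⟩
  refine ⟨a, haG, ha, exists_flag_of_central (zc_centIn hG a) (ha.irr_centIn hG hirr haG) ?_⟩
  intro b hb hbh g hg
  obtain ⟨hbG, hba⟩ := mem_centIn.1 hb
  obtain ⟨N, hN, hcomm⟩ := ha.exists_comm_both hbh hba.symm
  have hmem : a ^ N * b ∈ G := G.mul_mem (G.pow_mem haG N) hbG
  have h1 := hmin _ (zc_centIn hG (a ^ N * b)) ⟨_, hmem, hN, rfl⟩ fun x hx => by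
    obtain ⟨hxG, hx⟩ := mem_centIn.1 hx
    exact mem_centIn.2 ⟨hxG, (hcomm x hx).1⟩
  have h2 : g ∈ (centIn G (a ^ N * b) : Set (GLn n)) := h1 ▸ hg
  exact (hcomm g (mem_centIn.1 h2).2).2

end CommutingHyperbolic

section DominantPoint

open Filter Topology

variable {n : ℕ}

/-- Functions whose left translates by powers of `a` are combinations of the exponentials with
bases `ρ i`. -/
def expDec (a : GLn n) {ι : Type} [Fintype ι] (ρ : ι → ℝ) : Submodule ℂ (GLn n → ℂ) where
  carrier := {f | ∃ c : ι → GLn n → ℂ, ∀ (k : ℕ) z, f (a ^ k * z) = ∑ i, (ρ i : ℂ) ^ k * c i z}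
  add_mem' := by
    rintro f g ⟨c, hc⟩ ⟨c', hc'⟩
    refine ⟨fun i z => c i z + c' i z, fun k z => ?_⟩
    simp only [Pi.add_apply, hc, hc', mul_add, Finset.sum_add_distrib]
  zero_mem' := ⟨fun _ _ => 0, fun k z => by simp⟩
  smul_mem' := by
    rintro x f ⟨c, hc⟩
    refine ⟨fun i z => x * c i z, fun k z => ?_⟩
    simp only [Pi.smul_apply, hc, smul_eq_mul, Finset.mul_sum]
    exact Finset.sum_congr rfl fun i _ => by ring

theorem expDec_inl (a : GLn n) {ι κ : Type} [Fintype ι] [Fintype κ] (ρ : ι → ℝ) (σ : κ → ℝ) :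
    expDec a ρ ≤ expDec a (Sum.elim ρ σ) := by
  rintro f ⟨c, hc⟩
  exact ⟨Sum.elim c fun _ _ => 0, fun k z => by simp [hc]⟩

theorem expDec_inr (a : GLn n) {ι κ : Type} [Fintype ι] [Fintype κ] (ρ : ι → ℝ) (σ : κ → ℝ) :
    expDec a σ ≤ expDec a (Sum.elim ρ σ) := by
  rintro f ⟨c, hc⟩
  exact ⟨Sum.elim (fun _ _ => 0) c, fun k z => by simp [hc]⟩

theorem IsHyp.exists_mem_expDec {a : GLn n} (ha : IsHyp a) {f : GLn n → ℂ} (hf : f ∈ Reg n) :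
    ∃ (ι : Type) (_ : Fintype ι) (ρ : ι → ℝ), (∀ i, 0 < ρ i) ∧ f ∈ expDec a ρ := by
  obtain ⟨c, d, hd, hA⟩ := ha
  have hpow : ∀ k : ℤ, a ^ k = c * (c⁻¹ * a * c) ^ k * c⁻¹ := fun k => by
    have := conj_zpow (a := c) (b := c⁻¹ * a * c) (i := k)
    rw [← this]; congr 1; group
  induction hf using reg_induction with
  | h1 i j =>
    refine ⟨Fin n, inferInstance, d, hd, fun p z => c.1 i p * (c⁻¹ * z).1 p j, fun k z => ?_⟩
    change (a ^ k * z).1 i j = _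
    rw [← zpow_natCast a k, hpow, mul_assoc, mul_assoc, Units.val_mul, Units.val_mul,
      diagonal_zpow hd hA, Matrix.mul_apply]
    refine Finset.sum_congr rfl fun p _ => ?_
    rw [Matrix.diagonal_mul, zpow_natCast]; ring
  | h2 i j =>
    refine ⟨Fin n, inferInstance, fun i => (d i)⁻¹, fun i => inv_pos.2 (hd i),
      fun p z => (z⁻¹ * c).1 i p * (c⁻¹).1 p j, fun k z => ?_⟩
    change ((a ^ k * z)⁻¹).1 i j = _
    have h1 : (a ^ k * z)⁻¹ = z⁻¹ * c * (c⁻¹ * a * c) ^ (-(k : ℤ)) * c⁻¹ := by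
      rw [mul_inv_rev, ← zpow_natCast a k, ← zpow_neg, hpow]; group
    rw [h1, Units.val_mul, Units.val_mul _ ((c⁻¹ * a * c) ^ (-(k : ℤ))), diagonal_zpow hd hA,
      Matrix.mul_apply]
    refine Finset.sum_congr rfl fun p _ => ?_
    rw [Matrix.mul_diagonal, zpow_neg, zpow_natCast, Complex.ofReal_inv, inv_pow]; ring
  | h3 x =>
    exact ⟨Unit, inferInstance, fun _ => 1, fun _ => one_pos, fun _ _ => x, fun k z => by simp⟩
  | h4 f g _ _ hf hg =>
    obtain ⟨ι, _, ρ, hρ, hf⟩ := hf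
    obtain ⟨κ, _, σ, hσ, hg⟩ := hg
    exact ⟨ι ⊕ κ, inferInstance, Sum.elim ρ σ, Sum.rec hρ hσ,
      add_mem (expDec_inl a ρ σ hf) (expDec_inr a ρ σ hg)⟩
  | h5 f g _ _ hf hg =>
    obtain ⟨ι, _, ρ, hρ, c, hf⟩ := hf
    obtain ⟨κ, _, σ, hσ, c', hg⟩ := hg
    refine ⟨ι × κ, inferInstance, fun q => ρ q.1 * σ q.2, fun q => mul_pos (hρ _) (hσ _),
      fun q z => c q.1 z * c' q.2 z, fun k z => ?_⟩
    rw [Pi.mul_apply, hf, hg, Finset.sum_mul_sum, Fintype.sum_prod_type]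
    refine Finset.sum_congr rfl fun i _ => Finset.sum_congr rfl fun j _ => ?_
    push_cast
    ring

theorem IsHyp.exists_le_expDec {a : GLn n} (ha : IsHyp a) {M : Submodule ℂ (GLn n → ℂ)} (hM : M.FG)
    (hMR : ∀ f ∈ M, f ∈ Reg n) :
    ∃ (ι : Type) (_ : Fintype ι) (ρ : ι → ℝ), (∀ i, 0 < ρ i) ∧ M ≤ expDec a ρ := by
  revert hMR
  induction M, hM using Submodule.fg_induction with
  | singleton f =>
    intro hf
    obtain ⟨ι, _, ρ, hρ, h⟩ := ha.exists_mem_expDec (hf f (Submodule.mem_span_singleton_self f))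
    exact ⟨ι, _, ρ, hρ, (Submodule.span_singleton_le_iff_mem _ _).2 h⟩
  | sup N₁ N₂ _ _ h₁ h₂ =>
    intro h
    obtain ⟨ι, _, ρ, hρ, h₁⟩ := h₁ fun f hf => h f (Submodule.mem_sup_left hf)
    obtain ⟨κ, _, σ, hσ, h₂⟩ := h₂ fun f hf => h f (Submodule.mem_sup_right hf)
    exact ⟨ι ⊕ κ, inferInstance, Sum.elim ρ σ, Sum.rec hρ hσ,
      sup_le (h₁.trans (expDec_inl a ρ σ)) (h₂.trans (expDec_inr a ρ σ))⟩

/-- The dominant growth rate of the functions in `M` under translation by powers of `a`. -/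
theorem IsHyp.exists_growth {a : GLn n} (ha : IsHyp a) {M : Submodule ℂ (GLn n → ℂ)} (hM : M.FG)
    (hMR : ∀ f ∈ M, f ∈ Reg n) {S : Set (GLn n)} (hne : ∃ f ∈ M, ∃ z ∈ S, f z ≠ 0) :
    ∃ ρ : ℝ, 0 < ρ ∧ ∃ μ : (GLn n → ℂ) → GLn n → ℂ,
      (∀ f ∈ M, ∀ z ∈ S, Tendsto (fun k : ℕ => f (a ^ k * z) / (ρ : ℂ) ^ k) atTop (𝓝 (μ f z))) ∧
      ∃ f ∈ M, ∃ z ∈ S, μ f z ≠ 0 := by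
  classical
  obtain ⟨ι, _, ρ, hρ, hle⟩ := ha.exists_le_expDec hM hMR
  replace hle : ∀ f, f ∈ M → f ∈ expDec a ρ := fun f hf => hle hf
  choose! c hc using hle
  let ν : (GLn n → ℂ) → GLn n → ℝ → ℂ := fun f z r => ∑ i with ρ i = r, c f i z
  have hν : ∀ f ∈ M, ∀ k z, f (a ^ k * z) = ∑ r ∈ Finset.univ.image ρ, (r : ℂ) ^ k * ν f z r :=
    fun f hf k z => by
      rw [hc f hf, ← Finset.sum_fiberwise_of_maps_to (g := ρ) (t := Finset.univ.image ρ)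
        fun i hi => Finset.mem_image_of_mem _ hi]
      refine Finset.sum_congr rfl fun r _ => ?_
      rw [Finset.mul_sum]
      refine Finset.sum_congr rfl fun i hi => ?_
      rw [(Finset.mem_filter.1 hi).2]
  let R := (Finset.univ.image ρ).filter fun r => ∃ f ∈ M, ∃ z ∈ S, ν f z r ≠ 0
  have hR : R.Nonempty := by
    obtain ⟨f, hf, z, hz, hfz⟩ := hne
    have h1 := hν f hf 0 z
    rw [pow_zero, one_mul] at h1
    rw [h1] at hfz
    obtain ⟨r, hr, hr0⟩ := Finset.exists_ne_zero_of_sum_ne_zero hfz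
    exact ⟨r, Finset.mem_filter.2 ⟨hr, f, hf, z, hz, right_ne_zero_of_mul hr0⟩⟩
  obtain ⟨r₀, hr₀, hmax⟩ := R.exists_max_image id hR
  obtain ⟨hr₀', h0⟩ := Finset.mem_filter.1 hr₀
  have hpos : ∀ r ∈ Finset.univ.image ρ, 0 < r := fun r hr => by
    obtain ⟨i, -, rfl⟩ := Finset.mem_image.1 hr
    exact hρ i
  have hr₀pos := hpos _ hr₀'
  refine ⟨r₀, hr₀pos, fun f z => ν f z r₀, fun f hf z hz => ?_, h0⟩
  have hlim : ∀ r ∈ Finset.univ.image ρ, Tendsto (fun k : ℕ => (r : ℂ) ^ k * ν f z r / (r₀ : ℂ) ^ k)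
      atTop (𝓝 (if r = r₀ then ν f z r₀ else 0)) := fun r hr => by
    split_ifs with h
    · subst h
      refine tendsto_const_nhds.congr fun k => ?_
      rw [mul_div_cancel_left₀ _ (pow_ne_zero _ (Complex.ofReal_ne_zero.2 hr₀pos.ne'))]
    · rcases lt_or_gt_of_ne h with h | h
      · have h1 : Tendsto (fun k : ℕ => ((r : ℂ) / r₀) ^ k) atTop (𝓝 0) := by
          refine tendsto_pow_atTop_nhds_zero_of_norm_lt_one ?_
          rw [norm_div, Complex.norm_of_nonneg (hpos r hr).le, Complex.norm_of_nonneg hr₀pos.le]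
          exact (div_lt_one hr₀pos).2 h
        have h2 := h1.mul_const (ν f z r)
        rw [zero_mul] at h2
        refine h2.congr fun k => ?_
        rw [div_pow]; ring
      · have h1 : ν f z r = 0 := by
          by_contra hne
          exact absurd (hmax r (Finset.mem_filter.2 ⟨hr, f, hf, z, hz, hne⟩)) (not_le.2 h)
        simp [h1]
  have h1 := tendsto_finsetSum _ hlim
  rw [Finset.sum_ite_eq' , if_pos hr₀'] at h1
  refine h1.congr fun k => ?_
  rw [hν f hf, Finset.sum_div]

/-- Some translate of the dominant part is attained at a point of a group with closed orbit. -/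
theorem exists_dominant_point {G : Subgroup (GLn n)} (hG : ZC (Reg n) (G : Set (GLn n)))
    {x : GLn n} (hx : ZC (Reg n) (orb G x)) {a : GLn n} (haG : a ∈ G)
    {M : Submodule ℂ (GLn n → ℂ)} {χ : GLn n → ℂ} (hMR : ∀ f ∈ M, f ∈ Reg n)
    (hw : ∀ w, ∀ f ∈ M, (fun z => f (w * z)) ∈ M)
    (hχ : ∀ h ∈ G ⊓ flagStab x, ∀ f ∈ M, ∀ z, f (z * h) = χ h * f z) {ρ : ℝ} (hρ : 0 < ρ)
    {μ : (GLn n → ℂ) → GLn n → ℂ}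
    (hμ : ∀ f ∈ M, ∀ z ∈ G, Tendsto (fun k : ℕ => f (a ^ k * z) / (ρ : ℂ) ^ k) atTop (𝓝 (μ f z)))
    (hne : ∃ f ∈ M, ∃ z ∈ G, μ f z ≠ 0) :
    ∃ κ ∈ G, ∀ f ∈ M, f (a * κ) = ρ * f κ := by
  obtain ⟨f₀, hf₀, g, hg, h0⟩ := hne
  obtain ⟨K, hK, hKG, h⟩ := exists_compact_of_closed_orb hG.isClosed hx.isClosed
  choose y hyK hy using fun k : ℕ => h (a ^ k * g) (G.mul_mem (G.pow_mem haG k) hg)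
  set q : ℕ → GLn n := fun k => (y k)⁻¹ * (a ^ k * g) with hq
  have hqQ : ∀ k, q k ∈ G ⊓ flagStab x := fun k =>
    ⟨G.mul_mem (G.inv_mem (hKG (hyK k))) (G.mul_mem (G.pow_mem haG k) hg), hy k⟩
  have hfy : ∀ f ∈ M, ∀ k, f (a ^ k * g) = χ (q k) * f (y k) := fun f hf k => by
    rw [← hχ _ (hqQ k) f hf, hq]; congr 1; group
  obtain ⟨κ, hκK, hκ⟩ := hK.ultrafilter_le_nhds ((hyperfilter ℕ).map y)
    (Filter.le_principal_iff.2 (Filter.mem_map.2 (Filter.univ_mem' hyK)))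
  have hylim : Tendsto y (hyperfilter ℕ) (𝓝 κ) := hκ
  have hflim : ∀ f ∈ M, Tendsto (fun k => f (y k)) (hyperfilter ℕ) (𝓝 (f κ)) := fun f hf =>
    ((reg_continuous (hMR f hf)).tendsto κ).comp hylim
  have hμ' : ∀ f ∈ M, Tendsto (fun k => χ (q k) / (ρ : ℂ) ^ k * f (y k)) (hyperfilter ℕ)
      (𝓝 (μ f g)) := fun f hf =>
    ((hμ f hf g hg).mono_left Nat.hyperfilter_le_atTop).congr fun k => by rw [hfy f hf]; ring
  have hcross : ∀ f ∈ M, ∀ f' ∈ M, μ f g * f' κ = μ f' g * f κ := fun f hf f' hf' =>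
    tendsto_nhds_unique (((hμ' f hf).mul (hflim f' hf')).congr fun k => by ring)
      ((hμ' f' hf').mul (hflim f hf))
  have hρ0 : (ρ : ℂ) ≠ 0 := Complex.ofReal_ne_zero.2 hρ.ne'
  have hshift : ∀ f ∈ M, μ (fun z => f (a * z)) g = ρ * μ f g := fun f hf => by
    refine tendsto_nhds_unique (hμ _ (hw a f hf) g hg) ?_
    refine (((tendsto_add_atTop_iff_nat 1).2 (hμ f hf g hg)).const_mul (ρ : ℂ)).congr fun k => ?_
    change (ρ : ℂ) * (f (a ^ (k + 1) * g) / _) = f (a * (a ^ k * g)) / _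
    rw [pow_succ', ← mul_assoc a, pow_succ]
    field_simp
  refine ⟨κ, hKG hκK, fun f hf => ?_⟩
  have h1 := hcross f₀ hf₀ _ (hw a f hf)
  have h2 := hcross f₀ hf₀ f hf
  rw [hshift f hf] at h1
  refine mul_left_cancel₀ h0 ?_
  linear_combination h1 - ρ * h2

end DominantPoint

section Contracting

open Filter Topology

variable {n : ℕ}

theorem mem_flagStab_mul {x γ t g : GLn n} (ht : t ∈ Tri n) :
    g ∈ flagStab (γ * x * t) ↔ γ⁻¹ * g * γ ∈ flagStab x := by
  rw [mem_flagStab, mem_flagStab]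
  have : (γ * x * t)⁻¹ * g * (γ * x * t) = t⁻¹ * (x⁻¹ * (γ⁻¹ * g * γ) * x) * t := by group
  rw [this]
  rw [(Tri n).mul_mem_cancel_right ht, (Tri n).mul_mem_cancel_left ((Tri n).inv_mem ht)]

/-- A subgroup of the centralizer of `a` that fixes a flag fixes a dominant flag. -/
theorem exists_fixed_dominant {G L : Subgroup (GLn n)} (hG : ZC (Reg n) (G : Set (GLn n)))
    {x : GLn n} (hx : ZC (Reg n) (orb G x)) {a : GLn n}
    (hLG : L ≤ G) (hLa : ∀ γ ∈ L, γ * a = a * γ) (hL : BC L) {c : GLn n} (hc : L ≤ flagStab c)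
    {M : Submodule ℂ (GLn n → ℂ)} {χ : GLn n → ℂ} (hMR : ∀ f ∈ M, f ∈ Reg n)
    (hw : ∀ w, ∀ f ∈ M, (fun z => f (w * z)) ∈ M)
    (hχ : ∀ h ∈ G ⊓ flagStab x, ∀ f ∈ M, ∀ z, f (z * h) = χ h * f z) {ρ : ℂ}
    (hne : ∃ κ ∈ G, ∀ f ∈ M, f (a * κ) = ρ * f κ) :
    ∃ κ ∈ G, (∀ f ∈ M, f (a * κ) = ρ * f κ) ∧ ∀ γ ∈ L, κ⁻¹ * γ * κ ∈ flagStab x := by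
  obtain ⟨K, hK, hKG, h⟩ := exists_compact_of_closed_orb hG.isClosed hx.isClosed
  set T : Set (GLn n) := {κ | κ ∈ G ∧ ∀ f ∈ M, f (a * κ) = ρ * f κ} with hT
  have hTc : IsClosed T := by
    have : T = (G : Set (GLn n)) ∩ ⋂ f : M, {κ | f.1 (a * κ) = ρ * f.1 κ} := by
      ext κ; simp [hT]
    rw [this]
    refine hG.isClosed.inter (isClosed_iInter fun f => isClosed_eq ?_ ?_)
    · exact (reg_continuous (hMR _ f.2)).comp (continuous_const_mul a)
    · exact continuous_const.mul (reg_continuous (hMR _ f.2))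
  set Y : Set (GLn n) := {y | ∃ κ ∈ T, ∃ t ∈ Tri n, y = κ * x * t} with hY
  have hYeq : Y = (T ∩ K) * {y | x⁻¹ * y ∈ Tri n} := by
    ext y
    constructor
    · rintro ⟨κ, ⟨hκG, hκ⟩, t, ht, rfl⟩
      obtain ⟨k, hk, hkκ⟩ := h κ hκG
      have hq : k⁻¹ * κ ∈ G ⊓ flagStab x := ⟨G.mul_mem (G.inv_mem (hKG hk)) hκG, hkκ⟩
      have hq' := (G ⊓ flagStab x).inv_mem hq
      refine ⟨k, ⟨⟨hKG hk, fun f hf => ?_⟩, hk⟩, k⁻¹ * (κ * x * t), ?_, by simp⟩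
      · have e1 : k = κ * (k⁻¹ * κ)⁻¹ := by group
        have h1 := hχ _ hq' f hf κ
        have h2 := hχ _ hq' f hf (a * κ)
        rw [← e1] at h1
        rw [mul_assoc, ← e1] at h2
        rw [h1, h2, hκ f hf]; ring
      · have := mem_flagStab.1 hkκ
        have e : x⁻¹ * (k⁻¹ * (κ * x * t)) = x⁻¹ * (k⁻¹ * κ) * x * t := by group
        change x⁻¹ * (k⁻¹ * (κ * x * t)) ∈ Tri n
        rw [e]
        exact (Tri n).mul_mem this ht
    · rintro ⟨k, ⟨hkT, -⟩, z, hz, rfl⟩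
      exact ⟨k, hkT, x⁻¹ * z, hz, by simp [mul_assoc]⟩
  have hYc : IsClosed Y := by
    rw [hYeq]
    refine IsClosed.mul_left_of_isCompact ?_ (hK.inter_left hTc)
    exact zc_Tri.isClosed.preimage (continuous_const_mul x⁻¹)
  have hst : Stable L Y := by
    constructor
    · rintro γ hγ _ ⟨κ, ⟨hκG, hκ⟩, t, ht, rfl⟩
      refine ⟨γ * κ, ⟨G.mul_mem (hLG hγ) hκG, fun f hf => ?_⟩, t, ht, by simp [mul_assoc]⟩
      rw [← mul_assoc, ← hLa γ hγ, mul_assoc]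
      exact hκ _ (hw γ f hf)
    · rintro s hs _ ⟨κ, hκ, t, ht, rfl⟩
      exact ⟨κ, hκ, t * s, (Tri n).mul_mem ht hs, by simp [mul_assoc]⟩
  obtain ⟨κ, hκG, hκ⟩ := hne
  obtain ⟨y, ⟨κ', ⟨hG', hκ'⟩, t, ht, rfl⟩, hy⟩ := exists_fixed_flag hL hc hYc
    ⟨κ * x, κ, ⟨hκG, hκ⟩, 1, (Tri n).one_mem, by simp⟩ hst
  exact ⟨κ', hG', hκ', fun γ hγ => (mem_flagStab_mul ht).1 (hy hγ)⟩

/-- A stabilizer of a flag with closed orbit contains everything that some hyperbolic element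
contracts. -/
theorem exists_contracting {G : Subgroup (GLn n)} (hG : ZC (Reg n) (G : Set (GLn n)))
    (hirr : Irr (Reg n) (G : Set (GLn n))) {x : GLn n} (hx : ZC (Reg n) (orb G x)) :
    ∃ a ∈ G, IsHyp a ∧ ∀ p ∈ G, ∀ l, Contr a p l → p ∈ flagStab x := by
  obtain ⟨a, haG, ha, c, hc⟩ := exists_hyp_trig_centralizer hG hirr
  obtain ⟨ι, F, χ, M, hM, hMR, hF, -, hw, hχ, hQ, i, hi⟩ :=
    exists_chevalley_right (H := G ⊓ flagStab x) (by
      have := hG.inter (zc_flagStab x)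
      exact this)
  obtain ⟨ρ, hρ, μ, hμ, hne⟩ := ha.exists_growth hM hMR (S := (G : Set (GLn n)))
    ⟨F i, hF i, 1, G.one_mem, hi⟩
  obtain ⟨κ, hκG, hκ, hL⟩ := exists_fixed_dominant hG hx (L := centIn G a)
    (fun g hg => (mem_centIn.1 hg).1) (fun g hg => (mem_centIn.1 hg).2)
    (bc_of_irr (zc_centIn hG a) (ha.irr_centIn hG hirr haG)) hc hMR hw hχ
    (exists_dominant_point hG hx haG hMR hw hχ hρ hμ hne)
  have hρ0 : (ρ : ℂ) ≠ 0 := Complex.ofReal_ne_zero.2 hρ.ne'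
  set b : GLn n := κ⁻¹ * a * κ with hb
  have hbG : b ∈ G := G.mul_mem (G.mul_mem (G.inv_mem hκG) haG) hκG
  have hbQ : b ∈ G ⊓ flagStab x := ⟨hbG, hL a (mem_centIn.2 ⟨haG, rfl⟩)⟩
  have hbh : IsHyp b := by simpa [hb] using ha.conj κ⁻¹
  have hχb : χ b = ρ := by
    have h1 := hκ _ (hw κ⁻¹ _ (hF i))
    have h2 := hχ b hbQ _ (hF i) 1
    simp only [inv_mul_cancel, ← mul_assoc] at h1
    rw [one_mul, h1] at h2
    exact (mul_right_cancel₀ hi h2).symm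
  have hpow : ∀ f ∈ M, ∀ w, ∀ k : ℕ, f (w * b ^ k) = ρ ^ k * f w := fun f hf w k => by
    induction k with
    | zero => simp
    | succ k ih => rw [pow_succ, ← mul_assoc, hχ b hbQ f hf, ih, hχb]; ring
  refine ⟨b⁻¹, G.inv_mem hbG, hbh.inv, fun p hp l hl => ?_⟩
  have hlG : l ∈ G := hl.mem hG (G.inv_mem hbG) hp
  have hlQ : l ∈ G ⊓ flagStab x := by
    refine ⟨hlG, ?_⟩
    have h1 := hL (κ * l * κ⁻¹) (mem_centIn.2 ⟨G.mul_mem (G.mul_mem hκG hlG) (G.inv_mem hκG), ?_⟩)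
    · have e : κ⁻¹ * (κ * l * κ⁻¹) * κ = l := by group
      rwa [e] at h1
    · have h2 : l * b = b * l := by
        have := hl.comm
        calc l * b = b * (b⁻¹ * l) * b := by group
          _ = b * (l * b⁻¹) * b := by rw [this]
          _ = b * l := by group
      have e1 : κ * l * κ⁻¹ * a = κ * (l * b) * κ⁻¹ := by rw [hb]; group
      have e2 : a * (κ * l * κ⁻¹) = κ * (b * l) * κ⁻¹ := by rw [hb]; group
      rw [e1, e2, h2]
  have heq : ∀ f ∈ M, f p = f l := fun f hf => by
    obtain ⟨C, hC⟩ := hl.bounded (hMR f hf)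
    obtain ⟨C', hC'⟩ : ∃ C' : ℝ, ∀ k : ℕ, ‖f (b ^ k * p * (b ^ k)⁻¹)‖ ≤ C' := by
      obtain ⟨C', hC'⟩ := (Metric.isBounded_range_of_tendsto _
        (hμ _ (hw κ⁻¹ f hf) (κ * p) (G.mul_mem hκG hp))).exists_norm_le
      refine ⟨C', fun k => le_of_eq_of_le ?_ (hC' _ ⟨k, rfl⟩)⟩
      congr 1
      have h1 := hpow f hf (b ^ k * p * (b ^ k)⁻¹) k
      rw [inv_mul_cancel_right] at h1
      have h2 : κ⁻¹ * (a ^ k * (κ * p)) = b ^ k * p := by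
        have : b ^ k = κ⁻¹ * a ^ k * κ := by
          rw [hb]; simpa using (conj_pow (a := κ⁻¹) (b := a) (i := k))
        rw [this]; group
      change _ = f (κ⁻¹ * (a ^ k * (κ * p))) / _
      rw [h2, h1]
      field_simp
    have hconst := hbh.inv.const (hMR f hf) p hC (by rwa [inv_inv])
    refine tendsto_nhds_unique (tendsto_const_nhds.congr fun k => ?_)
        (((reg_continuous (hMR f hf)).tendsto l).comp hl)
    have := hconst k
    rw [zpow_natCast] at this
    exact this.symm
  refine (hQ p (χ l) fun j => ?_).2
  rw [heq _ (hF j), ← hχ l hlQ _ (hF j), one_mul]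

end Contracting

section Unipotent

variable {n : ℕ}

theorem IsUnipotentElt.char_eq_one {u : GLn n} (hu : IsUnipotentElt u) {H : Subgroup (GLn n)}
    (huH : u ∈ H) {χ : GLn n → ℂ} (hχ : χ ∈ Reg n) (h1 : χ 1 = 1)
    (hmul : ∀ h ∈ H, ∀ h' ∈ H, χ (h * h') = χ h * χ h') : χ u = 1 := by
  obtain ⟨p, hp⟩ := exists_poly_pow hu hχ
  obtain ⟨q, hq⟩ := exists_poly_pow hu.inv hχ
  have hpq : p * q = 1 := by
    refine Polynomial.eq_of_infinite_eval_eq _ _ (Set.infinite_of_injective_forall_mem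
      (f := fun k : ℕ => (k : ℂ)) Nat.cast_injective fun k => ?_)
    rw [Set.mem_setOf_eq, Polynomial.eval_mul, ← hp, ← hq,
      ← hmul _ (H.pow_mem huH k) _ (H.pow_mem (H.inv_mem huH) k), inv_pow, mul_inv_cancel, h1,
      Polynomial.eval_one]
  have hdeg := Polynomial.natDegree_eq_zero_of_isUnit (IsUnit.of_mul_eq_one q hpq)
  rw [Polynomial.natDegree_eq_zero] at hdeg
  obtain ⟨c, rfl⟩ := hdeg
  have e0 := hp 0
  have e1 := hp 1
  simp only [Polynomial.eval_C, pow_zero, pow_one] at e0 e1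
  rw [e1, ← e0, h1]

theorem diag_mul_of_mem_Tri {g h : GLn n} (hg : g ∈ Tri n) (hh : h ∈ Tri n) (i : Fin n) :
    (g * h).1 i i = g.1 i i * h.1 i i := by
  rw [Units.val_mul, Matrix.mul_apply, Finset.sum_eq_single i]
  · intro j _ hji
    rcases lt_or_gt_of_ne hji with h1 | h1
    · rw [mem_Tri.1 hg i j h1, zero_mul]
    · rw [mem_Tri.1 hh j i h1, mul_zero]
  · simp

theorem isUnipotentElt_iff_diag {g : GLn n} (hg : g ∈ Tri n) :
    IsUnipotentElt g ↔ ∀ i, g.1 i i = 1 := by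
  refine ⟨fun h i => h.char_eq_one (χ := fun g => g.1 i i) hg (reg_entry i i) (by simp)
    fun h hh h' hh' => diag_mul_of_mem_Tri hh hh' i, fun h => ?_⟩
  have h1 := Matrix.charpoly_of_isUpperTriangular g.1 fun i j hij => mem_Tri.1 hg i j hij
  have h2 := Matrix.aeval_self_charpoly g.1
  rw [h1] at h2
  simpa [h, IsUnipotentElt] using h2

theorem isUnipotentElt_mul_of_mem_flagStab {x g h : GLn n} (hg : g ∈ flagStab x)
    (hh : h ∈ flagStab x) (hgu : IsUnipotentElt g) (hhu : IsUnipotentElt h) :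
    IsUnipotentElt (g * h) := by
  have hg' := mem_flagStab.1 hg
  have hh' := mem_flagStab.1 hh
  have key : ∀ u : GLn n, IsUnipotentElt u → IsUnipotentElt (x⁻¹ * u * x) := fun u hu => by
    simpa using hu.conj x⁻¹
  have h1 := (isUnipotentElt_iff_diag hg').1 (key g hgu)
  have h2 := (isUnipotentElt_iff_diag hh').1 (key h hhu)
  have h3 := (isUnipotentElt_iff_diag ((Tri n).mul_mem hg' hh')).2 fun i => by
    rw [diag_mul_of_mem_Tri hg' hh', h1, h2, one_mul]
  have h4 := h3.conj x
  have e : x * (x⁻¹ * g * x * (x⁻¹ * h * x)) * x⁻¹ = g * h := by group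
  rwa [e] at h4

/-- The unipotent elements of `G` stabilizing a flag. -/
def flagUnip (G : Subgroup (GLn n)) (x : GLn n) : Subgroup (GLn n) where
  carrier := {g | (g ∈ G ∧ g ∈ flagStab x) ∧ IsUnipotentElt g}
  one_mem' := ⟨⟨G.one_mem, (flagStab x).one_mem⟩, by
    rcases n.eq_zero_or_pos with rfl | h
    · exact Subsingleton.elim _ _
    · simp [IsUnipotentElt, h.ne']⟩
  mul_mem' ha hb := ⟨⟨G.mul_mem ha.1.1 hb.1.1, (flagStab x).mul_mem ha.1.2 hb.1.2⟩,
    isUnipotentElt_mul_of_mem_flagStab ha.1.2 hb.1.2 ha.2 hb.2⟩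
  inv_mem' ha := ⟨⟨G.inv_mem ha.1.1, (flagStab x).inv_mem ha.1.2⟩, ha.2.inv⟩

theorem IsMaxUnipotentIn.flagUnip_eq {G U : Subgroup (GLn n)} (hU : IsMaxUnipotentIn G U)
    {x : GLn n} (hx : U ≤ flagStab x) : flagUnip G x = U :=
  hU.2 _ ⟨fun _ hg => hg.1.1, fun _ hg => hg.2⟩ fun _ hu => ⟨⟨hU.1.1 hu, hx hu⟩, hU.1.2 _ hu⟩

theorem IsMaxUnipotentIn.mem {G U : Subgroup (GLn n)} (hU : IsMaxUnipotentIn G U)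
    {x : GLn n} (hx : U ≤ flagStab x) {v : GLn n} (hv : v ∈ G) (hvx : v ∈ flagStab x)
    (hvu : IsUnipotentElt v) : v ∈ U := by
  rw [← hU.flagUnip_eq hx]; exact ⟨⟨hv, hvx⟩, hvu⟩

theorem IsMaxUnipotentIn.conj_inv {G U : Subgroup (GLn n)} (hU : IsMaxUnipotentIn G U)
    {g : GLn n} (hg : g ∈ G) (h : ∀ u ∈ U, g * u * g⁻¹ ∈ U) : ∀ u ∈ U, g⁻¹ * u * g ∈ U := by
  have h1 : U.comap (MulAut.conj g).toMonoidHom = U := by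
    refine hU.2 _ ⟨fun v hv => ?_, fun v hv => ?_⟩ fun u hu => h u hu
    · have h2 := hU.1.1 (show g * v * g⁻¹ ∈ U from hv)
      have := G.mul_mem (G.mul_mem (G.inv_mem hg) h2) hg
      have e : g⁻¹ * (g * v * g⁻¹) * g = v := by group
      rwa [e] at this
    · have h2 := (hU.1.2 _ (show g * v * g⁻¹ ∈ U from hv)).conj g⁻¹
      have e : g⁻¹ * (g * v * g⁻¹) * g⁻¹⁻¹ = v := by group
      rwa [e] at h2
  intro u hu
  rw [← h1]
  change g * (g⁻¹ * u * g) * g⁻¹ ∈ U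
  have e : g * (g⁻¹ * u * g) * g⁻¹ = u := by group
  rwa [e]

theorem IsUnipotentElt.pow {u : GLn n} (hu : IsUnipotentElt u) (k : ℕ) :
    IsUnipotentElt (u ^ k) := by
  have hc : Commute (u.1 - 1) (∑ i ∈ Finset.range k, u.1 ^ i) :=
    Commute.sum_right _ _ _ fun i _ =>
      ((Commute.refl u.1).pow_right i).sub_left (Commute.one_left _)
  rw [IsUnipotentElt, Units.val_pow_eq_pow_val, ← mul_geom_sum, hc.mul_pow,
    show (u.1 - 1) ^ n = 0 from hu, zero_mul]

theorem IsUnipotentElt.of_mem_zpowers {u v : GLn n} (hu : IsUnipotentElt u)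
    (hv : v ∈ Subgroup.zpowers u) : IsUnipotentElt v := by
  obtain ⟨k, rfl⟩ := Subgroup.mem_zpowers_iff.1 hv
  obtain ⟨m, rfl | rfl⟩ := k.eq_nat_or_neg
  · rw [zpow_natCast]; exact hu.pow m
  · rw [zpow_neg, zpow_natCast]; exact (hu.pow m).inv

theorem zc_setOf_le_flagStab (U : Subgroup (GLn n)) : ZC (Reg n) {y | U ≤ flagStab y} := by
  have : {y | U ≤ flagStab y} = ⋂ u : U, {y | y⁻¹ * u.1 * y ∈ Tri n} := by
    ext y
    simp only [Set.mem_setOf_eq, Set.mem_iInter, Subtype.forall]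
    exact ⟨fun h u hu => mem_flagStab.1 (h hu), fun h u hu => mem_flagStab.2 (h u hu)⟩
  rw [this]
  refine ZC.iInter fun u => ?_
  have h1 := (zc_Tri (n := n)).preimage ((RegMap.id.inv.mul (RegMap.const _ u.1)).mul RegMap.id)
  exact h1

/-- A unipotent element normalizing a maximal unipotent subgroup lies in it. -/
theorem IsMaxUnipotentIn.mem_of_conj {G U : Subgroup (GLn n)} (hU : IsMaxUnipotentIn G U)
    {x : GLn n} (hx : U ≤ flagStab x) {v : GLn n} (hv : v ∈ G) (hvu : IsUnipotentElt v)
    (h : ∀ u ∈ U, v * u * v⁻¹ ∈ U) : v ∈ U := by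
  have hBC : BC (Subgroup.zpowers v) := bc_of_unipotent fun u hu => hvu.of_mem_zpowers hu
  obtain ⟨c, hc⟩ := hBC.fc.exists_flag (isSolvable_of_comm mul_comm')
  have h' := hU.conj_inv hv h
  have hN : Subgroup.zpowers v ≤ Subgroup.normalizer U := by
    rw [Subgroup.zpowers_le, Subgroup.mem_normalizer_iff]
    refine fun u => ⟨h u, fun hu => ?_⟩
    have := h' _ hu
    have e : v⁻¹ * (v * u * v⁻¹) * v = u := by group
    rwa [e] at this
  obtain ⟨y, hyU, hyv⟩ := exists_fixed_flag hBC hc (zc_setOf_le_flagStab U).isClosed ⟨x, hx⟩ (by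
    constructor
    · intro γ hγ y hy u hu
      rw [mem_flagStab]
      have h1 := hy ((Subgroup.mem_normalizer_iff''.1 (hN hγ) u).1 hu)
      have e : (γ * y)⁻¹ * u * (γ * y) = y⁻¹ * (γ⁻¹ * u * γ) * y := by group
      rw [e]
      exact mem_flagStab.1 h1
    · intro t ht y hy u hu
      have := (mem_flagStab_mul (x := y) (γ := 1) (g := u) ht).2 (by simpa using hy hu)
      simpa using this)
  exact hU.mem hyU hv (hyv (Subgroup.mem_zpowers v)) hvu

/-- The normalizer of a maximal unipotent subgroup of `G` fixes every flag that the subgroup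
fixes and whose `G`-orbit is closed. -/
theorem IsMaxUnipotentIn.mem_flagStab_of_conj {G U : Subgroup (GLn n)}
    (hU : IsMaxUnipotentIn G U) (hG : ZC (Reg n) (G : Set (GLn n)))
    (hirr : Irr (Reg n) (G : Set (GLn n))) {x : GLn n} (hx : ZC (Reg n) (orb G x))
    (hUx : U ≤ flagStab x) {m : GLn n} (hm : m ∈ G) (h : ∀ u ∈ U, m * u * m⁻¹ ∈ U) :
    m ∈ flagStab x := by
  obtain ⟨a, haG, ha, hcon⟩ := exists_contracting hG hirr hx
  obtain ⟨Δ, hΔ, Λ, -, hΔ1, hlu⟩ := ha.exists_lu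
  have h1 : Δ 1 ≠ 0 := hΔ1 1 (by simp)
  obtain ⟨g, hg, hg0, hgm0⟩ : ∃ g ∈ G, Δ g ≠ 0 ∧ Δ (g * m) ≠ 0 := by
    by_contra! hcontra
    rcases hirr.2 Δ hΔ (fun g => Δ (g * m)) ((regMap_mulRight m) _ hΔ) (fun g hg => by
      by_cases h0 : Δ g = 0
      · rw [h0, zero_mul]
      · simp [hcontra g hg h0]) with h2 | h2
    · exact h1 (h2 1 G.one_mem)
    · have := h2 m⁻¹ (G.inv_mem hm)
      simp only [inv_mul_cancel] at this
      exact h1 this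
  obtain ⟨s, u, l, hs, hsl, hu, -⟩ := hlu g hg0
  obtain ⟨s', u', l', hs', hsl', hu', -⟩ := hlu _ hgm0
  obtain ⟨hsG, huG, -⟩ := ha.lu_mem hG haG hg hs hsl hu
  obtain ⟨hsG', huG', -⟩ := ha.lu_mem hG haG (G.mul_mem hg hm) hs' hsl' hu'
  have hsQ := hcon s hsG l hsl
  have hsQ' := hcon s' hsG' l' hsl'
  have hnorm : ∀ q ∈ G, q ∈ flagStab x → ∀ w ∈ U, q * w * q⁻¹ ∈ U := fun q hq hqx w hw =>
    hU.mem hUx (G.mul_mem (G.mul_mem hq (hU.1.1 hw)) (G.inv_mem hq))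
      ((flagStab x).mul_mem ((flagStab x).mul_mem hqx (hUx hw)) ((flagStab x).inv_mem hqx))
      ((hU.1.2 w hw).conj q)
  have hvu : IsUnipotentElt (u⁻¹ * u') := by
    refine isUnipotentElt_of_contr (b := a⁻¹) ?_
    simpa using hu.inv.mul hu'
  have hv : u⁻¹ * u' = s⁻¹ * m * s' := by rw [← hs, ← hs']; group
  have hvU : u⁻¹ * u' ∈ U := by
    refine hU.mem_of_conj hUx (G.mul_mem (G.inv_mem huG) huG') hvu fun w hw => ?_
    have h2 := hnorm s⁻¹ (G.inv_mem hsG) ((flagStab x).inv_mem hsQ) _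
      (h _ (hnorm s' hsG' hsQ' w hw))
    rw [hv]
    have e : s⁻¹ * m * s' * w * (s⁻¹ * m * s')⁻¹ =
      s⁻¹ * (m * (s' * w * s'⁻¹) * m⁻¹) * s⁻¹⁻¹ := by group
    rwa [e]
  have h3 := (flagStab x).mul_mem ((flagStab x).mul_mem hsQ (hUx hvU)) ((flagStab x).inv_mem hsQ')
  rw [hv] at h3
  have e : s * (s⁻¹ * m * s') * s'⁻¹ = m := by group
  rwa [e] at h3

end Unipotent

section Horospherical

variable {n : ℕ}

theorem IsUnipotentElt.mem_of_pow_mem {u : GLn n} (hu : IsUnipotentElt u) {Γ : Subgroup (GLn n)}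
    (hΓ : ZC (Reg n) (Γ : Set (GLn n))) {m : ℕ} (hm : m ≠ 0) (h : u ^ m ∈ Γ) : u ∈ Γ := by
  refine hΓ fun f hf hf0 => ?_
  obtain ⟨p, hp⟩ := exists_poly_pow hu hf
  have hp0 : p = 0 := by
    refine Polynomial.eq_of_infinite_eval_eq _ _ (Set.infinite_of_injective_forall_mem
      (f := fun k : ℕ => ((m * k : ℕ) : ℂ))
      (Nat.cast_injective.comp (mul_right_injective₀ hm)) fun k => ?_)
    rw [Set.mem_setOf_eq, ← hp, pow_mul, hf0 _ (Γ.pow_mem h k), Polynomial.eval_zero]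
  simpa [hp0] using hp 1

/-- Commutators of elements of `G` fixing a flag lie in a maximal unipotent subgroup fixing it. -/
theorem IsMaxUnipotentIn.commutator_mem {G U : Subgroup (GLn n)} (hU : IsMaxUnipotentIn G U)
    {x : GLn n} (hx : U ≤ flagStab x) {g h : GLn n} (hg : g ∈ G) (hgx : g ∈ flagStab x)
    (hh : h ∈ G) (hhx : h ∈ flagStab x) : g * h * g⁻¹ * h⁻¹ ∈ U := by
  refine hU.mem hx (G.mul_mem (G.mul_mem (G.mul_mem hg hh) (G.inv_mem hg)) (G.inv_mem hh))
    ((flagStab x).mul_mem ((flagStab x).mul_mem ((flagStab x).mul_mem hgx hhx)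
    ((flagStab x).inv_mem hgx)) ((flagStab x).inv_mem hhx)) ?_
  have hg' := mem_flagStab.1 hgx
  have hh' := mem_flagStab.1 hhx
  set p := x⁻¹ * g * x
  set q := x⁻¹ * h * x
  have hp := (Tri n).inv_mem hg'
  have hq := (Tri n).inv_mem hh'
  have hpq := (Tri n).mul_mem hg' hh'
  have hinv : ∀ r ∈ Tri n, ∀ i, r.1 i i * r⁻¹.1 i i = 1 := fun r hr i => by
    rw [← diag_mul_of_mem_Tri hr ((Tri n).inv_mem hr), mul_inv_cancel]; simp
  have h1 : IsUnipotentElt (p * q * p⁻¹ * q⁻¹) := by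
    refine (isUnipotentElt_iff_diag ((Tri n).mul_mem ((Tri n).mul_mem hpq hp) hq)).2 fun i => ?_
    rw [diag_mul_of_mem_Tri ((Tri n).mul_mem hpq hp) hq, diag_mul_of_mem_Tri hpq hp,
      diag_mul_of_mem_Tri hg' hh', mul_right_comm (p.1 i i), hinv p hg', one_mul, hinv q hh']
  have e : g * h * g⁻¹ * h⁻¹ = x * (p * q * p⁻¹ * q⁻¹) * x⁻¹ := by
    simp only [p, q]; group
  rw [e]
  exact h1.conj x

/-- A closed irreducible subgroup containing a maximal unipotent subgroup is normalized by the
stabilizer of a flag lying in a closed orbit. -/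
theorem IsMaxUnipotentIn.conj_mem_of_irr {G U K : Subgroup (GLn n)} (hU : IsMaxUnipotentIn G U)
    (hK : ZC (Reg n) (K : Set (GLn n))) (hirr : Irr (Reg n) (K : Set (GLn n))) (hKG : K ≤ G)
    (hUK : U ≤ K) {x : GLn n} (hx : ZC (Reg n) (orb K x)) (hUx : U ≤ flagStab x) {b h : GLn n}
    (hb : b ∈ G) (hbx : b ∈ flagStab x) (hh : h ∈ K) : b⁻¹ * h * b ∈ K := by
  obtain ⟨ι, F, χ, M, -, hMR, hF, hχR, -, hχ, hstab, hne⟩ := exists_chevalley hK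
  have hmul : ∀ h ∈ K, ∀ h' ∈ K, χ (h * h') = χ h * χ h' := fun _ hh _ hh' =>
    char_mul hχ hne hh hh'
  have h1 := char_one hχ hne
  have hconst : ∀ i, χ h * F i (b⁻¹ * h⁻¹ * b) = F i 1 := fun i => by
    obtain ⟨c, hc⟩ := const_of_invariant hK hirr hx (f := fun h => χ h * F i (b⁻¹ * h⁻¹ * b))
      (mul_mem_fun hχR
        ((((RegMap.const _ b⁻¹).mul RegMap.id.inv).mul (RegMap.const _ b)) _ (hMR _ (hF i))))
      fun γ hγ q hq hqx => by
        have hu := hU.commutator_mem hUx (hKG hq) hqx (G.inv_mem hb) ((flagStab x).inv_mem hbx)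
        rw [inv_inv] at hu
        have hqi := K.inv_mem hq
        have e : b⁻¹ * (γ * q)⁻¹ * b =
            q⁻¹ * (q * b⁻¹ * q⁻¹ * b) * (b⁻¹ * γ⁻¹ * b) := by group
        have h2 : χ q * χ q⁻¹ = 1 := by rw [← hmul _ hq _ hqi, mul_inv_cancel, h1]
        rw [e, hχ _ (K.mul_mem hqi (hUK hu)), hmul _ hqi _ (hUK hu), hmul _ hγ _ hq,
          (hU.1.2 _ hu).char_eq_one (hUK hu) hχR h1 hmul]
        linear_combination χ γ * F i (b⁻¹ * γ⁻¹ * b) * h2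
    have h3 := hc h hh
    have h4 := hc 1 K.one_mem
    simp only [inv_one, mul_one, inv_mul_cancel, h1, one_mul] at h4
    rw [h4]; exact h3
  have hχ0 : χ h⁻¹ * χ h = 1 := by rw [← hmul _ (K.inv_mem hh) _ hh, inv_mul_cancel, h1]
  have h5 := K.inv_mem (hstab (b⁻¹ * h⁻¹ * b) (χ h⁻¹) fun i => by
    linear_combination χ h⁻¹ * hconst i - F i (b⁻¹ * h⁻¹ * b) * hχ0)
  have e : (b⁻¹ * h⁻¹ * b)⁻¹ = b⁻¹ * h * b := by group
  rwa [e] at h5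

/-- A closed subgroup containing a maximal unipotent subgroup `U` is normalized by every Borel
subgroup containing `U`. -/
theorem IsMaxUnipotentIn.conj_mem {G B U H : Subgroup (GLn n)} (hU : IsMaxUnipotentIn G U)
    (hG : ZC (Reg n) (G : Set (GLn n))) (hGi : Irr (Reg n) (G : Set (GLn n))) (hBG : B ≤ G)
    (hB : ZC (Reg n) (B : Set (GLn n))) (hBi : Irr (Reg n) (B : Set (GLn n)))
    (hBs : IsSolvable B) (hUB : U ≤ B) (hHG : H ≤ G) (hH : ZC (Reg n) (H : Set (GLn n)))
    (hUH : U ≤ H) : (∀ b ∈ B, ∀ h ∈ H, b⁻¹ * h * b ∈ H) ∧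
      ∀ b ∈ B, ∀ b' ∈ B, b * b' * b⁻¹ * b'⁻¹ ∈ H := by
  obtain ⟨y₀, -, hy₀⟩ := exists_closed_orb hG (zc_univ (Reg n)) ⟨1, trivial⟩
    ⟨fun _ _ _ _ => trivial, fun _ _ _ _ => trivial⟩
  obtain ⟨c, hc⟩ := (fc_of_irr hBi).exists_flag hBs
  obtain ⟨y, hyY, hyB⟩ := exists_fixed_flag (bc_of_irr hB hBi) hc hy₀.isClosed ⟨y₀, mem_orb G y₀⟩
    ⟨fun γ hγ => (orb_stable G y₀).1 γ (hBG hγ), (orb_stable G y₀).2⟩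
  obtain ⟨K, hKH, hK, hKi, hKirr, hKn⟩ := exists_irr_subgroup hH
  have hKG := hKH.trans hHG
  have hUK : U ≤ K := fun u hu => by
    obtain ⟨m, hm, -, hmK⟩ := Subgroup.exists_pow_mem_of_relIndex_ne_zero hKi (hUH hu)
    exact (hU.1.2 u hu).mem_of_pow_mem hK hm.ne' hmK.1
  obtain ⟨x₀, hx₀Y, hx₀⟩ := exists_closed_orb hK hy₀ ⟨y₀, mem_orb G y₀⟩
    ⟨fun γ hγ => (orb_stable G y₀).1 γ (hKG hγ), (orb_stable G y₀).2⟩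
  obtain ⟨x, hxX, hUx⟩ := exists_fixed_flag (bc_of_unipotent hU.1.2) (hUB.trans hc) hx₀.isClosed
    ⟨x₀, mem_orb K x₀⟩ ⟨fun γ hγ => (orb_stable K x₀).1 γ (hUK hγ), (orb_stable K x₀).2⟩
  have hKx : orb K x = orb K x₀ := orb_eq_of_mem hxX
  have hxY : x ∈ orb G y₀ := by
    obtain ⟨k, hk, t, ht, rfl⟩ := hxX
    exact (orb_stable G y₀).2 t ht _ ((orb_stable G y₀).1 k (hKG hk) _ hx₀Y)
  have hGx : orb G x = orb G y₀ := orb_eq_of_mem hxY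
  rw [← hKx] at hx₀
  rw [← hGx] at hy₀ hyY
  have hfix : ∀ m ∈ G, (∀ u ∈ U, m * u * m⁻¹ ∈ flagStab x) → m ∈ flagStab x := fun m hm h =>
    hU.mem_flagStab_of_conj hG hGi hy₀ hUx hm fun u hu =>
      hU.mem hUx (G.mul_mem (G.mul_mem hm (hU.1.1 hu)) (G.inv_mem hm)) (h u hu)
        ((hU.1.2 u hu).conj m)
  have hBx : B ≤ flagStab x := by
    obtain ⟨g, hg, t, ht, rfl⟩ := hyY
    have h1 : ∀ b ∈ B, g⁻¹ * b * g ∈ flagStab x := fun b hb => (mem_flagStab_mul ht).1 (hyB hb)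
    have h2 := hfix g⁻¹ (G.inv_mem hg) fun u hu => by rw [inv_inv]; exact h1 u (hUB hu)
    intro b hb
    have h3 := (flagStab x).mul_mem ((flagStab x).mul_mem ((flagStab x).inv_mem h2) (h1 b hb)) h2
    have e : g⁻¹⁻¹ * (g⁻¹ * b * g) * g⁻¹ = b := by group
    rwa [e] at h3
  refine ⟨fun b hb h hh => ?_, fun b hb b' hb' =>
    hUH (hU.commutator_mem hUx (hBG hb) (hBx hb) (hBG hb') (hBx hb'))⟩
  have hV : ∀ v ∈ U.map (MulAut.conj h).toMonoidHom, ∃ u ∈ U, v = h * u * h⁻¹ := by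
    rintro _ ⟨u, hu, rfl⟩
    exact ⟨u, hu, rfl⟩
  obtain ⟨z, hzX, hz⟩ := exists_fixed_flag (Γ := U.map (MulAut.conj h).toMonoidHom) (c := h * c)
    (bc_of_unipotent fun v hv => by
      obtain ⟨u, hu, rfl⟩ := hV v hv
      exact (hU.1.2 u hu).conj h)
    (fun v hv => by
      obtain ⟨u, hu, rfl⟩ := hV v hv
      have h1 := mem_flagStab.1 (hc (hUB hu))
      rw [mem_flagStab]
      have e : (h * c)⁻¹ * (h * u * h⁻¹) * (h * c) = c⁻¹ * u * c := by group
      rwa [e]) hx₀.isClosed ⟨x, mem_orb K x⟩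
    ⟨fun v hv => by
      obtain ⟨u, hu, rfl⟩ := hV v hv
      exact (orb_stable K x).1 _ (hKn h hh u (hUK hu)), (orb_stable K x).2⟩
  obtain ⟨k, hk, t, ht, rfl⟩ := hzX
  have hm : k⁻¹ * h ∈ H := H.mul_mem (H.inv_mem (hKH hk)) hh
  have hmx := hfix _ (hHG hm) fun u hu => by
    have h1 := (mem_flagStab_mul ht).1 (hz ⟨u, hu, rfl⟩)
    have e : k⁻¹ * h * u * (k⁻¹ * h)⁻¹ = k⁻¹ * (h * u * h⁻¹) * k := by group
    rw [e]
    exact h1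
  have h1 := hKH (hU.conj_mem_of_irr hK hKirr hKG hUK hx₀ hUx (hBG hb) (hBx hb) hk)
  have h2 := hUH (hU.commutator_mem hUx (G.inv_mem (hHG hm)) ((flagStab x).inv_mem hmx)
    (G.inv_mem (hBG hb)) ((flagStab x).inv_mem (hBx hb)))
  have e : b⁻¹ * h * b = b⁻¹ * k * b * (k⁻¹ * h *
      ((k⁻¹ * h)⁻¹ * b⁻¹ * (k⁻¹ * h)⁻¹⁻¹ * b⁻¹⁻¹)) := by group
  rw [e]
  exact H.mul_mem h1 (H.mul_mem hm h2)

/-- The product of `H` with a subgroup normalizing it. -/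
def mulSubgroup (H B : Subgroup (GLn n)) (h : ∀ b ∈ B, ∀ h ∈ H, b⁻¹ * h * b ∈ H) :
    Subgroup (GLn n) where
  carrier := {g | ∃ h ∈ H, ∃ b ∈ B, g = h * b}
  one_mem' := ⟨1, H.one_mem, 1, B.one_mem, by simp⟩
  mul_mem' := by
    rintro _ _ ⟨p, hp, b, hb, rfl⟩ ⟨q, hq, c, hc, rfl⟩
    have := h _ (B.inv_mem hb) q hq
    exact ⟨p * (b⁻¹⁻¹ * q * b⁻¹), H.mul_mem hp this, b * c, B.mul_mem hb hc, by group⟩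
  inv_mem' := by
    rintro _ ⟨p, hp, b, hb, rfl⟩
    exact ⟨b⁻¹ * p⁻¹ * b, h b hb _ (H.inv_mem hp), b⁻¹, B.inv_mem hb, by group⟩

theorem commutator_zclSubgroup_le {H P : Subgroup (GLn n)} (hH : ZC (Reg n) (H : Set (GLn n)))
    (h : ∀ g ∈ P, ∀ g' ∈ P, g * g' * g⁻¹ * g'⁻¹ ∈ H) :
    ⁅zclSubgroup P, zclSubgroup P⁆ ≤ H := by
  have h1 : ∀ g' ∈ P, ∀ g ∈ zclSubgroup P, g * g' * g⁻¹ * g'⁻¹ ∈ H := fun g' hg' =>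
    zcl_min (hH.preimage (((RegMap.id.mul (RegMap.const _ g')).mul RegMap.id.inv).mul
      (RegMap.const _ g'⁻¹))) fun g hg => h g hg g' hg'
  have h2 : ∀ g ∈ zclSubgroup P, ∀ g' ∈ zclSubgroup P, g * g' * g⁻¹ * g'⁻¹ ∈ H := fun g hg =>
    zcl_min (hH.preimage ((((RegMap.const _ g).mul RegMap.id).mul (RegMap.const _ g⁻¹)).mul
      RegMap.id.inv)) fun g' hg' => h1 g' hg' g hg
  exact Subgroup.commutator_le.2 fun g hg g' hg' => h2 g hg g' hg'

end Horospherical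

/-- let `G` be a connected reductive group with Borel subgroup `B` and `U` the
maximal unipotent subgroup of `B`.  If `H` is a (Zariski-closed) subgroup of `G` containing
`U` (a horospherical subgroup), then there is a parabolic subgroup `P` of `G` with
`P' ≤ H ≤ P`, where `P' = ⁅P, P⁆` is the commutator subgroup of `P`. -/
theorem horospherical_between_parabolic_and_derived {n : ℕ}
    (G B U H : Subgroup (GLn n))
    (hG : IsConnectedReductive G)
    (hB : IsBorelIn G B)
    (hU : IsMaxUnipotentIn G U) (hUB : U ≤ B)
    (hHG : H ≤ G) (hHalg : IsAlgebraicSubset (H : Set (GLn n)))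
    (hUH : U ≤ H) :
    ∃ P : Subgroup (GLn n), IsParabolicIn G P ∧ ⁅P, P⁆ ≤ H ∧ H ≤ P := by
  have hGz := isAlgebraicSubset_iff.1 hG.1
  have hHz := isAlgebraicSubset_iff.1 hHalg
  obtain ⟨hBG, hBalg, hBc, hBs⟩ := hB.1
  obtain ⟨hnorm, hcomm⟩ := hU.conj_mem hGz (irr_of_isZConnected hG.1 hG.2.1) hBG
    (isAlgebraicSubset_iff.1 hBalg) (irr_of_isZConnected hBalg hBc) hBs hUB hHG hHz hUH
  set P := mulSubgroup H B hnorm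
  have hHP : H ≤ P := fun h hh => ⟨h, hh, 1, B.one_mem, by simp⟩
  have hBP : B ≤ P := fun b hb => ⟨1, H.one_mem, b, hb, by simp⟩
  have hPG : P ≤ G := by
    rintro _ ⟨h, hh, b, hb, rfl⟩
    exact G.mul_mem (hHG hh) (hBG hb)
  refine ⟨zclSubgroup P, ⟨zclSubgroup_le hGz hPG, isAlgebraicSubset_iff.2 (zc_zclSubgroup P), B, hB,
    hBP.trans (le_zclSubgroup P)⟩, commutator_zclSubgroup_le hHz ?_, hHP.trans (le_zclSubgroup P)⟩
  rintro _ ⟨p, hp, b, hb, rfl⟩ _ ⟨q, hq, c, hc, rfl⟩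
  have h1 := hnorm _ (B.inv_mem hb) q hq
  have h2 := hnorm (b * c⁻¹ * b⁻¹) (B.mul_mem (B.mul_mem hb (B.inv_mem hc)) (B.inv_mem hb)) _
    (H.inv_mem hp)
  have e : p * b * (q * c) * (p * b)⁻¹ * (q * c)⁻¹ = p * (b⁻¹⁻¹ * q * b⁻¹) *
      ((b * c⁻¹ * b⁻¹)⁻¹ * p⁻¹ * (b * c⁻¹ * b⁻¹)) * (b * c * b⁻¹ * c⁻¹) * q⁻¹ := by group
  rw [e]
  exact H.mul_mem (H.mul_mem (H.mul_mem (H.mul_mem hp h1) h2) (hcomm b hb c hc)) (H.inv_mem hq)
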